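/- arXiv:2310.17795 — 4 statements merged into one kernel-verified Lean document; each statement's English description precedes it below -/
import Mathlib

section
/- For every nonnegative integer w, there exists a positive integer N such that for every integer m ≥ 2, every graph G with tree-width at most w, and every m-list-assignment L of G, there exist at least m^{|V(G)|/(w+1)} different L-colorings of G with weak diameter in G at most N. -/
open SimpleGraph

universe u

/-- `a` and `b` lie in a common monochromatic component of the coloring `c`
restricted to the set `S` of colored vertices. -/
def MonoReach {β : Type*} {α : Type*} (G : SimpleGraph β) (S : Set β) (c : β → α)
    (a b : β) : Prop :=
  ∃ w : G.Walk a b, ∀ v ∈ w.support, v ∈ S ∧ c v = c a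

/-- The coloring `c` (with domain `S`) has weak diameter in `G` at most `N`. -/
def HasWeakDiamLE {β : Type*} {α : Type*} (G : SimpleGraph β) (S : Set β) (c : β → α)
    (N : ℕ) : Prop :=
  ∀ a b : β, MonoReach G S c a b → G.dist a b ≤ N

/-- `(T, X)` is a tree-decomposition of `G`. -/
def IsTreeDecomp {V : Type*} {ι : Type*} (G : SimpleGraph V) (T : SimpleGraph ι)
    (X : ι → Set V) : Prop :=
  T.IsTree ∧
  (∀ v : V, ∃ t, v ∈ X t) ∧
  (∀ ⦃a b : V⦄, G.Adj a b → ∃ t, a ∈ X t ∧ b ∈ X t) ∧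
  (∀ v : V, (T.induce {t | v ∈ X t}).Connected)

/-- `G` has tree-width at most `w`. -/
def TreewidthLE {V : Type*} (G : SimpleGraph V) (w : ℕ) : Prop :=
  ∃ (ι : Type) (_ : Fintype ι) (T : SimpleGraph ι) (X : ι → Set V),
    IsTreeDecomp G T X ∧ ∀ t, (X t).ncard ≤ w + 1

/-! ### Paths inside a set -/

/-- `a` and `b` are joined by a sequence of `E`-steps inside `W`. -/
def Linked {V : Type*} (E : V → V → Prop) (W : Set V) : V → V → Prop :=
  Relation.ReflTransGen (fun x y => x ∈ W ∧ y ∈ W ∧ E x y)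

section Linked

variable {V : Type*} {E F : V → V → Prop} {W W' : Set V} {a b c : V}

theorem Linked.refl : Linked E W a a := Relation.ReflTransGen.refl

theorem Linked.trans (h : Linked E W a b) (h' : Linked E W b c) : Linked E W a c :=
  Relation.ReflTransGen.trans h h'

theorem Linked.tail (h : Linked E W a b) (hb : b ∈ W) (hc : c ∈ W) (hE : E b c) :
    Linked E W a c :=
  Relation.ReflTransGen.tail h ⟨hb, hc, hE⟩

theorem Linked.single (ha : a ∈ W) (hb : b ∈ W) (hE : E a b) : Linked E W a b :=
  Linked.refl.tail ha hb hE

theorem Linked.mono (hW : W ⊆ W') (hE : ∀ x y, E x y → F x y) (h : Linked E W a b) :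
    Linked F W' a b := by
  induction h with
  | refl => exact Linked.refl
  | tail _ hs ih => exact ih.tail (hW hs.1) (hW hs.2.1) (hE _ _ hs.2.2)

theorem Linked.symm (hE : ∀ x y, E x y → E y x) (h : Linked E W a b) : Linked E W b a := by
  induction h with
  | refl => exact Linked.refl
  | tail _ hs ih => exact (Linked.single hs.2.1 hs.1 (hE _ _ hs.2.2)).trans ih

theorem Linked.mem (h : Linked E W a b) (ha : a ∈ W) : b ∈ W := by
  induction h with
  | refl => exact ha
  | tail _ hs _ => exact hs.2.1

/-- A sequence starting in `P` is split at its last visit to `P`. -/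
theorem Linked.last_visit {P : Set V} (h : Linked E W a b) (ha : a ∈ P) (haW : a ∈ W) :
    ∃ x ∈ P, x ∈ W ∧ (x = b ∨ ∃ y ∈ W \ P, E x y ∧ Linked E (W \ P) y b) := by
  induction h with
  | refl => exact ⟨a, ha, haW, Or.inl rfl⟩
  | @tail b c hab hs ih =>
    obtain ⟨hb, hc, hE⟩ := hs
    by_cases hcP : c ∈ P
    · exact ⟨c, hcP, hc, Or.inl rfl⟩
    · obtain ⟨x, hxP, hxW, rfl | ⟨y, hy, hxy, hyb⟩⟩ := ih
      · exact ⟨x, hxP, hxW, Or.inr ⟨c, ⟨hc, hcP⟩, hE, Linked.refl⟩⟩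
      · exact ⟨x, hxP, hxW, Or.inr ⟨y, hy, hxy, hyb.tail (hyb.mem hy) ⟨hc, hcP⟩ hE⟩⟩

/-- A sequence inside `W` stays among the vertices that it reaches. -/
theorem Linked.within (h : Linked E W a b) :
    Linked E {v | v ∈ W ∧ Linked E W a v} a b := by
  induction h with
  | refl => exact Linked.refl
  | tail hab hs ih => exact ih.tail ⟨hs.1, hab⟩ ⟨hs.2.1, Linked.tail hab hs.1 hs.2.1 hs.2.2⟩ hs.2.2

theorem Linked.eq_or_mem (h : Linked E W a b) : a = b ∨ a ∈ W := by
  rcases Relation.ReflTransGen.cases_head h with h' | ⟨z, hz, -⟩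
  · exact Or.inl h'
  · exact Or.inr hz.1

/-- Any two vertices of `W` are joined inside `W`. -/
def LinkedSet (E : V → V → Prop) (W : Set V) : Prop :=
  ∀ x ∈ W, ∀ y ∈ W, Linked E W x y

theorem LinkedSet.exists_step (h : LinkedSet E W) {x y : V} (hx : x ∈ W) (hy : y ∈ W)
    (hne : x ≠ y) : ∃ z ∈ W, E x z := by
  rcases Relation.ReflTransGen.cases_head (h x hx y hy) with h' | ⟨z, hz, -⟩
  · exact absurd h' hne
  · exact ⟨z, hz.2.1, hz.2.2⟩

end Linked

/-! ### Simplicial vertices -/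

section Simplicial

variable {V : Type*} {H : SimpleGraph V}

/-- The neighbors of `v` in `A` are pairwise adjacent. -/
def SimplicialIn (H : SimpleGraph V) (A : Set V) (v : V) : Prop :=
  ∀ x ∈ A, ∀ y ∈ A, H.Adj v x → H.Adj v y → x ≠ y → H.Adj x y

/-- Every nonempty finite set of vertices induces a subgraph with a simplicial vertex. -/
def HereditarilySimplicial (H : SimpleGraph V) : Prop :=
  ∀ A : Finset V, A.Nonempty → ∃ v ∈ A, SimplicialIn H (A : Set V) v

theorem SimplicialIn.mono {A B : Set V} {v : V} (h : SimplicialIn H A v) (hBA : B ⊆ A) :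
    SimplicialIn H B v :=
  fun x hx y hy => h x (hBA hx) y (hBA hy)

theorem LinkedSet.diff_simplicial {W : Set V} {v : V} (hW : LinkedSet H.Adj W)
    (hv : SimplicialIn H W v) : LinkedSet H.Adj (W \ {v}) := by
  intro x hx y hy
  have key : ∀ z, Linked H.Adj W x z →
      (z ≠ v → Linked H.Adj (W \ {v}) x z) ∧
      (z = v → ∃ u ∈ W \ {v}, H.Adj u v ∧ Linked H.Adj (W \ {v}) x u) := by
    intro z hz
    induction hz with
    | refl => exact ⟨fun _ => Linked.refl, fun h => absurd h hx.2⟩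
    | @tail b c hab hs ih =>
      obtain ⟨hb, hc, hE⟩ := hs
      by_cases hbv : b = v
      · subst hbv
        obtain ⟨u, hu, hub, hxu⟩ := ih.2 rfl
        refine ⟨fun hcv => ?_, fun hcv => absurd hcv.symm hE.ne⟩
        by_cases huc : u = c
        · exact huc ▸ hxu
        · exact hxu.tail hu ⟨hc, hcv⟩ (hv u hu.1 c hc hub.symm hE huc)
      · refine ⟨fun hcv => (ih.1 hbv).tail ⟨hb, hbv⟩ ⟨hc, hcv⟩ hE, fun hcv => ?_⟩
        subst hcv
        exact ⟨b, ⟨hb, hbv⟩, hE, ih.1 hbv⟩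
  exact (key y (hW x hx.1 y hy.1)).1 hy.2

/-- A simplicial vertex `v` of `W` can be replaced, as a neighbor, by another vertex of `W`. -/
theorem LinkedSet.exists_adj_diff_simplicial {W A : Set V} {v x y : V}
    (hW : LinkedSet H.Adj W) (hWA : W ⊆ A) (hv : SimplicialIn H A v) (hvW : v ∈ W)
    (hy : y ∈ W) (hyv : y ≠ v) (hxA : x ∈ A) (hxW : x ∉ W) (hx : ∃ z ∈ W, H.Adj x z) :
    ∃ z ∈ W \ {v}, H.Adj x z := by
  obtain ⟨z, hz, hxz⟩ := hx
  by_cases hzv : z = v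
  · subst hzv
    obtain ⟨u, hu, hzu⟩ := hW.exists_step hvW hy hyv.symm
    refine ⟨u, ⟨hu, hzu.ne'⟩, hv x hxA u (hWA hu) hxz.symm hzu ?_⟩
    rintro rfl
    exact hxW hu
  · exact ⟨z, ⟨hz, hzv⟩, hxz⟩

theorem HereditarilySimplicial.exists_common_neighbor (hH : HereditarilySimplicial H)
    (K Z : Finset V) (hZ : LinkedSet H.Adj (Z : Set V)) (hne : Z.Nonempty)
    (hK : H.IsClique (K : Set V)) (hKZ : ∀ x ∈ K, x ∉ Z) (hadj : ∀ x ∈ K, ∃ z ∈ Z, H.Adj x z) :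
    ∃ z ∈ Z, ∀ x ∈ K, H.Adj x z := by
  classical
  induction hn : Z.card generalizing Z with
  | zero => simp_all
  | succ n ih =>
    obtain ⟨v, hvm, hv⟩ := hH (Z ∪ K) (hne.mono Finset.subset_union_left)
    have hZs : (Z : Set V) ⊆ ((Z ∪ K : Finset V) : Set V) := by simp
    rcases Finset.mem_union.1 hvm with hvZ | hvK
    · by_cases hone : ∃ y ∈ Z, y ≠ v
      · obtain ⟨y, hy, hyv⟩ := hone
        have hstep : ∀ x ∈ K, ∃ z ∈ Z.erase v, H.Adj x z := by
          intro x hx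
          obtain ⟨z, hz, hxz⟩ := hZ.exists_adj_diff_simplicial hZs hv hvZ hy hyv
            (x := x) (by simp [hx]) (by simpa using hKZ x hx) (by simpa using hadj x hx)
          exact ⟨z, by simpa [and_comm] using hz, hxz⟩
        obtain ⟨z, hz, hzK⟩ := ih (Z.erase v)
          (by simpa using hZ.diff_simplicial (hv.mono hZs)) ⟨y, by simp [hy, hyv]⟩
          (fun x hx h => hKZ x hx (Finset.mem_of_mem_erase h)) hstep
          (by rw [Finset.card_erase_of_mem hvZ, hn]; rfl)
        exact ⟨z, Finset.mem_of_mem_erase hz, hzK⟩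
      · push Not at hone
        refine ⟨v, hvZ, fun x hx => ?_⟩
        obtain ⟨z, hz, hxz⟩ := hadj x hx
        exact hone z hz ▸ hxz
    · obtain ⟨z, hz, hvz⟩ := hadj v hvK
      refine ⟨z, hz, fun x hx => ?_⟩
      by_cases hxv : x = v
      · exact hxv ▸ hvz
      · refine hv x (by simp [hx]) z (by simp [hz]) (hK hvK hx (Ne.symm hxv)) hvz ?_
        rintro rfl
        exact hKZ x hx hz

theorem HereditarilySimplicial.adj_of_separated (hH : HereditarilySimplicial H) {x y : V}
    (hxy : x ≠ y) (Z C : Finset V)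
    (hZ : LinkedSet H.Adj (Z : Set V)) (hC : LinkedSet H.Adj (C : Set V))
    (hZC : ∀ z ∈ Z, ∀ c ∈ C, z ≠ c ∧ ¬ H.Adj z c)
    (hxZ : x ∉ Z) (hyZ : y ∉ Z) (hxC : x ∉ C) (hyC : y ∉ C)
    (hxZ' : ∃ z ∈ Z, H.Adj x z) (hyZ' : ∃ z ∈ Z, H.Adj y z)
    (hxC' : ∃ z ∈ C, H.Adj x z) (hyC' : ∃ z ∈ C, H.Adj y z) : H.Adj x y := by
  classical
  induction hn : Z.card + C.card using Nat.strong_induction_on generalizing Z C with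
  | _ n ih =>
    subst hn
    obtain ⟨v, hvm, hv⟩ := hH (Z ∪ C ∪ {x, y}) ⟨x, by simp⟩
    have hZs : (Z : Set V) ⊆ ((Z ∪ C ∪ {x, y} : Finset V) : Set V) := by
      intro z hz; simp at hz; simp [hz]
    have hCs : (C : Set V) ⊆ ((Z ∪ C ∪ {x, y} : Finset V) : Set V) := by
      intro z hz; simp at hz; simp [hz]
    have hout : ∀ a, a = x ∨ a = y → ¬ SimplicialIn H ((Z ∪ C ∪ {x, y} : Finset V) : Set V) a := by
      intro a ha hs
      obtain ⟨z, hz, haz⟩ : ∃ z ∈ Z, H.Adj a z := by rcases ha with rfl | rfl <;> assumption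
      obtain ⟨c, hc, hac⟩ : ∃ c ∈ C, H.Adj a c := by rcases ha with rfl | rfl <;> assumption
      exact (hZC z hz c hc).2 (hs z (hZs hz) c (hCs hc) haz hac (hZC z hz c hc).1)
    have shrink : ∀ W : Finset V, LinkedSet H.Adj (W : Set V) → v ∈ W →
        (W : Set V) ⊆ ((Z ∪ C ∪ {x, y} : Finset V) : Set V) → x ∉ W → y ∉ W →
        (∃ z ∈ W, H.Adj x z) → (∃ z ∈ W, H.Adj y z) → H.Adj x y ∨
        (LinkedSet H.Adj ((W.erase v : Finset V) : Set V) ∧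
          (∃ z ∈ W.erase v, H.Adj x z) ∧ ∃ z ∈ W.erase v, H.Adj y z) := by
      intro W hW hvW hWs hxW hyW hxW' hyW'
      by_cases hone : ∃ u ∈ W, u ≠ v
      · obtain ⟨u, hu, huv⟩ := hone
        refine Or.inr ⟨by simpa using hW.diff_simplicial (hv.mono hWs), ?_, ?_⟩
        · obtain ⟨z, hz, hxz⟩ := hW.exists_adj_diff_simplicial hWs hv hvW hu huv
            (x := x) (by simp) (by simpa using hxW) (by simpa using hxW')
          exact ⟨z, by simpa [and_comm] using hz, hxz⟩
        · obtain ⟨z, hz, hyz⟩ := hW.exists_adj_diff_simplicial hWs hv hvW hu huv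
            (x := y) (by simp) (by simpa using hyW) (by simpa using hyW')
          exact ⟨z, by simpa [and_comm] using hz, hyz⟩
      · push Not at hone
        obtain ⟨z, hz, hxz⟩ := hxW'
        obtain ⟨z', hz', hyz⟩ := hyW'
        rw [hone z hz] at hxz
        rw [hone z' hz'] at hyz
        exact Or.inl (hv x (by simp) y (by simp) hxz.symm hyz.symm hxy)
    rcases Finset.mem_union.1 hvm with hvm | hvm
    · rcases Finset.mem_union.1 hvm with hvZ | hvC
      · rcases shrink Z hZ hvZ hZs hxZ hyZ hxZ' hyZ' with h | ⟨h1, h2, h3⟩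
        · exact h
        · exact ih _ (Nat.add_lt_add_right (Finset.card_erase_lt_of_mem hvZ) _) (Z.erase v) C h1 hC
            (fun z hz => hZC z (Finset.mem_of_mem_erase hz))
            (fun h => hxZ (Finset.mem_of_mem_erase h)) (fun h => hyZ (Finset.mem_of_mem_erase h))
            hxC hyC h2 h3 hxC' hyC' rfl
      · rcases shrink C hC hvC hCs hxC hyC hxC' hyC' with h | ⟨h1, h2, h3⟩
        · exact h
        · exact ih _ (Nat.add_lt_add_left (Finset.card_erase_lt_of_mem hvC) _) Z (C.erase v) hZ h1
            (fun z hz c hc => hZC z hz c (Finset.mem_of_mem_erase hc)) hxZ hyZ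
            (fun h => hxC (Finset.mem_of_mem_erase h)) (fun h => hyC (Finset.mem_of_mem_erase h))
            hxZ' hyZ' h2 h3 rfl
    · exact absurd hv (hout v (by simpa using hvm))

end Simplicial

/-! ### Bounded distance -/

section Near

variable {V : Type*} {G H : SimpleGraph V} {m n : ℕ} {u v w : V}

/-- `u` and `v` are joined by a walk of length at most `n` in `G`. -/
def Near (G : SimpleGraph V) (n : ℕ) (u v : V) : Prop :=
  ∃ p : G.Walk u v, p.length ≤ n

theorem Near.refl : Near G n u u := ⟨Walk.nil, by simp⟩

theorem Near.symm (h : Near G n u v) : Near G n v u :=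
  h.imp' Walk.reverse fun p hp => by simpa using hp

theorem Near.mono (h : Near G m u v) (hmn : m ≤ n) : Near G n u v :=
  h.imp fun _ hp => hp.trans hmn

theorem Near.trans (h : Near G m u v) (h' : Near G n v w) : Near G (m + n) u w := by
  obtain ⟨p, hp⟩ := h
  obtain ⟨q, hq⟩ := h'
  exact ⟨p.append q, by rw [Walk.length_append]; omega⟩

/-- Adjacency in `H` between vertices at distance at most `D` in `G`. -/
def NearAdj (G H : SimpleGraph V) (D : ℕ) (u v : V) : Prop :=
  H.Adj u v ∧ Near G D u v

theorem NearAdj.symm {D : ℕ} (h : NearAdj G H D u v) : NearAdj G H D v u :=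
  ⟨h.1.symm, h.2.symm⟩

theorem NearAdj.mono {D D' : ℕ} (hD : D ≤ D') (h : NearAdj G H D u v) : NearAdj G H D' u v :=
  ⟨h.1, h.2.mono hD⟩

/-- A linked set covered by few balls has small diameter. -/
theorem near_of_linked_of_cover {E : V → V → Prop} {D r : ℕ} (hE : ∀ x y, E x y → Near G D x y)
    (S : Finset V) (W : Set V) (hW : ∀ v ∈ W, ∃ s ∈ S, Near G r s v) {a b : V}
    (ha : a ∈ W) (h : Linked E W a b) : Near G (S.card * (2 * r + D)) a b := by
  classical
  induction hn : S.card generalizing S W a with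
  | zero =>
    obtain ⟨s, hs, -⟩ := hW a ha
    simp_all
  | succ n ih =>
    obtain ⟨s, hs, hsa⟩ := hW a ha
    obtain ⟨x, hx, hxW, rfl | ⟨y, hy, hxy, hyb⟩⟩ :=
      h.last_visit (P := {v | Near G r s v}) hsa ha
    · refine (hsa.symm.trans hx).mono ?_
      nlinarith
    · have hrest := ih (S.erase s) (W \ {v | Near G r s v}) (fun v hv => by
        obtain ⟨t, ht, htv⟩ := hW v hv.1
        refine ⟨t, Finset.mem_erase.2 ⟨?_, ht⟩, htv⟩
        rintro rfl
        exact hv.2 htv) hy hyb (by rw [Finset.card_erase_of_mem hs, hn]; rfl)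
      refine (((hsa.symm.trans hx).trans (hE _ _ hxy)).trans hrest).mono ?_
      nlinarith

end Near

/-! ### Layers around a set -/

section Layer

variable {V : Type*} {E : V → V → Prop} {A S : Finset V}

open Classical in
/-- The vertices of `A` reached from `S` by at most `i` steps along `E` inside `A`. -/
noncomputable def layer (E : V → V → Prop) (A S : Finset V) : ℕ → Finset V
  | 0 => S
  | i + 1 => A.filter fun v => v ∈ layer E A S i ∨ ∃ u ∈ layer E A S i, E u v

theorem layer_subset (hSA : S ⊆ A) : ∀ i, layer E A S i ⊆ A
  | 0 => hSA
  | _ + 1 => fun v hv => by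
    simp only [layer, Finset.mem_filter] at hv
    exact hv.1

theorem layer_mono (hSA : S ⊆ A) : Monotone (layer E A S) :=
  monotone_nat_of_le_succ fun i v hv => by
    simp only [layer, Finset.mem_filter]
    exact ⟨layer_subset hSA i hv, Or.inl hv⟩

theorem mem_layer_succ {i : ℕ} {u v : V} (hu : u ∈ layer E A S i) (hv : v ∈ A) (h : E u v) :
    v ∈ layer E A S (i + 1) := by
  simp only [layer, Finset.mem_filter]
  exact ⟨hv, Or.inr ⟨u, hu, h⟩⟩

theorem near_of_mem_layer {G : SimpleGraph V} {D : ℕ} (hE : ∀ x y, E x y → Near G D x y) :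
    ∀ {i : ℕ} {v : V}, v ∈ layer E A S i → ∃ s ∈ S, Near G (i * D) s v
  | 0, v, hv => ⟨v, hv, Near.refl⟩
  | i + 1, v, hv => by
    simp only [layer, Finset.mem_filter] at hv
    obtain ⟨-, hv | ⟨u, hu, huv⟩⟩ := hv
    · obtain ⟨s, hs, h⟩ := near_of_mem_layer hE hv
      exact ⟨s, hs, h.mono (by nlinarith)⟩
    · obtain ⟨s, hs, h⟩ := near_of_mem_layer hE hu
      exact ⟨s, hs, (h.trans (hE _ _ huv)).mono (by nlinarith)⟩

theorem linked_of_mem_layer (hSA : S ⊆ A) {n : ℕ} :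
    ∀ {i : ℕ} {v : V}, i ≤ n → v ∈ layer E A S i →
      ∃ s ∈ S, Linked E (layer E A S n : Set V) s v
  | 0, v, _, hv => ⟨v, hv, Linked.refl⟩
  | i + 1, v, hi, hv => by
    have hvn := layer_mono hSA hi hv
    simp only [layer, Finset.mem_filter] at hv
    obtain ⟨-, hv | ⟨u, hu, huv⟩⟩ := hv
    · exact linked_of_mem_layer hSA (Nat.le_of_succ_le hi) hv
    · obtain ⟨s, hs, h⟩ := linked_of_mem_layer hSA (Nat.le_of_succ_le hi) hu
      exact ⟨s, hs, h.tail (layer_mono hSA (Nat.le_of_succ_le hi) hu) hvn huv⟩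

theorem linkedSet_layer {H : SimpleGraph V} (hE : ∀ x y, E x y → H.Adj x y) (hSA : S ⊆ A)
    (hS : H.IsClique (S : Set V)) (n : ℕ) : LinkedSet H.Adj (layer E A S n : Set V) := by
  intro x hx y hy
  have hS0 : S ⊆ layer E A S n := layer_mono hSA (Nat.zero_le n)
  obtain ⟨s, hs, hsx⟩ := linked_of_mem_layer hSA le_rfl hx
  obtain ⟨t, ht, hty⟩ := linked_of_mem_layer hSA le_rfl hy
  have hst : Linked H.Adj (layer E A S n : Set V) s t := by
    by_cases h : s = t
    · exact h ▸ Linked.refl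
    · exact Linked.single (hS0 hs) (hS0 ht) (hS hs ht h)
  exact (((hsx.mono subset_rfl hE).symm fun _ _ h => h.symm).trans hst).trans
    (hty.mono subset_rfl hE)

/-- If the two layers `2 * j + 1` and `2 * j + 2` avoid the color `β` outside the stable set `I`,
then a monochromatic component of color `β` starting at `S` does not get past them. -/
theorem mem_layer_of_linked {H : SimpleGraph V} {I : Set V} (hE : ∀ x y, E x y → H.Adj x y)
    (hI : ∀ x ∈ I, ∀ y ∈ I, ¬ H.Adj x y) (hSA : S ⊆ A) {c : V → ℕ} {β j : ℕ}
    (hc : ∀ v, v ∉ I → v ∈ layer E A S (2 * j + 2) → v ∉ layer E A S (2 * j) → c v ≠ β)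
    {s b : V} (hs : s ∈ S) (h : Linked E {v | v ∈ A ∧ c v = β} s b) :
    b ∈ layer E A S (2 * j + 1) := by
  induction h with
  | refl => exact layer_mono hSA (Nat.zero_le _) hs
  | @tail v w _ hst ih =>
    obtain ⟨⟨-, hv⟩, ⟨hwA, hw⟩, hvw⟩ := hst
    by_contra hcon
    have hv0 : v ∉ layer E A S (2 * j) := fun h => hcon (mem_layer_succ h hwA hvw)
    have hw0 : w ∉ layer E A S (2 * j) := fun h => hcon (layer_mono hSA (by omega) h)
    have hvI : v ∈ I := by
      by_contra hvI
      exact hc v hvI (layer_mono hSA (by omega) ih) hv0 hv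
    have hwI : w ∈ I := by
      by_contra hwI
      exact hc w hwI (mem_layer_succ ih hwA hvw) hw0 hw
    exact hI v hvI w hwI (hE _ _ hvw)

theorem exists_layered_coloring {I : Set V} {L : V → Finset ℕ}
    (hL : ∀ v a, ∃ b ∈ L v, v ∉ I → b ≠ a) (hSA : S ⊆ A) (f : V → ℕ) (hf : ∀ v, f v ∈ L v)
    (α : ℕ → ℕ) :
    ∃ c : V → ℕ, (∀ v, c v ∈ L v) ∧ (∀ s ∈ S, c s = f s) ∧
      ∀ v j, v ∉ I → v ∈ layer E A S (2 * j + 2) → v ∉ layer E A S (2 * j) → c v ≠ α j := by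
  have : ∀ v, ∃ b, b ∈ L v ∧ (v ∈ S → b = f v) ∧
      ∀ j, v ∉ I → v ∈ layer E A S (2 * j + 2) → v ∉ layer E A S (2 * j) → b ≠ α j := by
    intro v
    by_cases hv : v ∈ S
    · exact ⟨f v, hf v, fun _ => rfl, fun j _ _ h =>
        absurd (layer_mono hSA (Nat.zero_le _) hv) h⟩
    · by_cases hj : ∃ j, v ∈ layer E A S (2 * j + 2) ∧ v ∉ layer E A S (2 * j)
      · obtain ⟨j, hj1, hj2⟩ := hj
        obtain ⟨b, hb, hbI⟩ := hL v (α j)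
        refine ⟨b, hb, fun h => absurd h hv, fun i hvI hi1 hi2 => ?_⟩
        have hij : i = j := by
          rcases lt_trichotomy i j with h | h | h
          · exact absurd (layer_mono hSA (by omega : 2 * i + 2 ≤ 2 * j) hi1) hj2
          · exact h
          · exact absurd (layer_mono hSA (by omega : 2 * j + 2 ≤ 2 * i) hj1) hi2
        exact hij ▸ hbI hvI
      · exact ⟨f v, hf v, fun h => absurd h hv, fun j _ h1 h2 => absurd ⟨j, h1, h2⟩ hj⟩
  choose c hc using this
  exact ⟨c, fun v => (hc v).1, fun v => (hc v).2.1, fun v => (hc v).2.2⟩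

end Layer

theorem exists_enumeration {V : Type*} (S : Finset V) (f : V → ℕ) :
    ∃ α : ℕ → ℕ, ∀ s ∈ S, ∃ j < S.card, α j = f s := by
  refine ⟨fun j => if h : j < S.card then f (S.equivFin.symm ⟨j, h⟩) else 0, fun s hs => ?_⟩
  refine ⟨S.equivFin ⟨s, hs⟩, (S.equivFin ⟨s, hs⟩).2, ?_⟩
  simp

/-! ### Extending colorings -/

section Glue

variable {V : Type*} {G H : SimpleGraph V} {D D' : ℕ}

/-- Excursions of a linked sequence into `B` can be replaced by single long steps, when the
boundary of every component of `B` is a clique. Here `Q y` is the component of `y` together with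
its boundary `bd y`. -/
theorem exists_linked_diff_near {W B : Set V} {Q bd : V → Set V} (hD : D ≤ D')
    (hself : ∀ y ∈ B, y ∈ Q y)
    (hstep : ∀ y ∈ B, ∀ z ∈ B, H.Adj y z → Q z = Q y ∧ bd z = bd y)
    (hbd : ∀ y ∈ B, ∀ z ∈ W, z ∉ B → H.Adj y z → z ∈ bd y)
    (hbdQ : ∀ y ∈ B, bd y ⊆ Q y) (hcl : ∀ y ∈ B, H.IsClique (bd y))
    (hnear : ∀ y ∈ B, ∀ s ∈ bd y, s ∈ W → ∀ b, Linked (NearAdj G H D) (Q y ∩ W) s b →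
      Near G D' s b)
    {x y : V} (hx : x ∈ W \ B) (h : Linked (NearAdj G H D) W x y) :
    ∃ x' ∈ W \ B, Linked (NearAdj G H D') (W \ B) x x' ∧ Near G D' x' y := by
  have key : ∃ x' ∈ W \ B, Linked (NearAdj G H D') (W \ B) x x' ∧
      (y = x' ∨ (y ∈ B ∧ x' ∈ bd y ∧ Linked (NearAdj G H D) (Q y ∩ W) x' y)) := by
    induction h with
    | refl => exact ⟨x, hx, Linked.refl, Or.inl rfl⟩
    | @tail y z _ hs ih =>
      obtain ⟨hy, hz, hyz⟩ := hs
      obtain ⟨x', hx', hxx', rfl | ⟨hyB, hx'bd, hl⟩⟩ := ih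
      · by_cases hzB : z ∈ B
        · have hb := hbd z hzB y hy hx'.2 hyz.1.symm
          exact ⟨y, hx', hxx', Or.inr ⟨hzB, hb,
            Linked.single ⟨hbdQ z hzB hb, hy⟩ ⟨hself z hzB, hz⟩ hyz⟩⟩
        · exact ⟨z, ⟨hz, hzB⟩, hxx'.tail hx' ⟨hz, hzB⟩ (hyz.mono hD), Or.inl rfl⟩
      · by_cases hzB : z ∈ B
        · obtain ⟨hQ, hb⟩ := hstep y hyB z hzB hyz.1
          refine ⟨x', hx', hxx', Or.inr ⟨hzB, hb ▸ hx'bd, ?_⟩⟩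
          rw [hQ]
          exact hl.tail ⟨hself y hyB, hy⟩ ⟨hQ ▸ hself z hzB, hz⟩ hyz
        · have hb := hbd y hyB z hz hzB hyz.1
          have hn := hnear y hyB x' hx'bd hx'.1 z
            (hl.tail ⟨hself y hyB, hy⟩ ⟨hbdQ y hyB hb, hz⟩ hyz)
          refine ⟨z, ⟨hz, hzB⟩, ?_, Or.inl rfl⟩
          by_cases hxz : x' = z
          · exact hxz ▸ hxx'
          · exact hxx'.tail hx' ⟨hz, hzB⟩ ⟨hcl y hyB hx'bd hb hxz, hn⟩
  obtain ⟨x', hx', hxx', rfl | ⟨hyB, hx'bd, hl⟩⟩ := key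
  · exact ⟨y, hx', hxx', Near.refl⟩
  · exact ⟨x', hx', hxx', hnear y hyB x' hx'bd hx'.1 y hl⟩

/-- A linked set that stays near its trace outside `B` has bounded diameter if this trace
consists of a part `Z` covered by few balls and of small pieces. -/
theorem near_of_exists_linked_diff {S : Finset V} {W B Z : Set V} {k N ρ : ℕ} (hS : S.card ≤ k)
    (hZ : ∀ z ∈ Z, ∃ s ∈ S, Near G ρ s z)
    (hU : ∀ a b, Linked (NearAdj G H D') ((W \ B) \ Z) a b → Near G N a b)
    {x : V} (hx : x ∈ W \ B)
    (hexc : ∀ y, Linked (NearAdj G H D) W x y →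
      ∃ x' ∈ W \ B, Linked (NearAdj G H D') (W \ B) x x' ∧ Near G D' x' y)
    {a b : V} (hxa : Linked (NearAdj G H D) W x a) (hab : Linked (NearAdj G H D) W a b) :
    Near G (k * (2 * (N + 2 * D' + ρ) + D) + 2 * (N + D')) a b := by
  by_cases hz : ∃ z ∈ Z, z ∈ W \ B ∧ Linked (NearAdj G H D') (W \ B) x z
  · obtain ⟨z, hzZ, hzW, hxz⟩ := hz
    have hcover : ∀ y, Linked (NearAdj G H D) W x y →
        ∃ s ∈ S, Near G (N + 2 * D' + ρ) s y := by
      intro y hy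
      obtain ⟨x', -, hxx', hn⟩ := hexc y hy
      have hzx' := (hxz.symm fun _ _ h => h.symm).trans hxx'
      obtain ⟨z', hz', -, rfl | ⟨u, -, hzu, hux⟩⟩ := hzx'.last_visit (P := Z) hzZ hzW
      · obtain ⟨s, hs, hsz⟩ := hZ z' hz'
        exact ⟨s, hs, (hsz.trans hn).mono (by omega)⟩
      · obtain ⟨s, hs, hsz⟩ := hZ z' hz'
        exact ⟨s, hs, (((hsz.trans hzu.2).trans (hU u x' hux)).trans hn).mono (by omega)⟩
    have haW : a ∈ W := hxa.mem hx.1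
    refine (near_of_linked_of_cover (E := NearAdj G H D) (fun _ _ h => h.2) S
      {v | v ∈ W ∧ Linked (NearAdj G H D) W a v} (fun v hv => hcover v (hxa.trans hv.2))
      ⟨haW, Linked.refl⟩ hab.within).mono ?_
    exact (Nat.mul_le_mul_right _ hS).trans (Nat.le_add_right _ _)
  · have hsmall : ∀ y, Linked (NearAdj G H D) W x y → Near G (N + D') x y := by
      intro y hy
      obtain ⟨x', -, hxx', hn⟩ := hexc y hy
      refine (hU x x' (hxx'.within.mono ?_ fun _ _ h => h)).trans hn
      exact fun v hv => ⟨hv.1, fun hvZ => hz ⟨v, hvZ, hv.1, hv.2⟩⟩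
    exact ((hsmall a hxa).symm.trans (hsmall b (hxa.trans hab))).mono (by omega)

end Glue

/-- Colorings of a clique `S` extend to list colorings whose monochromatic components for the
`D`-near adjacency have weak diameter at most `N`, those that meet `S` being within distance `M`,
whenever the ambient graph is hereditarily simplicial with cliques of size at most `k`. The vertices
of the stable set `I` are allowed to have only one color. -/
def ExtendsWithin (k D M N : ℕ) : Prop :=
  ∀ (V : Type u) (G H : SimpleGraph V) (I : Set V) (L : V → Finset ℕ),
    HereditarilySimplicial H → (∀ x ∈ I, ∀ y ∈ I, ¬ H.Adj x y) →
    (∀ v a, ∃ b ∈ L v, v ∉ I → b ≠ a) →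
    ∀ A S : Finset V, (∀ K ⊆ A, H.IsClique (K : Set V) → K.card ≤ k) → S ⊆ A →
    H.IsClique (S : Set V) → ∀ f : V → ℕ, (∀ v, f v ∈ L v) →
    ∃ c : V → ℕ, (∀ v, c v ∈ L v) ∧ (∀ s ∈ S, c s = f s) ∧
      (∀ s ∈ S, ∀ b, Linked (NearAdj G H D) {v | v ∈ A ∧ c v = f s} s b → Near G M s b) ∧
      ∀ a b, Linked (NearAdj G H D) {v | v ∈ A ∧ c v = c a} a b → Near G N a b

theorem extendsWithin_zero (D : ℕ) : ExtendsWithin.{u} 0 D 0 0 := by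
  intro V G H I L _ _ _ A S hA hSA _ f hf
  have hA0 : ∀ v, v ∉ A := fun v hv => by
    simpa using hA {v} (by simpa using hv) (by simp)
  refine ⟨f, hf, fun _ _ => rfl, fun s hs => absurd (hSA hs) (hA0 s), fun a b h => ?_⟩
  rcases h.eq_or_mem with rfl | h
  · exact Near.refl
  · exact absurd h.1 (hA0 a)

theorem ExtendsWithin.succ {k D D' M N ρ : ℕ} (hρ : ρ = 2 * (k + 1) * D)
    (hD' : D' = (k + 1) * (2 * ρ + D) + D) (h : ExtendsWithin.{u} k D' M N) :
    ExtendsWithin.{u} (k + 1) D D'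
      ((k + 1) * (2 * (N + 2 * D' + ρ) + D) + 2 * (N + D')) := by
  classical
  intro V G H I L hH hI hL A
  have hDD' : D ≤ D' := hD' ▸ Nat.le_add_left _ _
  induction hn : A.card using Nat.strong_induction_on generalizing A with
  | _ n ih =>
  subst hn
  intro S hcl hSA hS f hf
  wlog hne : S.Nonempty generalizing S
  · rw [Finset.not_nonempty_iff_eq_empty] at hne
    subst hne
    rcases A.eq_empty_or_nonempty with rfl | ⟨v, hv⟩
    · refine ⟨f, hf, by simp, by simp, fun a b h => ?_⟩
      rcases h.eq_or_mem with rfl | h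
      · exact Near.refl
      · simp at h
    · obtain ⟨c, hc, -, -, hc'⟩ := this {v} (by simpa using hv) (by simp) (by simp)
      exact ⟨c, hc, by simp, by simp, hc'⟩
  set E := NearAdj G H D with hE
  have hEH : ∀ x y, E x y → H.Adj x y := fun _ _ h => h.1
  have hEG : ∀ x y, E x y → Near G D x y := fun _ _ h => h.2
  have hScard : S.card ≤ k + 1 := hcl S hSA hS
  obtain ⟨α, hα⟩ := exists_enumeration S f
  obtain ⟨cZ, hcZL, hcZS, hcZα⟩ := exists_layered_coloring (E := E) hL hSA f hf α
  set Z := layer E A S (2 * (k + 1)) with hZdef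
  have hZA : Z ⊆ A := layer_subset hSA _
  have hSZ : S ⊆ Z := layer_mono hSA (Nat.zero_le _)
  have hZlink : LinkedSet H.Adj (Z : Set V) := linkedSet_layer hEH hSA hS _
  have hZnear : ∀ z ∈ Z, ∃ s ∈ S, Near G ρ s z := fun z hz => hρ ▸ near_of_mem_layer hEG hz
  set U := A.filter (fun v => v ∉ Z ∧ ∃ z ∈ Z, H.Adj v z) with hU
  set B := A.filter (fun v => v ∉ Z ∧ ∀ z ∈ Z, ¬ H.Adj v z) with hB
  have hUcl : ∀ K ⊆ U, H.IsClique (K : Set V) → K.card ≤ k := by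
    intro K hKU hK
    obtain ⟨z, hz, hzK⟩ := hH.exists_common_neighbor K Z hZlink (hne.mono hSZ) hK
      (fun x hx => (Finset.mem_filter.1 (hKU hx)).2.1)
      (fun x hx => (Finset.mem_filter.1 (hKU hx)).2.2)
    have hzK' : z ∉ K := fun hz' => (hzK z hz').ne rfl
    have := hcl (insert z K)
      (Finset.insert_subset (hZA hz) fun x hx => (Finset.mem_filter.1 (hKU hx)).1)
      (by
        rw [Finset.coe_insert, isClique_insert]
        exact ⟨hK, fun x hx _ => (hzK x hx).symm⟩)
    rw [Finset.card_insert_of_notMem hzK'] at this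
    omega
  obtain ⟨cU, hcUL, -, -, hcU⟩ := h V G H I L hH hI hL U ∅ hUcl (by simp) (by simp) f hf
  let bd : Finset V → Finset V := fun C => A.filter fun v => v ∉ C ∧ ∃ u ∈ C, H.Adj u v
  have hbdU : ∀ C ⊆ B, (∀ x ∈ C, ∀ y ∈ B, H.Adj x y → y ∈ C) → bd C ⊆ U := by
    intro C hCB hCc v hv
    obtain ⟨hvA, hvC, u, hu, huv⟩ := Finset.mem_filter.1 hv
    have huB := (Finset.mem_filter.1 (hCB hu)).2
    have hvZ : v ∉ Z := fun hvZ => huB.2 v hvZ huv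
    refine Finset.mem_filter.2 ⟨hvA, hvZ, ?_⟩
    by_contra hcon
    push Not at hcon
    exact hvC (hCc u hu v (Finset.mem_filter.2 ⟨hvA, hvZ, hcon⟩) huv)
  have hbdcl : ∀ C ⊆ B, (∀ x ∈ C, ∀ y ∈ B, H.Adj x y → y ∈ C) →
      LinkedSet H.Adj (C : Set V) → H.IsClique (bd C : Set V) := by
    intro C hCB hCc hC x hx y hy hxy
    have hxU := Finset.mem_filter.1 (hbdU C hCB hCc hx)
    have hyU := Finset.mem_filter.1 (hbdU C hCB hCc hy)
    obtain ⟨-, hxC, u, hu, hux⟩ := Finset.mem_filter.1 hx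
    obtain ⟨-, hyC, v, hv, hvy⟩ := Finset.mem_filter.1 hy
    refine hH.adj_of_separated hxy Z C hZlink hC ?_ hxU.2.1 hyU.2.1 hxC hyC hxU.2.2 hyU.2.2
      ⟨u, hu, hux.symm⟩ ⟨v, hv, hvy.symm⟩
    intro z hz w hw
    have hwB := (Finset.mem_filter.1 (hCB hw)).2
    exact ⟨fun h => hwB.1 (h ▸ hz), fun h => hwB.2 z hz h.symm⟩
  have hrec : ∀ C : Finset V, ∃ c : V → ℕ, (∀ v, c v ∈ L v) ∧
      (C ⊆ B → (∀ x ∈ C, ∀ y ∈ B, H.Adj x y → y ∈ C) → LinkedSet H.Adj (C : Set V) →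
        (∀ s ∈ bd C, c s = cU s) ∧
        (∀ s ∈ bd C, ∀ b, Linked E {v | v ∈ C ∪ bd C ∧ c v = cU s} s b → Near G D' s b) ∧
        ∀ a b, Linked E {v | v ∈ C ∪ bd C ∧ c v = c a} a b →
          Near G ((k + 1) * (2 * (N + 2 * D' + ρ) + D) + 2 * (N + D')) a b) := by
    intro C
    by_cases hC : C ⊆ B ∧ (∀ x ∈ C, ∀ y ∈ B, H.Adj x y → y ∈ C) ∧ LinkedSet H.Adj (C : Set V)
    · obtain ⟨hCB, hCc, hCl⟩ := hC
      have hsub : C ∪ bd C ⊆ A :=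
        Finset.union_subset (hCB.trans (Finset.filter_subset _ _)) (Finset.filter_subset _ _)
      have hlt : (C ∪ bd C).card < A.card := by
        obtain ⟨s, hs⟩ := hne
        refine Finset.card_lt_card ⟨hsub, fun hcon => ?_⟩
        rcases Finset.mem_union.1 (hcon (hSA hs)) with hsC | hsC
        · exact (Finset.mem_filter.1 (hCB hsC)).2.1 (hSZ hs)
        · exact (Finset.mem_filter.1 (hbdU C hCB hCc hsC)).2.1 (hSZ hs)
      obtain ⟨c, hc, h1, h2, h3⟩ := ih _ hlt (C ∪ bd C) rfl (bd C)
        (fun K hK => hcl K (hK.trans hsub)) Finset.subset_union_right (hbdcl C hCB hCc hCl) cU hcUL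
      exact ⟨c, hc, fun _ _ _ => ⟨h1, h2, h3⟩⟩
    · exact ⟨f, hf, fun h1 h2 h3 => absurd ⟨h1, h2, h3⟩ hC⟩
  choose cC hcCL hcC using hrec
  let comp : V → Finset V := fun v => B.filter fun u => Linked H.Adj (B : Set V) v u
  have hHs : ∀ x y, H.Adj x y → H.Adj y x := fun _ _ h => h.symm
  have hcompB : ∀ v, comp v ⊆ B := fun v => Finset.filter_subset _ _
  have hcomp_self : ∀ v ∈ B, v ∈ comp v := fun v hv => Finset.mem_filter.2 ⟨hv, Linked.refl⟩
  have hcomp_closed : ∀ v, ∀ x ∈ comp v, ∀ y ∈ B, H.Adj x y → y ∈ comp v := by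
    intro v x hx y hy hxy
    obtain ⟨hxB, hvx⟩ := Finset.mem_filter.1 hx
    exact Finset.mem_filter.2 ⟨hy, hvx.tail hxB hy hxy⟩
  have hcomp_eq : ∀ v, ∀ u ∈ comp v, comp u = comp v := by
    intro v u hu
    have hvu := (Finset.mem_filter.1 hu).2
    ext w
    simp only [comp, Finset.mem_filter]
    exact and_congr_right fun _ => ⟨fun h => hvu.trans h, fun h => (hvu.symm hHs).trans h⟩
  have hcomp_link : ∀ v ∈ B, LinkedSet H.Adj (comp v : Set V) := by
    intro v hv
    have hfrom : ∀ x ∈ comp v, Linked H.Adj (comp v : Set V) v x := by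
      intro x hx
      refine (Finset.mem_filter.1 hx).2.within.mono (fun u hu => ?_) fun _ _ h => h
      exact Finset.mem_coe.2 (Finset.mem_filter.2 hu)
    exact fun x hx y hy => ((hfrom x hx).symm hHs).trans (hfrom y hy)
  let c : V → ℕ := fun v => if v ∈ Z then cZ v else if v ∈ U then cU v else cC (comp v) v
  have hcL : ∀ v, c v ∈ L v := by
    intro v
    simp only [c]
    split_ifs
    exacts [hcZL v, hcUL v, hcCL _ v]
  have hc_Z : ∀ v ∈ Z, c v = cZ v := fun v hv => if_pos hv
  have hc_U : ∀ v ∈ U, c v = cU v := fun v hv => by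
    simp only [c]
    rw [if_neg (Finset.mem_filter.1 hv).2.1, if_pos hv]
  have hc_B : ∀ v ∈ B, c v = cC (comp v) v := fun v hv => by
    have hv' := (Finset.mem_filter.1 hv).2
    have hvU : v ∉ U := fun hvU => by
      obtain ⟨z, hz, hvz⟩ := (Finset.mem_filter.1 hvU).2.2
      exact hv'.2 z hz hvz
    simp only [c]
    rw [if_neg hv'.1, if_neg hvU]
  have hA : ∀ v ∈ A, v ∉ B → v ∉ Z → v ∈ U := by
    intro v hv hvB hvZ
    refine Finset.mem_filter.2 ⟨hv, hvZ, ?_⟩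
    by_contra hcon
    push Not at hcon
    exact hvB (Finset.mem_filter.2 ⟨hv, hvZ, hcon⟩)
  have hc_comp : ∀ v ∈ B, ∀ u ∈ comp v ∪ bd (comp v), c u = cC (comp v) u := by
    intro v hv u hu
    rcases Finset.mem_union.1 hu with hu | hu
    · rw [hc_B u (hcompB v hu), hcomp_eq v u hu]
    · rw [hc_U u (hbdU _ (hcompB v) (hcomp_closed v) hu),
        (hcC _ (hcompB v) (hcomp_closed v) (hcomp_link v hv)).1 u hu]
  have hcS : ∀ s ∈ S, c s = f s := fun s hs => by rw [hc_Z s (hSZ hs), hcZS s hs]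
  refine ⟨c, hcL, hcS, ?_, ?_⟩
  · intro s hs b hsb
    obtain ⟨j, hj, hαj⟩ := hα s hs
    have hmem : ∀ v, Linked E {v | v ∈ A ∧ c v = f s} s v → v ∈ Z := by
      intro v hv
      refine layer_mono hSA (by omega) (mem_layer_of_linked (j := j) hEH hI hSA ?_ hs hv)
      intro w hwI hw hw'
      rw [hc_Z w (layer_mono hSA (by omega) hw), ← hαj]
      exact hcZα w j hwI hw hw'
    refine (near_of_linked_of_cover hEG S
      {v | v ∈ {v | v ∈ A ∧ c v = f s} ∧ Linked E {v | v ∈ A ∧ c v = f s} s v}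
      (fun v hv => hZnear v (hmem v hv.2)) ⟨⟨hSA hs, hcS s hs⟩, Linked.refl⟩ hsb.within).mono ?_
    rw [hD']
    exact (Nat.mul_le_mul_right _ hScard).trans (Nat.le_add_right _ _)
  · intro a b hab
    rcases hab.eq_or_mem with rfl | haW
    · exact Near.refl
    set W : Set V := {v | v ∈ A ∧ c v = c a} with hW
    by_cases hx : ∃ x ∈ W, x ∉ B ∧ Linked E W a x
    · obtain ⟨x, hxW, hxB, hax⟩ := hx
      have hxa : Linked E W x a := hax.symm fun _ _ h => h.symm
      refine near_of_exists_linked_diff (B := (B : Set V)) (Z := (Z : Set V)) hScard hZnear ?_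
        (x := x) ⟨hxW, hxB⟩ ?_ hxa hab
      · intro u v huv
        rcases huv.eq_or_mem with rfl | hu
        · exact Near.refl
        have hmemU : ∀ w ∈ (W \ B) \ Z, w ∈ U ∧ cU w = c a := fun w hw => by
          have hwU := hA w hw.1.1.1 hw.1.2 hw.2
          exact ⟨hwU, by rw [← hc_U w hwU]; exact hw.1.1.2⟩
        refine hcU u v (huv.mono (fun w hw => ?_) fun _ _ h => h)
        exact ⟨(hmemU w hw).1, by rw [(hmemU w hw).2, (hmemU u hu).2]⟩
      · intro y hxy
        refine exists_linked_diff_near (B := (B : Set V))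
          (Q := fun v => ((comp v ∪ bd (comp v) : Finset V) : Set V))
          (bd := fun v => (bd (comp v) : Set V)) hDD' ?_ ?_ ?_ ?_ ?_ ?_ ⟨hxW, hxB⟩ hxy
        · exact fun v hv => Finset.mem_coe.2 (Finset.mem_union_left _ (hcomp_self v hv))
        · intro v hv w hw hvw
          have := hcomp_eq v w (hcomp_closed v v (hcomp_self v hv) w hw hvw)
          simp only [this, and_self]
        · intro v hv w hw hwB hvw
          exact Finset.mem_coe.2 (Finset.mem_filter.2 ⟨hw.1, fun h => hwB (hcompB v h), v,
            hcomp_self v hv, hvw⟩)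
        · exact fun v _ => Finset.coe_subset.2 Finset.subset_union_right
        · exact fun v hv => hbdcl _ (hcompB v) (hcomp_closed v) (hcomp_link v hv)
        · intro v hv s hs hsW u hsu
          have hC := hcC _ (hcompB v) (hcomp_closed v) (hcomp_link v hv)
          refine hC.2.1 s hs u (hsu.mono (fun w hw => ⟨hw.1, ?_⟩) fun _ _ h => h)
          rw [← hc_comp v hv w hw.1, ← hc_U s (hbdU _ (hcompB v) (hcomp_closed v) hs), hw.2.2,
            hsW.2]
    · push Not at hx
      have hB' : ∀ v, Linked E W a v → v ∈ B := fun v hv => by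
        by_contra hcon
        exact hx v (hv.mem haW) hcon hv
      have haB := hB' a Linked.refl
      have hl : Linked E (W ∩ B) a b :=
        hab.within.mono (fun v hv => ⟨hv.1, hB' v hv.2⟩) fun _ _ h => h
      refine (hcC _ (hcompB a) (hcomp_closed a) (hcomp_link a haB)).2.2 a b
        (hl.within.mono (fun v hv => ?_) fun _ _ h => h)
      have hvc : v ∈ comp a := Finset.mem_filter.2
        ⟨hv.1.2, hv.2.mono Set.inter_subset_right hEH⟩
      refine ⟨Finset.mem_union_left _ hvc, ?_⟩
      rw [← hc_comp a haB v (Finset.mem_union_left _ hvc),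
        ← hc_comp a haB a (Finset.mem_union_left _ (hcomp_self a haB)), hv.1.1.2]

theorem exists_extendsWithin (k D : ℕ) : ∃ M N, ExtendsWithin.{u} k D M N := by
  induction k generalizing D with
  | zero => exact ⟨0, 0, extendsWithin_zero D⟩
  | succ k ih =>
    obtain ⟨M, N, h⟩ := ih ((k + 1) * (2 * (2 * (k + 1) * D) + D) + D)
    exact ⟨_, _, h.succ rfl rfl⟩

/-! ### Tree-decompositions -/

section TreeDecomposition

theorem SimpleGraph.IsTree.exists_leaf_of_finset {ι : Type*} {T : SimpleGraph ι} (hT : T.IsTree)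
    (F : Finset ι) (hF : F.Nonempty) :
    ∃ t ∈ F, ∀ x ∈ F, ∀ y ∈ F, T.Adj t x → T.Adj t y → x = y := by
  classical
  have r := hF.choose
  obtain ⟨t, ht, hmax⟩ := F.exists_max_image (T.dist r) hF
  obtain ⟨q, hq, -⟩ := (hT.connected r t).exists_path_of_dist
  have key : ∀ x ∈ F, T.Adj t x → x = q.penultimate := by
    intro x hx htx
    obtain ⟨p, hp, hpl⟩ := (hT.connected r x).exists_path_of_dist
    have hlt : T.dist r x < T.dist r t :=
      lt_of_le_of_ne (hmax x hx) (hT.dist_ne_of_adj r htx).symm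
    have htp : t ∉ p.support := fun h => by
      have h1 := SimpleGraph.dist_le (p.takeUntil t h)
      have h2 := p.length_takeUntil_le_length h
      omega
    exact hT.isAcyclic.eq_penultimate_of_adj_end hq htx
      (hT.isAcyclic.mem_support_of_ne_mem_support_of_adj_of_isPath hq hp htx htp)
  exact ⟨t, ht, fun x hx y hy htx hty => (key x hx htx).trans (key y hy hty).symm⟩

variable {V ι : Type*} {T : SimpleGraph ι} {X : ι → Set V}

theorem exists_bag_of_linkedSet (hT : T.IsTree) (A : Finset V) (hA : A.Nonempty) (F : Finset ι)
    (hF : ∀ v ∈ A, ∃ t ∈ F, v ∈ X t) (hc : ∀ v ∈ A, LinkedSet T.Adj {t | t ∈ F ∧ v ∈ X t}) :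
    ∃ v ∈ A, ∃ t ∈ F, ∀ x ∈ A, (∃ s ∈ F, v ∈ X s ∧ x ∈ X s) → x ∈ X t := by
  classical
  induction hn : F.card using Nat.strong_induction_on generalizing F with
  | _ n ih =>
    subst hn
    have hne : F.Nonempty := by
      obtain ⟨v, hv⟩ := hA
      obtain ⟨t, ht, -⟩ := hF v hv
      exact ⟨t, ht⟩
    obtain ⟨t, ht, hleaf⟩ := hT.exists_leaf_of_finset F hne
    by_cases h : ∃ v ∈ A, v ∈ X t ∧ ∀ s ∈ F, v ∈ X s → s = t
    · obtain ⟨v, hv, -, hs⟩ := h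
      refine ⟨v, hv, t, ht, ?_⟩
      rintro x - ⟨s, hsF, hvs, hxs⟩
      exact hs s hsF hvs ▸ hxs
    · push Not at h
      have hstep : ∀ v ∈ A, v ∈ X t → ∃ z, (z ∈ F ∧ v ∈ X z) ∧ T.Adj t z := by
        intro v hv hvt
        obtain ⟨s, hs, hvs, hst⟩ := h v hv hvt
        exact (hc v hv).exists_step ⟨ht, hvt⟩ ⟨hs, hvs⟩ hst.symm
      obtain ⟨v, hv, s, hs, hvs⟩ := ih _ (Finset.card_erase_lt_of_mem ht) (F.erase t)
        (fun v hv => by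
          obtain ⟨s, hs, hvs⟩ := hF v hv
          by_cases hst : s = t
          · obtain ⟨z, ⟨hz, hvz⟩, htz⟩ := hstep v hv (hst ▸ hvs)
            exact ⟨z, Finset.mem_erase.2 ⟨htz.ne', hz⟩, hvz⟩
          · exact ⟨s, Finset.mem_erase.2 ⟨hst, hs⟩, hvs⟩)
        (fun v hv => by
          have := (hc v hv).diff_simplicial (v := t) fun x hx y hy htx hty hxy =>
            absurd (hleaf x hx.1 y hy.1 htx hty) hxy
          convert this using 1
          ext s
          simp only [Finset.mem_erase, Set.mem_ofPred_eq, Set.mem_sdiff, Set.mem_singleton_iff]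
          tauto) rfl
      refine ⟨v, hv, s, Finset.mem_of_mem_erase hs, ?_⟩
      rintro x hx ⟨u, hu, hvu, hxu⟩
      refine hvs x hx ?_
      by_cases hut : u = t
      · obtain ⟨z, ⟨hz, hvz⟩, htz⟩ := hstep v hv (hut ▸ hvu)
        obtain ⟨z', ⟨hz', hxz'⟩, htz'⟩ := hstep x hx (hut ▸ hxu)
        refine ⟨z, Finset.mem_erase.2 ⟨htz.ne', hz⟩, hvz, ?_⟩
        rwa [hleaf z hz z' hz' htz htz']
      · exact ⟨u, Finset.mem_erase.2 ⟨hut, hu⟩, hvu, hxu⟩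

theorem linkedSet_of_induce_connected {W : Set ι} (h : (T.induce W).Connected) :
    LinkedSet T.Adj W := by
  intro x hx y hy
  have hxy : ∀ z, (T.induce W).Reachable ⟨x, hx⟩ z → Linked T.Adj W x z := by
    intro z hz
    rw [reachable_iff_reflTransGen] at hz
    induction hz with
    | refl => exact Linked.refl
    | @tail a b _ hab ih => exact ih.tail a.2 b.2 hab
  exact hxy ⟨y, hy⟩ (h ⟨x, hx⟩ ⟨y, hy⟩)

/-- The graph in which two distinct vertices are adjacent if they lie in a common bag. -/
def bagGraph (X : ι → Set V) : SimpleGraph V where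
  Adj u v := u ≠ v ∧ ∃ t, u ∈ X t ∧ v ∈ X t
  symm := ⟨fun _ _ h => ⟨h.1.symm, h.2.imp fun _ ht => ht.symm⟩⟩
  loopless := ⟨fun _ h => h.1 rfl⟩

theorem IsTreeDecomp.exists_bag [Finite ι] {G : SimpleGraph V} (h : IsTreeDecomp G T X)
    (A : Finset V) (hA : A.Nonempty) :
    ∃ v ∈ A, ∃ t, v ∈ X t ∧ ∀ x ∈ A, (bagGraph X).Adj v x → x ∈ X t := by
  have := Fintype.ofFinite ι
  obtain ⟨hT, hV, -, hc⟩ := h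
  obtain ⟨v, hv, t, -, ht⟩ := exists_bag_of_linkedSet hT A hA Finset.univ
    (fun v _ => by simpa using hV v)
    (fun v _ => by simpa using linkedSet_of_induce_connected (hc v))
  obtain ⟨s, hs⟩ := hV v
  exact ⟨v, hv, t, ht v hv ⟨s, Finset.mem_univ _, hs, hs⟩, fun x hx hvx =>
    ht x hx (hvx.2.imp fun _ h => ⟨Finset.mem_univ _, h⟩)⟩

theorem IsTreeDecomp.hereditarilySimplicial [Finite ι] {G : SimpleGraph V}
    (h : IsTreeDecomp G T X) : HereditarilySimplicial (bagGraph X) := by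
  intro A hA
  obtain ⟨v, hv, t, -, ht⟩ := h.exists_bag A hA
  exact ⟨v, hv, fun x hx y hy hvx hvy hxy => ⟨hxy, t, ht x hx hvx, ht y hy hvy⟩⟩

theorem IsTreeDecomp.card_le_of_isClique [Finite ι] [Finite V] {G : SimpleGraph V} {k : ℕ}
    (h : IsTreeDecomp G T X) (hk : ∀ t, (X t).ncard ≤ k) (K : Finset V)
    (hK : (bagGraph X).IsClique (K : Set V)) : K.card ≤ k := by
  rcases K.eq_empty_or_nonempty with rfl | hne
  · simp
  obtain ⟨v, hv, t, hvt, ht⟩ := h.exists_bag K hne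
  have hsub : (K : Set V) ⊆ X t := fun x hx => by
    by_cases hxv : v = x
    · exact hxv ▸ hvt
    · exact ht x hx (hK hv hx hxv)
  exact (Set.ncard_coe_finset K ▸ Set.ncard_le_ncard hsub (Set.toFinite _)).trans (hk t)

theorem IsTreeDecomp.exists_coloring [Finite ι] [Finite V] {G : SimpleGraph V} {w : ℕ}
    (h : IsTreeDecomp G T X) (hw : ∀ t, (X t).ncard ≤ w + 1) (A : Finset V) :
    ∃ col : V → Fin (w + 1), ∀ u ∈ A, ∀ v ∈ A, (bagGraph X).Adj u v → col u ≠ col v := by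
  classical
  induction hn : A.card generalizing A with
  | zero => exact ⟨fun _ => 0, by simp_all⟩
  | succ n ih =>
    obtain ⟨v, hv, t, hvt, ht⟩ := h.exists_bag A (Finset.card_pos.1 (by omega))
    obtain ⟨col, hcol⟩ := ih (A.erase v) (by rw [Finset.card_erase_of_mem hv, hn]; rfl)
    set K := A.filter ((bagGraph X).Adj v) with hK
    have hKcard : K.card < w + 1 := by
      have hsub : ((insert v K : Finset V) : Set V) ⊆ X t := by
        intro x hx
        rcases Finset.mem_insert.1 (Finset.mem_coe.1 hx) with rfl | hx
        · exact hvt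
        · exact ht x (Finset.mem_filter.1 hx).1 (Finset.mem_filter.1 hx).2
      have hle := (Set.ncard_le_ncard hsub (Set.toFinite _)).trans (hw t)
      rw [Set.ncard_coe_finset, Finset.card_insert_of_notMem (by simp [hK])] at hle
      omega
    obtain ⟨a, -, ha⟩ : ∃ a ∈ (Finset.univ : Finset (Fin (w + 1))), a ∉ K.image col := by
      refine Finset.exists_mem_notMem_of_card_lt_card ?_
      simpa using Finset.card_image_le.trans_lt hKcard
    have hane : ∀ x ∈ A, (bagGraph X).Adj v x → a ≠ col x := fun x hx hvx hax =>
      ha (Finset.mem_image.2 ⟨x, Finset.mem_filter.2 ⟨hx, hvx⟩, hax.symm⟩)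
    refine ⟨Function.update col v a, fun x hx y hy hxy => ?_⟩
    by_cases hxv : x = v
    · subst hxv
      rw [Function.update_self, Function.update_of_ne hxy.ne']
      exact hane y hy hxy
    · by_cases hyv : y = v
      · subst hyv
        rw [Function.update_self, Function.update_of_ne hxv]
        exact (hane x hx hxy.symm).symm
      · rw [Function.update_of_ne hxv, Function.update_of_ne hyv]
        exact hcol x (Finset.mem_erase.2 ⟨hxv, hx⟩) y (Finset.mem_erase.2 ⟨hyv, hy⟩) hxy

/-- Some color class of a proper coloring with `w + 1` colors is a large set without two vertices
in a common bag. -/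
theorem IsTreeDecomp.exists_large_stable [Finite ι] [Fintype V] {G : SimpleGraph V} {w : ℕ}
    (h : IsTreeDecomp G T X) (hw : ∀ t, (X t).ncard ≤ w + 1) :
    ∃ I : Finset V, (∀ x ∈ I, ∀ y ∈ I, ¬ (bagGraph X).Adj x y) ∧
      (Fintype.card V : ℝ) / (w + 1) ≤ I.card := by
  obtain ⟨col, hcol⟩ := h.exists_coloring hw Finset.univ
  obtain ⟨i, hi⟩ := Fintype.exists_le_card_fiber_of_nsmul_le_card col
    (b := (Fintype.card V : ℝ) / (w + 1)) (by
      simp only [Fintype.card_fin, nsmul_eq_mul, Nat.cast_add, Nat.cast_one]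
      rw [mul_div_cancel₀ _ (by positivity)])
  refine ⟨_, fun x hx y hy hxy => ?_, hi⟩
  exact hcol x (by simp) y (by simp) hxy
    ((Finset.mem_filter.1 hx).2.trans (Finset.mem_filter.1 hy).2.symm)

end TreeDecomposition

/-! ### Counting -/

theorem linked_of_monoReach {V : Type*} {G H : SimpleGraph V} (hGH : G ≤ H) {c : V → ℕ} {a b : V}
    (h : MonoReach G Set.univ c a b) : Linked (NearAdj G H 1) {v | c v = c a} a b := by
  obtain ⟨p, hp⟩ := h
  generalize c a = i at hp ⊢
  induction p with
  | nil => exact Linked.refl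
  | @cons u v _ hadj p ih =>
    have hE : NearAdj G H 1 u v := ⟨hGH hadj, hadj.toWalk, by simp⟩
    have hu : c u = i := (hp u (by simp)).2
    have hv : c v = i := (hp v (by simp)).2
    exact (Linked.single (W := {v | c v = i}) hu hv hE).trans (ih fun x hx => hp x (by simp [hx]))

/-- If every choice of colors on `I` from lists of size `m` extends to a function in the finite set
`𝒞`, then `𝒞` has at least `m ^ |I|` elements. -/
theorem pow_card_le_ncard_of_extends {V : Type*} [Fintype V] {L : V → Finset ℕ} {m : ℕ}
    (hm : ∀ v, (L v).card = m) (I : Finset V) {𝒞 : Set (V → ℕ)} (hfin : 𝒞.Finite)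
    (hext : ∀ φ : V → ℕ, (∀ v ∈ I, φ v ∈ L v) → ∃ c ∈ 𝒞, ∀ v ∈ I, c v = φ v) :
    m ^ I.card ≤ 𝒞.ncard := by
  classical
  let P : Finset (V → ℕ) := Fintype.piFinset fun v => if v ∈ I then L v else {0}
  have hP : P.card = m ^ I.card := by
    rw [Fintype.card_piFinset, ← Finset.prod_const, ← Finset.prod_subset (Finset.subset_univ I)]
    · exact Finset.prod_congr rfl fun v hv => by rw [if_pos hv, hm]
    · intro v _ hv
      rw [if_neg hv, Finset.card_singleton]
  have hPI : ∀ φ ∈ P, ∀ v, φ v ∈ if v ∈ I then L v else {0} := fun φ hφ =>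
    Fintype.mem_piFinset.1 hφ
  have hchoose : ∀ φ : V → ℕ, ∃ c : V → ℕ, φ ∈ P → c ∈ 𝒞 ∧ ∀ v ∈ I, c v = φ v := by
    intro φ
    by_cases hφ : φ ∈ P
    · obtain ⟨c, hc, hcφ⟩ := hext φ fun v hv => by simpa [hv] using hPI φ hφ v
      exact ⟨c, fun _ => ⟨hc, hcφ⟩⟩
    · exact ⟨φ, fun h => absurd h hφ⟩
  choose e he using hchoose
  have hinj : Set.InjOn e P := by
    intro φ hφ ψ hψ h
    ext v
    by_cases hv : v ∈ I
    · rw [← (he φ hφ).2 v hv, h, (he ψ hψ).2 v hv]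
    · have h1 := hPI φ hφ v
      have h2 := hPI ψ hψ v
      simp only [if_neg hv, Finset.mem_singleton] at h1 h2
      rw [h1, h2]
  rw [← hP, ← Set.ncard_coe_finset, ← hinj.ncard_image]
  refine Set.ncard_le_ncard ?_ hfin
  rintro _ ⟨φ, hφ, rfl⟩
  exact (he φ hφ).1

/-- **Corollary.** For every nonnegative integer `w`, there exists a positive integer `N`
such that for every integer `m ≥ 2`, every graph `G` with tree-width at most `w`, and every
`m`-list-assignment `L` of `G`, there exist at least `m ^ (|V(G)|/(w+1))` different
`L`-colorings of `G` with weak diameter in `G` at most `N`. -/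
theorem treewidth_exponentially_many_colorings_weak_diameter (w : ℕ) :
    ∃ N : ℕ, 0 < N ∧
      ∀ (m : ℕ), 2 ≤ m →
      ∀ (V : Type u) [Fintype V] (G : SimpleGraph V),
        TreewidthLE G w →
        ∀ L : V → Finset ℕ,
          (∀ x, (L x).Nonempty) →
          (∀ x, (L x).card = m) →
          (m : ℝ) ^ ((Fintype.card V : ℝ) / ((w : ℝ) + 1)) ≤
            ({c : V → ℕ | (∀ x, c x ∈ L x) ∧ HasWeakDiamLE G Set.univ c N}.ncard : ℝ) := by
  obtain ⟨M, N, hN⟩ := exists_extendsWithin.{u} (w + 1) 1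
  refine ⟨N + 1, N.succ_pos, ?_⟩
  intro m hm V _ G ⟨ι, _, T, X, hX, hw⟩ L hL hLm
  classical
  obtain ⟨I, hI, hIcard⟩ := hX.exists_large_stable hw
  have hGH : G ≤ bagGraph X := fun a b hab => ⟨hab.ne, hX.2.2.1 hab⟩
  have hcount : m ^ I.card ≤
      {c : V → ℕ | (∀ x, c x ∈ L x) ∧ HasWeakDiamLE G Set.univ c (N + 1)}.ncard := by
    refine pow_card_le_ncard_of_extends hLm I ?_ fun φ hφ => ?_
    · exact (Fintype.piFinset L).finite_toSet.subset fun c hc =>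
        Finset.mem_coe.2 (Fintype.mem_piFinset.2 hc.1)
    let L' : V → Finset ℕ := fun v => if v ∈ I then {φ v} else L v
    have hL' : ∀ v a, ∃ b ∈ L' v, v ∉ (I : Set V) → b ≠ a := by
      intro v a
      by_cases hv : v ∈ I
      · exact ⟨φ v, by simp [L', hv], fun h => absurd hv h⟩
      · obtain ⟨b, hb, hba⟩ := Finset.exists_mem_ne (by rw [hLm v]; omega : 1 < (L v).card) a
        exact ⟨b, by simp [L', hv, hb], fun _ => hba⟩
    choose f hf _ using fun v => hL' v 0
    obtain ⟨c, hc, -, -, hcN⟩ := hN V G (bagGraph X) I L' hX.hereditarilySimplicial hI hL'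
      Finset.univ ∅ (fun K _ => hX.card_le_of_isClique hw K) (by simp) (by simp) f hf
    have hcI : ∀ v ∈ I, c v = φ v := fun v hv => by simpa [L', hv] using hc v
    refine ⟨c, ⟨fun v => ?_, fun a b hab => ?_⟩, hcI⟩
    · by_cases hv : v ∈ I
      · exact hcI v hv ▸ hφ v hv
      · simpa [L', hv] using hc v
    · obtain ⟨p, hp⟩ := hcN a b (by simpa using linked_of_monoReach hGH hab)
      exact ((SimpleGraph.dist_le p).trans hp).trans N.le_succ
  calc (m : ℝ) ^ ((Fintype.card V : ℝ) / ((w : ℝ) + 1)) ≤ (m : ℝ) ^ (I.card : ℝ) :=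
        Real.rpow_le_rpow_of_exponent_le (by exact_mod_cast (by omega : 1 ≤ m)) hIcard
    _ = ((m ^ I.card : ℕ) : ℝ) := by rw [Real.rpow_natCast, Nat.cast_pow]
    _ ≤ _ := by exact_mod_cast hcount
end

section
/- For every nonnegative integer w and every positive integer Δ, there exists a positive integer N such that for every integer m ≥ 2, every graph G with tree-width at most w and maximum degree at most Δ, and every m-list-assignment L of G, there exist at least m^{|V(G)|/(w+1)} different L-colorings of G with clustering at most N. -/
open SimpleGraph

universe u

/-- The coloring `c` (with domain `S`) has clustering at most `N`:
every monochromatic component has at most `N` vertices. -/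
def HasClusteringLE {β : Type*} {α : Type*} (G : SimpleGraph β) (S : Set β) (c : β → α)
    (N : ℕ) : Prop :=
  ∀ a : β, {b | MonoReach G S c a b}.ncard ≤ N

/-- `G` has maximum degree at most `Δ`. -/
def MaxDegreeLE {V : Type*} (G : SimpleGraph V) (Δ : ℕ) : Prop :=
  ∀ v, (G.neighborSet v).ncard ≤ Δ

section Bags

open scoped Classical

/-- The list of bags can be taken apart from the front, each bag meeting the union of the later
ones inside a single later bag. -/
inductive IsBagElimination {V : Type*} : List (Finset V) → Prop
  | singleton (X : Finset V) : IsBagElimination [X]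
  | cons {X P : Finset V} {l : List (Finset V)} (hP : P ∈ l)
      (hXP : ∀ Y ∈ l, ∀ v ∈ X, v ∈ Y → v ∈ P) (hl : IsBagElimination l) :
      IsBagElimination (X :: l)

theorem exists_isBagElimination_of_isTree {V : Type*} (n : ℕ) :
    ∀ {ι : Type*} [Fintype ι] (T : SimpleGraph ι) (X : ι → Finset V), Fintype.card ι = n →
      T.IsTree →
      (∀ v s t, v ∈ X s → v ∈ X t →
        Relation.ReflTransGen (fun a b => T.Adj a b ∧ v ∈ X a ∧ v ∈ X b) s t) →
      ∃ l, IsBagElimination l ∧ ∀ Y, Y ∈ l ↔ ∃ t, X t = Y := by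
  induction n with
  | zero =>
    intro ι _ T X hn hT _
    have := hT.connected.nonempty
    exact absurd hn Fintype.card_ne_zero
  | succ n ih =>
    intro ι _ T X hn hT hX
    have hne := hT.connected.nonempty
    rcases subsingleton_or_nontrivial ι with hι | hι
    · obtain ⟨r⟩ := hne
      refine ⟨[X r], .singleton _, fun Y => ?_⟩
      rw [List.mem_singleton]
      constructor
      · rintro rfl
        exact ⟨r, rfl⟩
      · rintro ⟨t, rfl⟩
        rw [Subsingleton.elim t r]
    · obtain ⟨a, -, -, ha, -⟩ := hT.exists_ne_and_degree_eq_one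
      obtain ⟨p, hap, hp⟩ := degree_eq_one_iff_existsUnique_adj.mp ha
      have hpa : p ≠ a := hap.ne'
      have htree : (T.induce {a}ᶜ).IsTree :=
        ⟨hT.connected.induce_compl_singleton_of_degree_eq_one ha, hT.isAcyclic.induce _⟩
      let π : ι → ({a}ᶜ : Set ι) := fun s => if h : s = a then ⟨p, hpa⟩ else ⟨s, h⟩
      have hπa : π a = ⟨p, hpa⟩ := dif_pos rfl
      have hπ : ∀ (s : ι) (h : s ≠ a), π s = ⟨s, h⟩ := fun s h => dif_neg h
      have hleaf : ∀ v s, v ∈ X a → v ∈ X s → s ≠ a → v ∈ X p := by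
        intro v s hva hvs hs
        rcases (hX v a s hva hvs).cases_head with h | ⟨c, ⟨hac, -, hvc⟩, -⟩
        · exact absurd h.symm hs
        · rwa [hp c hac] at hvc
      obtain ⟨l, hl, hlX⟩ := ih (T.induce {a}ᶜ) (fun s => X s) (by
          have := Fintype.card_compl_set ({a} : Set ι)
          simp only [Fintype.card_unique, hn] at this
          simpa using this) htree (by
        rintro v ⟨s, hs⟩ ⟨t, ht⟩ hvs hvt
        have := Relation.ReflTransGen.lift' π
          (p := fun b c => (T.induce {a}ᶜ).Adj b c ∧ v ∈ X b ∧ v ∈ X c) ?_ _ _ (hX v s t hvs hvt)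
        · simpa only [Function.onFun, hπ s hs, hπ t ht] using this
        · rintro b c ⟨hbc, hvb, hvc⟩
          change Relation.ReflTransGen _ (π b) (π c)
          by_cases hb : b = a
          · subst hb
            rw [hp c hbc, hπa, hπ p hpa]
          · by_cases hc : c = a
            · subst hc
              rw [hp b hbc.symm, hπa, hπ p hpa]
            · rw [hπ b hb, hπ c hc]
              exact .single ⟨hbc, hvb, hvc⟩)
      refine ⟨X a :: l, .cons (P := X p) ((hlX _).2 ⟨⟨p, hpa⟩, rfl⟩) ?_ hl, fun Y => ?_⟩
      · intro Y hY v hva hvY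
        obtain ⟨⟨s, hs⟩, rfl⟩ := (hlX Y).1 hY
        exact hleaf v s hva hvY hs
      · rw [List.mem_cons, hlX]
        constructor
        · rintro (rfl | ⟨t, rfl⟩)
          · exact ⟨a, rfl⟩
          · exact ⟨t, rfl⟩
        · rintro ⟨t, rfl⟩
          by_cases h : t = a
          · exact .inl (by rw [h])
          · exact .inr ⟨⟨t, h⟩, rfl⟩

theorem TreewidthLE.exists_isBagElimination {V : Type*} [Fintype V] {G : SimpleGraph V} {w : ℕ}
    (h : TreewidthLE G w) :
    ∃ l : List (Finset V), IsBagElimination l ∧ (∀ Y ∈ l, Y.card ≤ w + 1) ∧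
      (∀ v, ∃ Y ∈ l, v ∈ Y) ∧ ∀ a b, G.Adj a b → ∃ Y ∈ l, a ∈ Y ∧ b ∈ Y := by
  obtain ⟨ι, _, T, X, ⟨hT, hcov, hadj, hconn⟩, hw⟩ := h
  obtain ⟨l, hl, hlX⟩ := exists_isBagElimination_of_isTree _ T (fun t => (X t).toFinset) rfl hT (by
    intro v s t hs ht
    rw [Set.mem_toFinset] at hs ht
    have := (hconn v).preconnected ⟨s, hs⟩ ⟨t, ht⟩
    rw [reachable_iff_reflTransGen] at this
    refine Relation.ReflTransGen.lift Subtype.val ?_ _ _ this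
    rintro ⟨b, hb⟩ ⟨c, hc⟩ hbc
    exact ⟨hbc, Set.mem_toFinset.2 hb, Set.mem_toFinset.2 hc⟩)
  refine ⟨l, hl, ?_, ?_, ?_⟩
  · intro Y hY
    obtain ⟨t, rfl⟩ := (hlX Y).1 hY
    rw [← Set.ncard_eq_toFinset_card']
    exact hw t
  · intro v
    obtain ⟨t, ht⟩ := hcov v
    exact ⟨_, (hlX _).2 ⟨t, rfl⟩, Set.mem_toFinset.2 ht⟩
  · intro a b hab
    obtain ⟨t, ha, hb⟩ := hadj hab
    exact ⟨_, (hlX _).2 ⟨t, rfl⟩, Set.mem_toFinset.2 ha, Set.mem_toFinset.2 hb⟩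

theorem exists_injOn_union_extend {α : Type*} [DecidableEq α] {k : ℕ} (B : Finset α) (c : α → ℕ)
    (hc : Set.InjOn c B) (hk : ∀ b ∈ B, c b < k) (D : Finset α) (hD : (B ∪ D).card ≤ k) :
    ∃ c' : α → ℕ, (∀ x, x ∈ B ∨ x ∉ D → c' x = c x) ∧ Set.InjOn c' (B ∪ D : Finset α) ∧
      ∀ x ∈ B ∪ D, c' x < k := by
  induction D using Finset.induction_on with
  | empty => exact ⟨c, fun _ _ => rfl, by simpa using hc, by simpa using hk⟩
  | insert d D hd ih =>
    obtain ⟨c', h1, h2, h3⟩ := ih ((Finset.card_le_card (by grind)).trans hD)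
    by_cases hdB : d ∈ B
    · have : B ∪ insert d D = B ∪ D := by grind
      rw [this]
      exact ⟨c', fun x hx => h1 x (by grind), h2, h3⟩
    · have hlt : ((B ∪ D).image c').card < (Finset.range k).card := by
        rw [Finset.card_range]
        refine Finset.card_image_le.trans_lt (lt_of_lt_of_le ?_ hD)
        exact Finset.card_lt_card ⟨by grind, by grind⟩
      obtain ⟨i, hi, hi'⟩ := Finset.exists_mem_notMem_of_card_lt_card hlt
      refine ⟨Function.update c' d i, fun x hx => ?_, ?_, ?_⟩
      · rw [Function.update_of_ne (by grind)]
        exact h1 x (by grind)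
      · intro x hx y hy hxy
        have h2' : ∀ x ∈ B ∪ D, ∀ y ∈ B ∪ D, c' x = c' y → x = y := h2
        simp only [Function.update_apply] at hxy
        simp only [Finset.mem_coe] at hx hy
        grind
      · simp only [Function.update_apply]
        grind

theorem IsBagElimination.exists_injOn {V : Type*} {k : ℕ} {l : List (Finset V)}
    (hl : IsBagElimination l) (hk : ∀ Y ∈ l, Y.card ≤ k) :
    ∃ c : V → ℕ, ∀ Y ∈ l, Set.InjOn c Y ∧ ∀ v ∈ Y, c v < k := by
  induction hl with
  | singleton X =>
    obtain ⟨c, -, h2, h3⟩ := exists_injOn_union_extend (k := k) (∅ : Finset V) (fun _ => 0)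
      (by simp) (by simp) X (by simpa using hk)
    refine ⟨c, fun Y hY => ?_⟩
    rw [List.mem_singleton] at hY
    subst hY
    rw [Finset.empty_union] at h2 h3
    exact ⟨h2, h3⟩
  | @cons X P l hP hXP _ ih =>
    obtain ⟨c, hc⟩ := ih fun Y hY => hk Y (List.mem_cons_of_mem _ hY)
    obtain ⟨c', h1, h2, h3⟩ := exists_injOn_union_extend (k := k) (X ∩ P) c
      ((hc P hP).1.mono (by simp)) (fun b hb => (hc P hP).2 b (by grind)) X
      ((Finset.card_le_card (by grind)).trans (hk X List.mem_cons_self))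
    have hX : X ∩ P ∪ X = X := by grind
    rw [hX] at h2 h3
    refine ⟨c', fun Y hY => ?_⟩
    rcases List.mem_cons.1 hY with rfl | hY
    · exact ⟨h2, h3⟩
    · have heq : ∀ v ∈ Y, c' v = c v := fun v hv => h1 v (by have := hXP Y hY v; grind)
      refine ⟨(hc Y hY).1.congr fun v hv => (heq v hv).symm, fun v hv => ?_⟩
      rw [heq v hv]
      exact (hc Y hY).2 v hv

/-- Every vertex set `S` of size at least `q` has a separation `(A ∪ X, V \ A)` of order at most
`κ` whose first side contains at least `q` vertices of `S`, with at most `2 * q` of them in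
`A`. -/
def HasSeparators {V : Type*} (G : SimpleGraph V) (κ : ℕ) : Prop :=
  ∀ (S : Finset V) (q : ℕ), q ≤ S.card → ∃ A X : Finset V, X.card ≤ κ ∧ Disjoint A X ∧
    (∀ a ∈ A, ∀ b, G.Adj a b → b ∈ A ∪ X) ∧ q ≤ (S ∩ (A ∪ X)).card ∧ (S ∩ A).card ≤ 2 * q

theorem IsBagElimination.exists_separation {V : Type*} {G : SimpleGraph V} {κ q : ℕ}
    {S : Finset V} {l : List (Finset V)} (hl : IsBagElimination l) (hκ : ∀ Y ∈ l, Y.card ≤ κ)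
    (hq : q ≤ S.card) (H : Finset V → Finset V) (hH : ∀ Y ∈ l, (S ∩ H Y).card ≤ 2 * q)
    (hclosed : ∀ Y ∈ l, ∀ a ∈ H Y, ∀ b, G.Adj a b → b ∈ H Y ∪ Y)
    (hcov : ∀ v ∈ S, ∃ Y ∈ l, v ∈ H Y ∪ Y)
    (hadj : ∀ Y ∈ l, ∀ a ∈ Y, ∀ b, G.Adj a b → ∃ Z ∈ l, a ∈ Z ∧ b ∈ H Z ∪ Z) :
    ∃ A X : Finset V, X.card ≤ κ ∧ (∀ a ∈ A, ∀ b, G.Adj a b → b ∈ A ∪ X) ∧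
      q ≤ (S ∩ (A ∪ X)).card ∧ (S ∩ A).card ≤ 2 * q := by
  induction hl generalizing H with
  | singleton X =>
    refine ⟨H X, X, hκ X (by simp), hclosed X (by simp), ?_, hH X (by simp)⟩
    refine hq.trans (Finset.card_le_card fun v hv => ?_)
    obtain ⟨Y, hY, hvY⟩ := hcov v hv
    rw [List.mem_singleton] at hY
    subst hY
    exact Finset.mem_inter.2 ⟨hv, hvY⟩
  | @cons X P l hP hXP _ ih =>
    have hXl : X ∈ X :: l := List.mem_cons_self
    have hPl : P ∈ X :: l := List.mem_cons_of_mem _ hP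
    by_cases hqP : q ≤ (S ∩ (H P ∪ P)).card
    · exact ⟨H P, P, hκ P hPl, hclosed P hPl, hqP, hH P hPl⟩
    by_cases hqX : q ≤ (S ∩ (H X ∪ X)).card
    · exact ⟨H X, X, hκ X hXl, hclosed X hXl, hqX, hH X hXl⟩
    let H' := Function.update H P (H P ∪ H X ∪ (X \ P))
    have hH'P : H' P = H P ∪ H X ∪ (X \ P) := Function.update_self ..
    have hH' : ∀ Y, Y ≠ P → H' Y = H Y := fun Y h => Function.update_of_ne h ..
    have hsub : ∀ Y, H Y ⊆ H' Y := fun Y => by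
      by_cases h : Y = P
      · subst h
        grind
      · rw [hH' Y h]
    have hXsub : H X ∪ X ⊆ H' P ∪ P := by grind
    refine ih (fun Y hY => hκ Y (List.mem_cons_of_mem _ hY)) H' ?_ ?_ ?_ ?_
    · intro Y hY
      by_cases h : Y = P
      · subst h
        rw [hH'P]
        have : S ∩ (H Y ∪ H X ∪ X \ Y) ⊆ (S ∩ (H Y ∪ Y)) ∪ (S ∩ (H X ∪ X)) := by grind
        have := (Finset.card_le_card this).trans (Finset.card_union_le _ _)
        omega
      · rw [hH' Y h]
        exact hH Y (List.mem_cons_of_mem _ hY)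
    · intro Y hY a ha b hab
      by_cases h : Y = P
      · subst h
        rw [hH'P] at ha
        rcases Finset.mem_union.1 ha with ha | ha
        · rcases Finset.mem_union.1 ha with ha | ha
          · have := hclosed Y hPl a ha b hab
            have := hsub Y
            grind
          · exact hXsub (hclosed X hXl a ha b hab)
        · obtain ⟨haX, haY⟩ := Finset.mem_sdiff.1 ha
          obtain ⟨Z, hZ, haZ, hbZ⟩ := hadj X hXl a haX b hab
          rcases List.mem_cons.1 hZ with rfl | hZ
          · exact hXsub hbZ
          · exact absurd (hXP Z hZ a haX haZ) haY
      · rw [hH' Y h] at ha ⊢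
        exact hclosed Y (List.mem_cons_of_mem _ hY) a ha b hab
    · intro v hv
      obtain ⟨Y, hY, hvY⟩ := hcov v hv
      rcases List.mem_cons.1 hY with rfl | hY
      · exact ⟨P, hP, hXsub hvY⟩
      · exact ⟨Y, hY, Finset.union_subset_union_left (hsub Y) hvY⟩
    · intro Y hY a ha b hab
      obtain ⟨Z, hZ, haZ, hbZ⟩ := hadj Y (List.mem_cons_of_mem _ hY) a ha b hab
      rcases List.mem_cons.1 hZ with rfl | hZ
      · exact ⟨P, hP, hXP Y hY a haZ ha, hXsub hbZ⟩
      · exact ⟨Z, hZ, haZ, Finset.union_subset_union_left (hsub Z) hbZ⟩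

theorem TreewidthLE.hasSeparators {V : Type*} [Fintype V] {G : SimpleGraph V} {w : ℕ}
    (h : TreewidthLE G w) : HasSeparators G (w + 1) := by
  intro S q hq
  obtain ⟨l, hl, hw, hcov, hadj⟩ := h.exists_isBagElimination
  obtain ⟨A, X, hX, hA, hqA, hqA'⟩ := hl.exists_separation (G := G) hw hq (fun _ => ∅) (by simp)
    (by simp) (by simpa using fun v _ => hcov v) (by
      intro Y _ a _ b hab
      obtain ⟨Z, hZ, ha, hb⟩ := hadj a b hab
      exact ⟨Z, hZ, ha, by simpa using hb⟩)
  refine ⟨A \ X, X, hX, Finset.sdiff_disjoint, fun a ha b hab => ?_, ?_, ?_⟩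
  · have := hA a (by grind) b hab
    grind
  · rwa [Finset.sdiff_union_self_eq_union]
  · exact (Finset.card_le_card (by grind)).trans hqA'

theorem TreewidthLE.exists_indep {V : Type*} [Fintype V] {G : SimpleGraph V} {w : ℕ}
    (h : TreewidthLE G w) :
    ∃ I : Finset V, (∀ a ∈ I, ∀ b ∈ I, ¬ G.Adj a b) ∧ Fintype.card V ≤ (w + 1) * I.card := by
  obtain ⟨l, hl, hw, hcov, hadj⟩ := h.exists_isBagElimination
  obtain ⟨c, hc⟩ := hl.exists_injOn hw
  have hlt : ∀ v, c v < w + 1 := fun v => by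
    obtain ⟨Y, hY, hv⟩ := hcov v
    exact (hc Y hY).2 v hv
  by_contra! hcon
  have hsum := Finset.card_eq_sum_card_fiberwise (f := c) (s := Finset.univ)
    (t := Finset.range (w + 1)) fun v _ => by simpa using hlt v
  have hI : ∀ i, Fintype.card V > (w + 1) * {v : V | c v = i}.toFinset.card := fun i =>
    hcon _ fun a ha b hb hab => by
      obtain ⟨Y, hY, haY, hbY⟩ := hadj a b hab
      simp only [Set.mem_toFinset, Set.mem_ofPred_eq] at ha hb
      exact hab.ne ((hc Y hY).1 haY hbY (ha.trans hb.symm))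
  have := Finset.sum_lt_sum_of_nonempty (s := Finset.range (w + 1)) (by simp) fun i _ => hI i
  rw [← Finset.mul_sum] at this
  simp only [Finset.sum_const, Finset.card_range, smul_eq_mul] at this
  have h2 := lt_of_mul_lt_mul_left this (Nat.zero_le _)
  rw [Finset.card_univ] at hsum
  refine h2.ne' (hsum.trans (Finset.sum_congr rfl fun i _ => ?_))
  congr 1
  ext v
  simp

end Bags

section Extension

open scoped Classical

/-- The adjacent pairs in `R × W` whose first vertex has color `c`. -/
noncomputable def crossingPairs {V : Type*} (G : SimpleGraph V) (f : V → ℕ) (c : ℕ)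
    (R W : Finset V) : Finset (V × V) :=
  {p ∈ R ×ˢ W | f p.1 = c ∧ G.Adj p.1 p.2}

theorem mem_crossingPairs {V : Type*} {G : SimpleGraph V} {f : V → ℕ} {c : ℕ} {R W : Finset V}
    {p : V × V} :
    p ∈ crossingPairs G f c R W ↔ (p.1 ∈ R ∧ p.2 ∈ W) ∧ f p.1 = c ∧ G.Adj p.1 p.2 := by
  simp [crossingPairs]

theorem card_crossingPairs_le {V : Type*} [Fintype V] {G : SimpleGraph V} {D : ℕ}
    (hD : ∀ v, (Finset.univ.filter (G.Adj v)).card ≤ D) (f : V → ℕ) (c : ℕ) (R W : Finset V) :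
    (crossingPairs G f c R W).card ≤ D * R.card := by
  refine Finset.card_le_mul_card_image_of_maps_to (f := Prod.fst)
    (fun p hp => (mem_crossingPairs.1 hp).1.1) D fun x _ => ?_
  refine (Finset.card_le_card_of_injOn Prod.snd ?_ ?_).trans (hD x)
  · rintro ⟨y, z⟩ h
    simp only [Finset.coe_filter, mem_crossingPairs, Set.mem_ofPred_eq] at h
    obtain ⟨⟨-, -, h⟩, rfl⟩ := h
    simpa using h
  · rintro ⟨y, z⟩ h ⟨y', z'⟩ h' hz
    simp only [Finset.coe_filter, Set.mem_ofPred_eq] at h h'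
    exact Prod.ext (h.2.trans h'.2.symm) hz

/-- `g` extends the coloring `f` of `R` to `U`, where `Q c` contains all vertices outside `R` that
are joined to `R` inside the color class `c` and has size controlled by the rank `ρ c`, and all
other monochromatic components have at most `N` vertices. -/
structure IsBoundedExtension {V : Type*} (G : SimpleGraph V) (L : V → Finset ℕ) (B : ℕ → ℕ) (N : ℕ)
    (R U : Finset V) (f : V → ℕ) (ρ : ℕ → ℕ) (g : V → ℕ) (Q : ℕ → Finset V) : Prop where
  eq_of_mem : ∀ x ∈ R, g x = f x
  mem_list : ∀ x ∈ U, g x ∈ L x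
  subset : ∀ c, Q c ⊆ U \ R
  color_eq : ∀ c, ∀ x ∈ Q c, g x = c
  closed : ∀ c, ∀ x ∈ R ∪ Q c, g x = c → ∀ y ∈ U \ R, G.Adj x y → g y = c → y ∈ Q c
  card_le : ∀ c, (Q c).card ≤ B (ρ c) * (crossingPairs G f c R (U \ R)).card
  cover : ∀ a ∈ U \ R, a ∈ Q (g a) ∨ ∃ P ⊆ U \ R, a ∈ P ∧ P.card ≤ N ∧
    ∀ x ∈ P, ∀ y ∈ U, G.Adj x y → g y = g x → y ∈ P

/-- Every list coloring of `R`, with its colors ranked injectively below `k`, has a bounded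
extension to `U`. -/
def IsExtendable {V : Type*} (G : SimpleGraph V) (L : V → Finset ℕ) (B : ℕ → ℕ) (N k : ℕ)
    (R U : Finset V) : Prop :=
  ∀ f ρ : _ → ℕ, (∀ x ∈ R, f x ∈ L x) → Set.InjOn ρ (R.image f : Finset ℕ) →
    (∀ x ∈ R, ρ (f x) < k) → ∃ g Q, IsBoundedExtension G L B N R U f ρ g Q

theorem IsExtendable.refl {V : Type*} (G : SimpleGraph V) (L : V → Finset ℕ) (B : ℕ → ℕ)
    (N k : ℕ) (R : Finset V) : IsExtendable G L B N k R R := by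
  intro f ρ hf _ _
  refine ⟨f, fun _ => ∅, fun _ _ => rfl, hf, by simp, by simp, by simp, by simp, by simp⟩

theorem IsExtendable.union {V : Type*} {G : SimpleGraph V} {L : V → Finset ℕ} {B : ℕ → ℕ}
    {N k : ℕ} {R₁ U₁ R₂ U₂ : Finset V} (h₁ : IsExtendable G L B N k R₁ U₁)
    (h₂ : IsExtendable G L B N k R₂ U₂) (hR₁ : R₁ ⊆ U₁) (hR₂ : R₂ ⊆ U₂)
    (hU₁ : ∀ x ∈ U₁, x ∈ U₂ → x ∈ R₁) (hU₂ : ∀ x ∈ U₁, x ∈ U₂ → x ∈ R₂)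
    (hadj₁ : ∀ x ∈ U₁ \ R₁, ∀ y ∈ U₂, G.Adj x y → y ∈ U₁)
    (hadj₂ : ∀ x ∈ U₂ \ R₂, ∀ y ∈ U₁, G.Adj x y → y ∈ U₂) :
    IsExtendable G L B N k (R₁ ∪ R₂) (U₁ ∪ U₂) := by
  intro f ρ hf hρ hk
  obtain ⟨g₁, Q₁, e₁⟩ := h₁ f ρ (fun x hx => hf x (by grind))
    (hρ.mono (Finset.coe_subset.2 (Finset.image_subset_image Finset.subset_union_left)))
    (fun x hx => hk x (by grind))
  obtain ⟨g₂, Q₂, e₂⟩ := h₂ f ρ (fun x hx => hf x (by grind))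
    (hρ.mono (Finset.coe_subset.2 (Finset.image_subset_image Finset.subset_union_right)))
    (fun x hx => hk x (by grind))
  obtain ⟨g, hg⟩ : ∃ g : V → ℕ, g = fun x => if x ∈ U₁ then g₁ x else g₂ x := ⟨_, rfl⟩
  have hg₁ : ∀ x ∈ U₁, g x = g₁ x := fun x hx => by rw [hg]; exact if_pos hx
  have hg₂ : ∀ x ∈ U₂, g x = g₂ x := fun x hx => by
    by_cases h : x ∈ U₁
    · rw [hg₁ x h, e₁.eq_of_mem x (hU₁ x h hx), e₂.eq_of_mem x (hU₂ x h hx)]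
    · rw [hg]
      exact if_neg h
  have hdiff : (U₁ ∪ U₂) \ (R₁ ∪ R₂) = (U₁ \ R₁) ∪ (U₂ \ R₂) := by grind
  have hQ₁ := e₁.subset
  have hQ₂ := e₂.subset
  refine ⟨g, fun c => Q₁ c ∪ Q₂ c, ?_, ?_, ?_, ?_, ?_, ?_, ?_⟩
  · intro x hx
    rcases Finset.mem_union.1 hx with hx | hx
    · rw [hg₁ x (hR₁ hx), e₁.eq_of_mem x hx]
    · rw [hg₂ x (hR₂ hx), e₂.eq_of_mem x hx]
  · intro x hx
    rcases Finset.mem_union.1 hx with hx | hx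
    · rw [hg₁ x hx]
      exact e₁.mem_list x hx
    · rw [hg₂ x hx]
      exact e₂.mem_list x hx
  · intro c
    rw [hdiff]
    exact Finset.union_subset_union (hQ₁ c) (hQ₂ c)
  · intro c x hx
    rcases Finset.mem_union.1 hx with hx | hx
    · rw [hg₁ x (by have := hQ₁ c hx; grind), e₁.color_eq c x hx]
    · rw [hg₂ x (by have := hQ₂ c hx; grind), e₂.color_eq c x hx]
  · intro c x hx hxc y hy hxy hyc
    rw [hdiff] at hy
    have hxU : x ∈ U₁ ∪ U₂ := by have := @hQ₁ c x; have := @hQ₂ c x; grind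
    rcases Finset.mem_union.1 hy with hy | hy
    · have hyU : y ∈ U₁ := by grind
      have hxU₁ : x ∈ U₁ := by
        by_contra h
        exact h (hadj₁ y hy x (by grind) hxy.symm)
      refine Finset.mem_union_left _ (e₁.closed c x ?_ (by rw [← hg₁ x hxU₁, hxc]) y hy hxy
        (by rw [← hg₁ y hyU, hyc]))
      have := @hQ₂ c x
      grind
    · have hyU : y ∈ U₂ := by grind
      have hxU₂ : x ∈ U₂ := by
        by_contra h
        exact h (hadj₂ y hy x (by grind) hxy.symm)
      refine Finset.mem_union_right _ (e₂.closed c x ?_ (by rw [← hg₂ x hxU₂, hxc]) y hy hxy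
        (by rw [← hg₂ y hyU, hyc]))
      have := @hQ₁ c x
      grind
  · intro c
    have hdisj : Disjoint (crossingPairs G f c R₁ (U₁ \ R₁)) (crossingPairs G f c R₂ (U₂ \ R₂)) := by
      rw [Finset.disjoint_left]
      intro p hp hp'
      rw [mem_crossingPairs] at hp hp'
      grind
    have hsub : crossingPairs G f c R₁ (U₁ \ R₁) ∪ crossingPairs G f c R₂ (U₂ \ R₂) ⊆
        crossingPairs G f c (R₁ ∪ R₂) ((U₁ ∪ U₂) \ (R₁ ∪ R₂)) := by
      intro p hp
      rw [hdiff]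
      rw [Finset.mem_union, mem_crossingPairs, mem_crossingPairs] at hp
      rw [mem_crossingPairs]
      grind
    have hcard := Finset.card_le_card hsub
    rw [Finset.card_union_of_disjoint hdisj] at hcard
    calc (Q₁ c ∪ Q₂ c).card ≤ _ := Finset.card_union_le _ _
      _ ≤ _ := add_le_add (e₁.card_le c) (e₂.card_le c)
      _ = _ := (mul_add _ _ _).symm
      _ ≤ _ := Nat.mul_le_mul_left _ hcard
  · intro a ha
    rw [hdiff] at ha ⊢
    rcases Finset.mem_union.1 ha with ha | ha
    · rw [hg₁ a (by grind)]
      rcases e₁.cover a ha with h | ⟨P, hP, haP, hPN, hPc⟩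
      · exact .inl (Finset.mem_union_left _ h)
      · refine .inr ⟨P, by grind, haP, hPN, fun x hx y hy hxy hyx => ?_⟩
        have hyU : y ∈ U₁ := by
          by_contra h
          exact h (hadj₁ x (hP hx) y (by grind) hxy)
        rw [hg₁ y hyU, hg₁ x (by have := hP hx; grind)] at hyx
        exact hPc x hx y hyU hxy hyx
    · rw [hg₂ a (by grind)]
      rcases e₂.cover a ha with h | ⟨P, hP, haP, hPN, hPc⟩
      · exact .inl (Finset.mem_union_right _ h)
      · refine .inr ⟨P, by grind, haP, hPN, fun x hx y hy hxy hyx => ?_⟩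
        have hyU : y ∈ U₂ := by
          by_contra h
          exact h (hadj₂ x (hP hx) y (by grind) hxy)
        rw [hg₂ y hyU, hg₂ x (by have := hP hx; grind)] at hyx
        exact hPc x hx y hyU hxy hyx

/-- Bounds the number of vertices reached, through one crossing edge, by a color of rank `r`. -/
def rankBound (k D : ℕ) : ℕ → ℕ
  | 0 => 0
  | r + 1 => k + rankBound k D r * (D * k)

theorem rankBound_mono (k D : ℕ) : Monotone (rankBound k D) := by
  refine monotone_nat_of_le_succ fun r => ?_
  induction r with
  | zero => exact Nat.zero_le _
  | succ r ih => exact Nat.add_le_add_left (Nat.mul_le_mul_right _ ih) _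

theorem exists_mem_list_ne {V : Type*} {L : V → Finset ℕ} (hL : ∀ x, 2 ≤ (L x).card)
    {C : Finset ℕ} {ρ : ℕ → ℕ} (hρ : Set.InjOn ρ C) :
    ∃ f : V → ℕ, ∀ x, f x ∈ L x ∧ (f x ∈ C → ρ (f x) ≠ 0) := by
  have : ∀ x, ∃ i ∈ L x, i ∈ C → ρ i ≠ 0 := by
    intro x
    obtain ⟨i, hi, j, hj, hij⟩ := Finset.one_lt_card.1 (hL x)
    by_contra! h
    obtain ⟨hiC, hi0⟩ := h i hi
    obtain ⟨hjC, hj0⟩ := h j hj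
    exact hij (hρ hiC hjC (hi0.trans hj0.symm))
  choose f hf using this
  exact ⟨f, hf⟩

theorem IsExtendable.union_of_subset {V : Type*} [Fintype V] {G : SimpleGraph V}
    {L : V → Finset ℕ} {k D : ℕ} (hD : ∀ v, (Finset.univ.filter (G.Adj v)).card ≤ D)
    (hL : ∀ x, 2 ≤ (L x).card) {R S U : Finset V}
    (h : IsExtendable G L (rankBound k D) (rankBound k D (k + 1)) k S U) (hSU : S ⊆ U)
    (hS : S.card ≤ k) (hRU : Disjoint R U) (hadj : ∀ x ∈ R, ∀ y ∈ U, G.Adj x y → y ∈ S) :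
    IsExtendable G L (rankBound k D) (rankBound k D (k + 1)) k R (R ∪ U) := by
  intro f ρ hf hρ hk
  obtain ⟨f', hf'⟩ := exists_mem_list_ne (L := L) hL hρ
  have hcard : ((S.image f' ∩ R.image f) ∪ S.image f').card ≤ k := by
    rw [Finset.union_eq_right.2 Finset.inter_subset_left]
    exact Finset.card_image_le.trans hS
  have hO : ∀ c ∈ S.image f' ∩ R.image f, c ∈ R.image f ∧ ρ c ≠ 0 ∧ ρ c < k := by
    intro c hc
    obtain ⟨hc, hc'⟩ := Finset.mem_inter.1 hc
    obtain ⟨x, hx, rfl⟩ := Finset.mem_image.1 hc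
    obtain ⟨y, hy, hyx⟩ := Finset.mem_image.1 hc'
    exact ⟨hc', (hf' x).2 hc', hyx ▸ hk y hy⟩
  obtain ⟨ρ', hρ'eq, hρ'inj, hρ'k⟩ := exists_injOn_union_extend (k := k)
    (S.image f' ∩ R.image f) (fun c => ρ c - 1) (by
      intro c hc d hd hcd
      have h1 := hO c hc
      have h2 := hO d hd
      refine hρ h1.1 h2.1 ?_
      simp only at hcd
      omega) (fun c hc => by have := hO c hc; omega) (S.image f') hcard
  rw [Finset.union_eq_right.2 Finset.inter_subset_left] at hρ'inj hρ'k
  obtain ⟨g', Q', e⟩ := h f' ρ' (fun x _ => (hf' x).1) hρ'inj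
    fun x hx => hρ'k _ (Finset.mem_image_of_mem _ hx)
  have hUR : ∀ x ∈ U, x ∉ R := fun x hx hxR => Finset.disjoint_left.1 hRU hxR hx
  have hdiff : (R ∪ U) \ R = U := by grind
  obtain ⟨g, hg⟩ : ∃ g : V → ℕ, g = fun x => if x ∈ R then f x else g' x := ⟨_, rfl⟩
  have hgR : ∀ x ∈ R, g x = f x := fun x hx => by rw [hg]; exact if_pos hx
  have hgU : ∀ x ∈ U, g x = g' x := fun x hx => by rw [hg]; exact if_neg (hUR x hx)
  obtain ⟨W, hW⟩ : ∃ W : ℕ → Finset V, W = fun c => {x ∈ S | g' x = c} ∪ Q' c := ⟨_, rfl⟩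
  have hmemW : ∀ c x, x ∈ W c ↔ (x ∈ S ∧ g' x = c) ∨ x ∈ Q' c := fun c x => by
    rw [hW, Finset.mem_union, Finset.mem_filter]
  have hWU : ∀ c, W c ⊆ U := fun c x hx => by
    rcases (hmemW c x).1 hx with hx | hx
    · exact hSU hx.1
    · exact (Finset.mem_sdiff.1 (e.subset c hx)).1
  have hWc : ∀ c, ∀ x ∈ W c, g x = c := fun c x hx => by
    rw [hgU x (hWU c hx)]
    rcases (hmemW c x).1 hx with hx | hx
    · exact hx.2
    · exact e.color_eq c x hx
  have hWclosed : ∀ c, ∀ x ∈ W c, ∀ y ∈ U, G.Adj x y → g y = c → y ∈ W c := by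
    intro c x hx y hy hxy hyc
    have hxc := hWc c x hx
    rw [hgU x (hWU c hx)] at hxc
    rw [hgU y hy] at hyc
    rw [hmemW]
    by_cases hyS : y ∈ S
    · exact .inl ⟨hyS, hyc⟩
    · refine .inr (e.closed c x ?_ hxc y (Finset.mem_sdiff.2 ⟨hy, hyS⟩) hxy hyc)
      rw [Finset.mem_union]
      exact ((hmemW c x).1 hx).imp_left fun h => h.1
  have hempty : ∀ c, c ∉ S.image f' → W c = ∅ := by
    intro c hc
    have h1 : crossingPairs G f' c S (U \ S) = ∅ := by
      rw [Finset.eq_empty_iff_forall_notMem]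
      intro p hp
      rw [mem_crossingPairs] at hp
      exact hc (Finset.mem_image.2 ⟨p.1, hp.1.1, hp.2.1⟩)
    have h2 := e.card_le c
    rw [h1, Finset.card_empty, mul_zero, Nat.le_zero, Finset.card_eq_zero] at h2
    rw [Finset.eq_empty_iff_forall_notMem]
    intro x hx
    rcases (hmemW c x).1 hx with hx | hx
    · exact hc (Finset.mem_image.2 ⟨x, hx.1, by rw [← e.eq_of_mem x hx.1, hx.2]⟩)
    · simp [h2] at hx
  have hWcard : ∀ c, (W c).card ≤ rankBound k D (ρ' c + 1) := by
    intro c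
    have h1 := e.card_le c
    have h2 : (crossingPairs G f' c S (U \ S)).card ≤ D * k :=
      (card_crossingPairs_le hD ..).trans (Nat.mul_le_mul_left _ hS)
    rw [hW]
    exact (Finset.card_union_le _ _).trans (add_le_add
      ((Finset.card_le_card (Finset.filter_subset _ _)).trans hS)
      (h1.trans (Nat.mul_le_mul_left _ h2)))
  have hcross : ∀ x ∈ R, ∀ y ∈ U, G.Adj x y →
      (crossingPairs G f (f x) R U).Nonempty := fun x hx y hy hxy =>
    ⟨(x, y), mem_crossingPairs.2 ⟨⟨hx, hy⟩, rfl, hxy⟩⟩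
  refine ⟨g, fun c => if (crossingPairs G f c R U).Nonempty then W c else ∅,
    hgR, ?_, ?_, ?_, ?_, ?_, ?_⟩
  · intro x hx
    rcases Finset.mem_union.1 hx with hx | hx
    · rw [hgR x hx]
      exact hf x hx
    · rw [hgU x hx]
      exact e.mem_list x hx
  · intro c
    rw [hdiff]
    split_ifs
    · exact hWU c
    · exact Finset.empty_subset _
  · intro c x hx
    split_ifs at hx
    · exact hWc c x hx
    · simp at hx
  · intro c x hx hxc y hy hxy hyc
    rw [hdiff] at hy
    rcases Finset.mem_union.1 hx with hxR | hx
    · rw [hgR x hxR] at hxc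
      subst hxc
      rw [if_pos (hcross x hxR y hy hxy), hmemW]
      exact .inl ⟨hadj x hxR y hy hxy, by rw [← hgU y hy, hyc]⟩
    · split_ifs at hx ⊢
      · exact hWclosed c x hx y hy hxy hyc
      · simp at hx
  · intro c
    rw [hdiff]
    split_ifs with hne
    · by_cases hc : c ∈ S.image f'
      · obtain ⟨p, hp⟩ := hne
        rw [mem_crossingPairs] at hp
        have hcO : c ∈ S.image f' ∩ R.image f :=
          Finset.mem_inter.2 ⟨hc, Finset.mem_image.2 ⟨p.1, hp.1.1, hp.2.1⟩⟩
        have h1 := hO c hcO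
        have h2 := hWcard c
        rw [hρ'eq c (.inl hcO), Nat.sub_add_cancel (Nat.pos_of_ne_zero h1.2.1)] at h2
        exact h2.trans (Nat.le_mul_of_pos_right _
          (Finset.card_pos.2 ⟨p, mem_crossingPairs.2 hp⟩))
      · rw [hempty c hc]
        exact Nat.zero_le _
    · exact Nat.zero_le _
  · intro a ha
    rw [hdiff] at ha ⊢
    have hW' : a ∈ W (g a) → (a ∈ if (crossingPairs G f (g a) R U).Nonempty then W (g a) else ∅) ∨
        ∃ P ⊆ U, a ∈ P ∧ P.card ≤ rankBound k D (k + 1) ∧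
          ∀ x ∈ P, ∀ y ∈ R ∪ U, G.Adj x y → g y = g x → y ∈ P := by
      intro haW
      split_ifs with hne
      · exact .inl haW
      · refine .inr ⟨W (g a), hWU _, haW, ?_, fun x hx y hy hxy hyx => ?_⟩
        · by_cases hc : g a ∈ S.image f'
          · exact (hWcard _).trans (rankBound_mono k D (Nat.succ_le_succ (hρ'k _ hc).le))
          · rw [hempty _ hc]
            exact Nat.zero_le _
        · rw [hWc _ x hx] at hyx
          rcases Finset.mem_union.1 hy with hy | hy
          · rw [hgR y hy] at hyx
            exact absurd (hyx ▸ hcross y hy x (hWU _ hx) hxy.symm) hne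
          · exact hWclosed _ x hx y hy hxy hyx
    by_cases haS : a ∈ S
    · exact hW' ((hmemW _ _).2 (.inl ⟨haS, (hgU a ha).symm⟩))
    · rcases e.cover a (Finset.mem_sdiff.2 ⟨ha, haS⟩) with h | ⟨P, hP, haP, hPN, hPc⟩
      · exact hW' ((hmemW _ _).2 (.inr (by rwa [hgU a ha])))
      · refine .inr ⟨P, hP.trans Finset.sdiff_subset, haP, hPN, fun x hx y hy hxy hyx => ?_⟩
        obtain ⟨hxU, hxS⟩ := Finset.mem_sdiff.1 (hP hx)
        rcases Finset.mem_union.1 hy with hy | hy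
        · exact absurd (hadj y hy x hxU hxy.symm) hxS
        · rw [hgU y hy, hgU x hxU] at hyx
          exact hPc x hx y hy hxy hyx

theorem HasSeparators.exists_isExtendable {V : Type*} [Fintype V] {G : SimpleGraph V}
    {L : V → Finset ℕ} {κ D k : ℕ} (hG : HasSeparators G κ) (hκ : 0 < κ)
    (hD : ∀ v, (Finset.univ.filter (G.Adj v)).card ≤ D) (hL : ∀ x, 2 ≤ (L x).card)
    (hk : 5 * κ * (1 + 5 * κ * D) ≤ k) (U S : Finset V) (hSU : S ⊆ U)
    (hS : S.card ≤ 5 * κ * (1 + D)) :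
    ∃ R, S ⊆ R ∧ R ⊆ U ∧ R.card ≤ 5 * κ * (1 + (S.card - 5 * κ)) ∧
      IsExtendable G L (rankBound k D) (rankBound k D (k + 1)) k R U := by
  induction hu : U.card using Nat.strong_induction_on generalizing U S with
  | _ u ihU =>
  induction hs : S.card using Nat.strong_induction_on generalizing U S with
  | _ s ihS =>
  subst hu hs
  by_cases hsmall : S.card ≤ 5 * κ
  · rcases U.eq_empty_or_nonempty with rfl | hU
    · exact ⟨∅, hSU, Finset.Subset.refl _, by simp,
        IsExtendable.refl G L _ _ k ∅⟩
    obtain ⟨S₀, hSS₀, hS₀U, hS₀, hS₀card⟩ :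
        ∃ S₀, S ⊆ S₀ ∧ S₀ ⊆ U ∧ S₀.Nonempty ∧ S₀.card ≤ 5 * κ := by
      rcases S.eq_empty_or_nonempty with rfl | hne
      · obtain ⟨u, hu⟩ := hU
        exact ⟨{u}, by simp, by simpa using hu, by simp, by rw [Finset.card_singleton]; omega⟩
      · exact ⟨S, Finset.Subset.refl _, hSU, hne, hsmall⟩
    have hS' : ((U \ S₀).filter fun y => ∃ x ∈ S₀, G.Adj x y).card ≤ 5 * κ * D := by
      have hsub : ((U \ S₀).filter fun y => ∃ x ∈ S₀, G.Adj x y) ⊆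
          S₀.biUnion fun x => Finset.univ.filter (G.Adj x) := by
        intro y hy
        simpa using (Finset.mem_filter.1 hy).2
      exact (Finset.card_le_card hsub).trans ((Finset.card_biUnion_le_card_mul _ _ _
        fun x _ => hD x).trans (Nat.mul_le_mul_right _ hS₀card))
    obtain ⟨R', hSR', hR'U, hR'card, hR'⟩ := ihU (U \ S₀).card
      (Finset.card_lt_card ⟨Finset.sdiff_subset, fun h => by
        obtain ⟨x, hx⟩ := hS₀
        exact (Finset.mem_sdiff.1 (h (hS₀U hx))).2 hx⟩) (U \ S₀) _ (Finset.filter_subset _ _)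
      (hS'.trans (Nat.mul_le_mul_left _ (Nat.le_add_left _ _))) rfl
    refine ⟨S₀, hSS₀, hS₀U, hS₀card.trans (Nat.le_mul_of_pos_right _ (by omega)), ?_⟩
    have := hR'.union_of_subset (R := S₀) hD hL hR'U ?_ Finset.disjoint_sdiff ?_
    · rwa [Finset.union_sdiff_of_subset hS₀U] at this
    · refine hR'card.trans ((Nat.mul_le_mul_left _ ?_).trans hk)
      omega
    · exact fun x hx y hy hxy => hSR' (Finset.mem_filter.2 ⟨hy, x, hx, hxy⟩)
  · obtain ⟨A, X, hX, hAX, hA, hq, hq'⟩ := hG S (2 * κ) (by omega)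
    have hS₁ : ((S ∩ A) ∪ (X ∩ U)).card ≤ 5 * κ := by
      have h1 := Finset.card_union_le (S ∩ A) (X ∩ U)
      have h2 := Finset.card_le_card (Finset.inter_subset_left (s₁ := X) (s₂ := U))
      omega
    have hS₂ : ((S \ (A ∪ X)) ∪ (X ∩ U)).card < S.card := by
      have h1 := Finset.card_union_le (S \ (A ∪ X)) (X ∩ U)
      have h2 := Finset.card_le_card (Finset.inter_subset_left (s₁ := X) (s₂ := U))
      have h3 := Finset.card_sdiff_add_card_inter S (A ∪ X)
      omega
    have key : ∀ U' S', U' ⊆ U → S' ⊆ U' → S'.card < S.card →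
        ∃ R, S' ⊆ R ∧ R ⊆ U' ∧ R.card ≤ 5 * κ * (1 + (S'.card - 5 * κ)) ∧
          IsExtendable G L (rankBound k D) (rankBound k D (k + 1)) k R U' := by
      intro U' S' hU' hS' hlt
      have hcard := Finset.card_le_card hU'
      rcases hcard.lt_or_eq with h | h
      · exact ihU _ h U' S' hS' (hlt.le.trans hS) rfl
      · have := Finset.eq_of_subset_of_card_le hU' h.ge
        subst this
        exact ihS _ hlt U' S' hS' (hlt.le.trans hS) rfl rfl
    clear ihU ihS
    have hsub₁ : (S ∩ A) ∪ (X ∩ U) ⊆ U ∩ (A ∪ X) := by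
      clear key
      grind
    have hsub₂ : (S \ (A ∪ X)) ∪ (X ∩ U) ⊆ U \ A := by
      have := Finset.disjoint_left.1 hAX
      clear key
      grind
    obtain ⟨R₁, hSR₁, hRU₁, hR₁card, hR₁⟩ := key (U ∩ (A ∪ X)) ((S ∩ A) ∪ (X ∩ U))
      Finset.inter_subset_left hsub₁ (by omega)
    obtain ⟨R₂, hSR₂, hRU₂, hR₂card, hR₂⟩ := key (U \ A) ((S \ (A ∪ X)) ∪ (X ∩ U))
      Finset.sdiff_subset hsub₂ hS₂
    clear key
    have hX₁ : ∀ x ∈ X, x ∈ U → x ∈ R₁ := fun x hx hxU => hSR₁ (by grind)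
    have hX₂ : ∀ x ∈ X, x ∈ U → x ∈ R₂ := fun x hx hxU => hSR₂ (by grind)
    have hU : (U ∩ (A ∪ X)) ∪ (U \ A) = U := by grind
    refine ⟨R₁ ∪ R₂, ?_, by grind, ?_, ?_⟩
    · intro x hx
      by_cases hxX : x ∈ X
      · exact Finset.mem_union_left _ (hX₁ x hxX (hSU hx))
      · by_cases hxA : x ∈ A
        · exact Finset.mem_union_left _ (hSR₁ (by grind))
        · exact Finset.mem_union_right _ (hSR₂ (by grind))
    · refine (Finset.card_union_le _ _).trans ((add_le_add hR₁card hR₂card).trans ?_)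
      rw [← mul_add]
      exact Nat.mul_le_mul_left _ (by omega)
    · have := hR₁.union hR₂ hRU₁ hRU₂ (by grind) (by grind) ?_ ?_
      · rwa [hU] at this
      · intro x hx y hy hxy
        have := hA x (by grind) y hxy
        grind
      · intro x hx y hy hxy
        have := hA y
        have := hxy.symm
        grind

/-- The number of vertices that a monochromatic component of the constructed coloring may have. -/
def clusterBound (k D : ℕ) : ℕ :=
  k + rankBound k D (k + 1) * (D * k) + rankBound k D (k + 1)

theorem HasSeparators.exists_listColoring {V : Type*} [Fintype V] {G : SimpleGraph V}
    {L : V → Finset ℕ} {κ D k : ℕ} (hG : HasSeparators G κ) (hκ : 0 < κ)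
    (hD : ∀ v, (Finset.univ.filter (G.Adj v)).card ≤ D) (hL : ∀ x, 2 ≤ (L x).card)
    (hk : 5 * κ * (1 + 5 * κ * D) ≤ k) :
    ∃ g : V → ℕ, (∀ x, g x ∈ L x) ∧ ∀ a, ∃ P : Finset V, a ∈ P ∧ P.card ≤ clusterBound k D ∧
      ∀ x ∈ P, ∀ y, G.Adj x y → g y = g x → y ∈ P := by
  obtain ⟨R, -, -, hRcard, hR⟩ := hG.exists_isExtendable hκ hD hL hk Finset.univ ∅ (by simp)
    (by simp)
  have hRk : R.card ≤ k := hRcard.trans ((Nat.mul_le_mul_left _ (by simp)).trans hk)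
  have hne : ∀ x, ∃ i, i ∈ L x := fun x =>
    Finset.card_pos.1 (lt_of_lt_of_le Nat.zero_lt_two (hL x))
  choose f hf using hne
  obtain ⟨ρ, -, hρ, hρk⟩ := exists_injOn_union_extend (k := k) (∅ : Finset ℕ) (fun _ => 0)
    (by simp) (by simp) (R.image f) (by
      rw [Finset.empty_union]
      exact Finset.card_image_le.trans hRk)
  rw [Finset.empty_union] at hρ hρk
  obtain ⟨g, Q, e⟩ := hR f ρ (fun x _ => hf x) hρ fun x hx =>
    hρk _ (Finset.mem_image_of_mem _ hx)
  refine ⟨g, fun x => e.mem_list x (Finset.mem_univ x), fun a => ?_⟩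
  have hQ : (Q (g a)).card ≤ rankBound k D (k + 1) * (D * k) := by
    by_cases hc : g a ∈ R.image f
    · exact (e.card_le _).trans (Nat.mul_le_mul
        (rankBound_mono k D ((hρk _ hc).le.trans (Nat.le_succ k)))
        ((card_crossingPairs_le hD ..).trans (Nat.mul_le_mul_left _ hRk)))
    · have : crossingPairs G f (g a) R (Finset.univ \ R) = ∅ := by
        rw [Finset.eq_empty_iff_forall_notMem]
        intro p hp
        rw [mem_crossingPairs] at hp
        exact hc (Finset.mem_image.2 ⟨p.1, hp.1.1, hp.2.1⟩)
      have h := e.card_le (g a)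
      rw [this, Finset.card_empty, mul_zero] at h
      exact h.trans (Nat.zero_le _)
  have hRQ : a ∈ R ∨ a ∈ Q (g a) → ∃ P : Finset V, a ∈ P ∧ P.card ≤ clusterBound k D ∧
      ∀ x ∈ P, ∀ y, G.Adj x y → g y = g x → y ∈ P := by
    intro ha
    refine ⟨{x ∈ R | g x = g a} ∪ Q (g a), by grind, ?_, fun x hx y hxy hyx => ?_⟩
    · exact ((Finset.card_union_le _ _).trans (add_le_add ((Finset.card_le_card
        (Finset.filter_subset _ _)).trans hRk) hQ)).trans (Nat.le_add_right _ _)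
    · have hxc : g x = g a := by
        rcases Finset.mem_union.1 hx with hx | hx
        · exact (Finset.mem_filter.1 hx).2
        · exact e.color_eq _ x hx
      by_cases hy : y ∈ R
      · exact Finset.mem_union_left _ (Finset.mem_filter.2 ⟨hy, hyx.trans hxc⟩)
      · exact Finset.mem_union_right _ (e.closed _ x (by grind) hxc y (by simpa using hy) hxy
          (hyx.trans hxc))
  by_cases ha : a ∈ R
  · exact hRQ (.inl ha)
  · rcases e.cover a (by simpa using ha) with h | ⟨P, -, haP, hP, hPc⟩
    · exact hRQ (.inr h)
    · exact ⟨P, haP, hP.trans (Nat.le_add_left _ _), fun x hx y => hPc x hx y (Finset.mem_univ y)⟩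

end Extension

section Square

open scoped Classical

/-- The square of a graph: distinct vertices at distance at most two are adjacent. -/
def squareGraph {V : Type*} (G : SimpleGraph V) : SimpleGraph V where
  Adj x y := x ≠ y ∧ (G.Adj x y ∨ ∃ z, G.Adj x z ∧ G.Adj z y)
  symm := ⟨fun _ _ ⟨hne, h⟩ => ⟨hne.symm, h.imp .symm fun ⟨z, h₁, h₂⟩ => ⟨z, h₂.symm, h₁.symm⟩⟩⟩
  loopless := ⟨fun _ h => h.1 rfl⟩

theorem MaxDegreeLE.card_filter_le {V : Type*} [Fintype V] {G : SimpleGraph V} {Δ : ℕ}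
    (hG : MaxDegreeLE G Δ) (v : V) : (Finset.univ.filter (G.Adj v)).card ≤ Δ := by
  refine le_trans (le_of_eq ?_) (hG v)
  rw [← Set.ncard_coe_finset]
  congr 1
  ext
  simp

theorem card_union_biUnion_neighbors_le {V : Type*} [Fintype V] {G : SimpleGraph V} {Δ : ℕ}
    (hG : MaxDegreeLE G Δ) (X : Finset V) :
    (X ∪ X.biUnion fun x => Finset.univ.filter (G.Adj x)).card ≤ X.card * (1 + Δ) := by
  rw [mul_add, mul_one]
  exact (Finset.card_union_le _ _).trans (Nat.add_le_add_left
    (Finset.card_biUnion_le_card_mul _ _ _ fun x _ => hG.card_filter_le x) _)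

theorem card_filter_squareGraph_adj_le {V : Type*} [Fintype V] {G : SimpleGraph V} {Δ : ℕ}
    (hG : MaxDegreeLE G Δ) (v : V) :
    (Finset.univ.filter ((squareGraph G).Adj v)).card ≤ Δ * (1 + Δ) := by
  refine le_trans (Finset.card_le_card ?_) ((card_union_biUnion_neighbors_le hG
    (Finset.univ.filter (G.Adj v))).trans (Nat.mul_le_mul_right _ (hG.card_filter_le v)))
  intro y hy
  simpa using (Finset.mem_filter.1 hy).2.2

theorem HasSeparators.squareGraph {V : Type*} [Fintype V] {G : SimpleGraph V} {κ Δ : ℕ}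
    (h : HasSeparators G κ) (hG : MaxDegreeLE G Δ) :
    HasSeparators (squareGraph G) (κ * (1 + Δ)) := by
  intro S q hq
  obtain ⟨A, X, hX, -, hA, hqA, hqA'⟩ := h S q hq
  obtain ⟨Y, hY⟩ : ∃ Y, Y = X ∪ X.biUnion fun x => Finset.univ.filter (G.Adj x) := ⟨_, rfl⟩
  have hXY : X ⊆ Y := hY ▸ Finset.subset_union_left
  have hadjY : ∀ x ∈ X, ∀ y, G.Adj x y → y ∈ Y := fun x hx y hxy => by
    rw [hY]
    exact Finset.mem_union_right _ (Finset.mem_biUnion.2 ⟨x, hx, by simpa using hxy⟩)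
  refine ⟨A \ Y, Y, ?_, Finset.sdiff_disjoint, ?_, ?_, ?_⟩
  · rw [hY]
    exact (card_union_biUnion_neighbors_le hG X).trans (Nat.mul_le_mul_right _ hX)
  · rintro a ha b ⟨-, hab⟩
    obtain ⟨haA, haY⟩ := Finset.mem_sdiff.1 ha
    rw [Finset.sdiff_union_self_eq_union]
    refine Finset.union_subset_union_right hXY ?_
    rcases hab with hab | ⟨z, haz, hzb⟩
    · exact hA a haA b hab
    · rcases Finset.mem_union.1 (hA a haA z haz) with hz | hz
      · exact hA z hz b hzb
      · exact absurd (hadjY z hz a haz.symm) haY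
  · rw [Finset.sdiff_union_self_eq_union]
    exact hqA.trans (Finset.card_le_card (Finset.inter_subset_inter_left
      (Finset.union_subset_union_right hXY)))
  · exact (Finset.card_le_card (Finset.inter_subset_inter_left Finset.sdiff_subset)).trans hqA'

theorem MonoReach.mem_of_closed {V : Type*} {G : SimpleGraph V} {c : V → ℕ} {a b : V}
    (h : MonoReach G Set.univ c a b) (P : V → Prop) (ha : P a)
    (hP : ∀ x y, P x → c x = c a → G.Adj x y → c y = c a → P y) : P b := by
  obtain ⟨w, hw⟩ := h
  suffices ∀ {x y : V} (w : G.Walk x y), (∀ v ∈ w.support, c v = c a) → P x → P y from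
    this w (fun v hv => (hw v hv).2) ha
  intro x y w
  induction w with
  | nil => exact fun _ h => h
  | cons hadj w ih =>
    intro hw hx
    simp only [Walk.support_cons, List.mem_cons, forall_eq_or_imp] at hw
    exact ih hw.2 (hP _ _ hx hw.1 hadj (hw.2 _ w.start_mem_support))

/-- Recoloring an independent set arbitrarily keeps the clustering bounded if the coloring has
bounded clustering in the square of the graph. -/
theorem hasClusteringLE_of_squareGraph {V : Type*} [Fintype V] {G : SimpleGraph V} {Δ N : ℕ}
    (hG : MaxDegreeLE G Δ) {I : Finset V} (hI : ∀ a ∈ I, ∀ b ∈ I, ¬ G.Adj a b) {g c : V → ℕ}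
    (hgc : ∀ x ∉ I, c x = g x)
    (hg : ∀ a, ∃ P : Finset V, a ∈ P ∧ P.card ≤ N ∧
      ∀ x ∈ P, ∀ y, (squareGraph G).Adj x y → g y = g x → y ∈ P) :
    HasClusteringLE G Set.univ c (N * (1 + Δ) + 1) := by
  have key : ∀ a p, p ∉ I → c p = c a → (a = p ∨ a ∈ I ∧ G.Adj p a) →
      {b | MonoReach G Set.univ c a b}.ncard ≤ N * (1 + Δ) + 1 := by
    intro a p hpI hpc hap
    obtain ⟨P, hpP, hPN, hP⟩ := hg p
    have hsub : {b | MonoReach G Set.univ c a b} ⊆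
        (P ∪ P.biUnion fun x => Finset.univ.filter (G.Adj x) : Finset V) := by
      intro b hb
      have := MonoReach.mem_of_closed hb
        (fun x => (x ∉ I ∧ x ∈ P) ∨ (x ∈ I ∧ ∃ y ∈ P, y ∉ I ∧ c y = c a ∧ G.Adj y x)) ?_ ?_
      · rcases this with ⟨-, h⟩ | ⟨-, y, hy, -, -, hyb⟩
        · simp [h]
        · simp only [Finset.coe_union, Finset.coe_biUnion]
          exact .inr (Set.mem_biUnion hy (by simpa using hyb))
      · rcases hap with rfl | ⟨haI, hpa⟩
        · exact .inl ⟨hpI, hpP⟩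
        · exact .inr ⟨haI, p, hpP, hpI, hpc, hpa⟩
      · rintro x y (⟨hxI, hxP⟩ | ⟨hxI, z, hzP, hzI, hzc, hzx⟩) hxc hxy hyc
        · by_cases hy : y ∈ I
          · exact .inr ⟨hy, x, hxP, hxI, hxc, hxy⟩
          · exact .inl ⟨hy, hP x hxP y ⟨hxy.ne, .inl hxy⟩
              (by rw [← hgc y hy, ← hgc x hxI, hyc, hxc])⟩
        · have hy : y ∉ I := fun hy => hI x hxI y hy hxy
          refine .inl ⟨hy, ?_⟩
          by_cases hzy : z = y
          · exact hzy ▸ hzP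
          · exact hP z hzP y ⟨hzy, .inr ⟨x, hzx, hxy⟩⟩
              (by rw [← hgc y hy, ← hgc z hzI, hyc, hzc])
    have h1 := Set.ncard_le_ncard hsub (Finset.finite_toSet _)
    rw [Set.ncard_coe_finset] at h1
    exact (h1.trans ((card_union_biUnion_neighbors_le hG P).trans
      (Nat.mul_le_mul_right _ hPN))).trans (Nat.le_succ _)
  intro a
  by_cases ha : a ∈ I
  · by_cases hp : ∃ p, G.Adj p a ∧ c p = c a
    · obtain ⟨p, hpa, hpc⟩ := hp
      exact key a p (fun hp => hI p hp a ha hpa) hpc (.inr ⟨ha, hpa⟩)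
    · have hsub : {b | MonoReach G Set.univ c a b} ⊆ {a} := fun b hb =>
        MonoReach.mem_of_closed hb (fun x => x = a) rfl fun x y hx _ hxy hyc =>
          absurd ⟨y, hx ▸ hxy.symm, hyc⟩ hp
      have h1 := Set.ncard_le_ncard hsub (Set.finite_singleton a)
      rw [Set.ncard_singleton] at h1
      exact h1.trans (Nat.le_add_left _ _)
  · exact key a a ha rfl (.inl rfl)

theorem pow_card_le_ncard {V : Type*} [Fintype V] {m : ℕ} {L : V → Finset ℕ}
    (hL : ∀ x, (L x).card = m) (I : Finset V) {g : V → ℕ} (hg : ∀ x, g x ∈ L x)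
    {p : (V → ℕ) → Prop} (hp : ∀ c : V → ℕ, (∀ x ∉ I, c x = g x) → p c) :
    m ^ I.card ≤ {c : V → ℕ | (∀ x, c x ∈ L x) ∧ p c}.ncard := by
  have hcard : (Fintype.piFinset fun x => if x ∈ I then L x else {g x}).card = m ^ I.card := by
    rw [Fintype.card_piFinset, ← Finset.prod_const, ← Finset.univ_inter I, ← Finset.prod_ite_mem,
      Finset.univ_inter]
    refine Finset.prod_congr rfl fun x _ => ?_
    split_ifs
    · exact hL x
    · exact Finset.card_singleton _
  rw [← hcard, ← Set.ncard_coe_finset]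
  refine Set.ncard_le_ncard (fun c hc => ?_)
    ((Fintype.piFinset L).finite_toSet.subset fun c hc => by simpa using hc.1)
  have hc' : ∀ x, c x ∈ if x ∈ I then L x else {g x} := by simpa using hc
  have hcI : ∀ x ∉ I, c x = g x := fun x hx => by simpa [hx] using hc' x
  refine ⟨fun x => ?_, hp c hcI⟩
  by_cases hx : x ∈ I
  · simpa [hx] using hc' x
  · rw [hcI x hx]
    exact hg x

end Square

/-- **Corollary.** For every nonnegative integer `w` and every positive integer `Δ`, there
exists a positive integer `N` such that for every integer `m ≥ 2`, every graph `G` with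
tree-width at most `w` and maximum degree at most `Δ`, and every `m`-list-assignment `L`
of `G`, there exist at least `m ^ (|V(G)|/(w+1))` different `L`-colorings of `G` with
clustering at most `N`. -/
theorem treewidth_exponentially_many_colorings_clustering (w Δ : ℕ) (hΔ : 0 < Δ) :
    ∃ N : ℕ, 0 < N ∧
      ∀ (m : ℕ), 2 ≤ m →
      ∀ (V : Type u) [Fintype V] (G : SimpleGraph V),
        TreewidthLE G w →
        MaxDegreeLE G Δ →
        ∀ L : V → Finset ℕ,
          (∀ x, (L x).Nonempty) →
          (∀ x, (L x).card = m) →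
          (m : ℝ) ^ ((Fintype.card V : ℝ) / ((w : ℝ) + 1)) ≤
            ({c : V → ℕ | (∀ x, c x ∈ L x) ∧ HasClusteringLE G Set.univ c N}.ncard : ℝ) := by
  obtain ⟨D, hD⟩ : ∃ D, D = Δ * (1 + Δ) := ⟨_, rfl⟩
  obtain ⟨κ, hκ⟩ : ∃ κ, κ = (w + 1) * (1 + Δ) := ⟨_, rfl⟩
  obtain ⟨k, hk⟩ : ∃ k, k = 5 * κ * (1 + 5 * κ * D) := ⟨_, rfl⟩
  refine ⟨clusterBound k D * (1 + Δ) + 1, Nat.succ_pos _, ?_⟩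
  intro m hm V _ G hw hG L _ hL
  obtain ⟨I, hI, hIcard⟩ := hw.exists_indep
  obtain ⟨g, hgL, hg⟩ := (hw.hasSeparators.squareGraph hG).exists_listColoring (L := L) (D := D)
    (k := k) (by positivity) (fun v => hD ▸ card_filter_squareGraph_adj_le hG v)
    (fun x => hm.trans (hL x).ge) (by rw [hk, hκ])
  have hcount := pow_card_le_ncard hL I hgL
    (p := fun c => HasClusteringLE G Set.univ c (clusterBound k D * (1 + Δ) + 1))
    fun c hc => hasClusteringLE_of_squareGraph hG hI hc hg
  calc (m : ℝ) ^ ((Fintype.card V : ℝ) / ((w : ℝ) + 1)) ≤ (m : ℝ) ^ (I.card : ℝ) := by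
        refine Real.rpow_le_rpow_of_exponent_le (by exact_mod_cast (by omega : 1 ≤ m)) ?_
        rw [div_le_iff₀' (by positivity)]
        exact_mod_cast hIcard
    _ = ((m ^ I.card : ℕ) : ℝ) := by rw [Real.rpow_natCast, Nat.cast_pow]
    _ ≤ _ := by exact_mod_cast hcount
end

section
/- For all positive integers w and Δ, there exists a positive integer N such that every graph G with layered tree-width at most w and maximum degree at most Δ has at least 2^{|V(G)|/(3w)} different 3-colorings with clustering at most N. -/
open SimpleGraph

universe u

/-- `G` has layered tree-width at most `w`: there are a tree-decomposition and a layering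
(encoded by the layer index function `ℓ`, every edge joining vertices in the same or
consecutive layers) such that every bag meets every layer in at most `w` vertices. -/
def LayeredTreewidthLE {V : Type*} (G : SimpleGraph V) (w : ℕ) : Prop :=
  ∃ (ι : Type) (_ : Fintype ι) (T : SimpleGraph ι) (X : ι → Set V) (ℓ : V → ℕ),
    IsTreeDecomp G T X ∧
    (∀ ⦃a b : V⦄, G.Adj a b → ℓ a ≤ ℓ b + 1 ∧ ℓ b ≤ ℓ a + 1) ∧
    ∀ (t : ι) (i : ℕ), (X t ∩ {v | ℓ v = i}).ncard ≤ w


namespace LayeredColoring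

/-! ### Reachability and restricted graphs -/

/-- The spanning subgraph of `G` keeping the edges with both ends in `A`. -/
def restrict {V : Type*} (G : SimpleGraph V) (A : Set V) : SimpleGraph V where
  Adj a b := G.Adj a b ∧ a ∈ A ∧ b ∈ A
  symm := ⟨fun _ _ h => ⟨h.1.symm, h.2.2, h.2.1⟩⟩
  loopless := ⟨fun _ h => h.1.ne rfl⟩

/-- The graph of monochromatic edges of `G` with both ends in `S`. -/
def mono {V α : Type*} (G : SimpleGraph V) (S : Set V) (c : V → α) : SimpleGraph V where
  Adj a b := G.Adj a b ∧ a ∈ S ∧ b ∈ S ∧ c a = c b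
  symm := ⟨fun _ _ h => ⟨h.1.symm, h.2.2.1, h.2.1, h.2.2.2.symm⟩⟩
  loopless := ⟨fun _ h => h.1.ne rfl⟩

/-- Every connected component of `G` has at most `d` vertices. -/
def ComponentsLE {V : Type*} (G : SimpleGraph V) (d : ℕ) : Prop :=
  ∀ a, {b | G.Reachable a b}.ncard ≤ d

theorem mem_of_reachable {V : Type*} {G : SimpleGraph V} {a b : V} (h : G.Reachable a b)
    {Q : Set V} (ha : a ∈ Q) (hQ : ∀ x y, G.Adj x y → x ∈ Q → y ∈ Q) : b ∈ Q := by
  obtain ⟨p⟩ := h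
  induction p with
  | nil => exact ha
  | cons hadj _ ih => exact ih (hQ _ _ hadj ha)

theorem reachable_of_forall_adj {V : Type*} {G H : SimpleGraph V} {a b : V}
    (h : G.Reachable a b) (hGH : ∀ x y, G.Adj x y → H.Reachable x y) : H.Reachable a b :=
  mem_of_reachable (Q := {y | H.Reachable a y}) h .rfl fun x y hxy hx => hx.trans (hGH x y hxy)

theorem ComponentsLE.of_forall_reachable {V : Type*} [Finite V] {G H : SimpleGraph V} {d : ℕ}
    (hH : ComponentsLE H d) (hGH : ∀ x y, G.Adj x y → H.Reachable x y) : ComponentsLE G d :=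
  fun a => (Set.ncard_le_ncard (fun _ hb => reachable_of_forall_adj hb hGH)
    (Set.toFinite _)).trans (hH a)

theorem mem_of_restrict_reachable {V : Type*} {G : SimpleGraph V} {A : Set V} {a b : V}
    (h : (restrict G A).Reachable a b) (ha : a ∈ A) : b ∈ A :=
  mem_of_reachable h ha fun _ _ hxy _ => hxy.2.2

theorem restrict_reachable_mono {V : Type*} {G : SimpleGraph V} {A B : Set V} {a b : V}
    (h : (restrict G A).Reachable a b) (hAB : A ⊆ B) : (restrict G B).Reachable a b :=
  h.mono fun _ _ (hxy : (restrict G A).Adj _ _) => ⟨hxy.1, hAB hxy.2.1, hAB hxy.2.2⟩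

theorem restrict_reachable_of_induce {V : Type*} {G : SimpleGraph V} {A : Set V} {a b : A}
    (h : (G.induce A).Reachable a b) : (restrict G A).Reachable a b := by
  obtain ⟨p⟩ := h
  induction p with
  | nil => exact .rfl
  | @cons u v _ hadj _ ih =>
    exact (SimpleGraph.Adj.reachable (show (restrict G A).Adj u v from ⟨hadj, u.2, v.2⟩)).trans ih

/-- A bound on the number of vertices related to some vertex of a set. -/
theorem ncard_exists_le {α β : Type*} [Finite β] (A : Set α) (r : α → β → Prop) (m : ℕ)
    (h : ∀ a ∈ A, {b | r a b}.ncard ≤ m) (hA : A.Finite := by toFinite_tac) :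
    {b | ∃ a ∈ A, r a b}.ncard ≤ A.ncard * m := by
  classical
  have := Fintype.ofFinite β
  have key := Finset.card_biUnion_le_card_mul hA.toFinset (fun a => {b | r a b}.toFinset) m
    (fun a ha => by
      rw [← Set.ncard_eq_toFinset_card']
      exact h a (by simpa using ha))
  rw [Set.ncard_eq_toFinset_card A hA, Set.ncard_eq_toFinset_card']
  refine le_trans (Finset.card_le_card fun b hb => ?_) key
  simpa using hb

/-! ### Balanced separators -/

/-- Outside of `P`, every component of `G - P` contains at most half of `B`, up to rounding. -/
def Separates {V : Type*} (G : SimpleGraph V) (P B : Set V) : Prop :=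
  ∀ v ∉ P, 2 * {u ∈ B | (restrict G Pᶜ).Reachable v u}.ncard ≤ B.ncard + 1

theorem Separates.transfer {V : Type*} [Finite V] {G H : SimpleGraph V} {P P' B : Set V}
    (h : Separates G P B)
    (hH : ∀ u v, H.Adj u v → u ∉ P' → v ∉ P' → u ∉ P ∧ (restrict G Pᶜ).Reachable u v) :
    Separates H P' B := by
  intro v hv
  by_cases hw : ∃ w, (restrict H P'ᶜ).Adj v w
  · obtain ⟨w, hw⟩ := hw
    refine le_trans ?_ (h v (hH v w hw.1 hw.2.1 hw.2.2).1)
    refine Nat.mul_le_mul_left _ (Set.ncard_le_ncard (fun u hu => ⟨hu.1, ?_⟩) (Set.toFinite _))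
    exact reachable_of_forall_adj hu.2 fun x y hxy => (hH x y hxy.1 hxy.2.1 hxy.2.2).2
  · push Not at hw
    have hsub : {u ∈ B | (restrict H P'ᶜ).Reachable v u} ⊆ {v} := by
      rintro u ⟨-, hu⟩
      refine mem_of_reachable hu rfl fun x y hxy hx => ?_
      rw [Set.mem_singleton_iff] at hx
      exact absurd (hx ▸ hxy) (hw y)
    have h1 := Set.ncard_le_ncard hsub (Set.toFinite _)
    have h2 := Set.ncard_le_ncard
      (show {u ∈ B | (restrict H P'ᶜ).Reachable v u} ⊆ B from fun u hu => hu.1) (Set.toFinite _)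
    rw [Set.ncard_singleton] at h1
    omega

theorem exists_bag_separates {V ι : Type*} [Finite V] [Fintype ι] {G : SimpleGraph V}
    {T : SimpleGraph ι} {X : ι → Set V} (h : IsTreeDecomp G T X) (B : Set V) :
    ∃ t, Separates G (X t) B := by
  classical
  obtain ⟨hT, hcov, hedge, hconn⟩ := h
  by_contra! hcon
  simp only [Separates, not_forall, not_le] at hcon
  choose v hv hlarge using hcon
  -- the part of the tree touched by the large component avoiding the bag of `t`
  let D : ι → Set V := fun t => {u | (restrict G (X t)ᶜ).Reachable (v t) u}
  have hD : ∀ t, ∀ u ∈ D t, u ∉ X t := fun t u hu => mem_of_restrict_reachable hu (hv t)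
  have hsub : ∀ t u s s', u ∉ X t → u ∈ X s → u ∈ X s' →
      (restrict T {t}ᶜ).Reachable s s' := by
    intro t u s s' hu hs hs'
    refine restrict_reachable_mono
      (restrict_reachable_of_induce ((hconn u).preconnected ⟨s, hs⟩ ⟨s', hs'⟩)) ?_
    rintro x hx rfl
    exact hu hx
  have hside : ∀ t, ∃ f, T.Adj t f ∧ ∀ u ∈ D t, ∀ s, u ∈ X s →
      (restrict T {t}ᶜ).Reachable f s := by
    intro t
    obtain ⟨s₀, hs₀⟩ := hcov (v t)
    have hne : t ≠ s₀ := by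
      rintro rfl
      exact hv t hs₀
    obtain ⟨p, hp, -⟩ := hT.existsUnique_path t s₀
    cases p with
    | nil => exact absurd rfl hne
    | @cons _ f _ hadj q =>
      refine ⟨f, hadj, fun u hu => ?_⟩
      rw [Walk.cons_isPath_iff] at hp
      have hq : (restrict T {t}ᶜ).Reachable f s₀ := by
        refine restrict_reachable_mono
          (restrict_reachable_of_induce (q.induce {x | x ∈ q.support} fun x hx => hx).reachable) ?_
        rintro x hx rfl
        exact hp.2 hx
      refine mem_of_reachable (Q := {u | u ∉ X t ∧ ∀ s, u ∈ X s →
        (restrict T {t}ᶜ).Reachable f s}) hu ⟨hv t, fun s hs => hq.trans ?_⟩ ?_ |>.2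
      · exact hsub t _ _ _ (hv t) hs₀ hs
      · rintro x y ⟨hxy, hx, hy⟩ ⟨-, ih⟩
        obtain ⟨s', hxs, hys⟩ := hedge hxy
        exact ⟨hy, fun s hs => (ih s' hxs).trans (hsub t y _ _ hy hys hs)⟩
  choose f hf hfreach using hside
  -- two tree nodes point at each other
  obtain ⟨t, t', htt, he⟩ : ∃ t t', t ≠ t' ∧ s(t, f t) = s(t', f t') := by
    have hcard := hT.card_edgeFinset
    obtain ⟨x, -, y, -, hxy, h⟩ := Finset.exists_ne_map_eq_of_card_lt_of_maps_to
      (s := Finset.univ) (t := T.edgeFinset) (f := fun t => s(t, f t))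
      (by rw [Finset.card_univ]; omega) (fun t _ => by simpa using hf t)
    exact ⟨x, y, hxy, h⟩
  have h1 : f t = t' ∧ f t' = t := by
    rw [Sym2.eq_iff] at he
    rcases he with ⟨h, -⟩ | ⟨h1, h2⟩
    · exact absurd h htt
    · exact ⟨h2, h1.symm⟩
  obtain ⟨u, hu, hu'⟩ : ∃ u, u ∈ D t ∧ u ∈ D t' := by
    by_contra! hdis
    have h2 := hlarge t
    have h3 := hlarge t'
    have hd : Disjoint {u ∈ B | (restrict G (X t)ᶜ).Reachable (v t) u}
        {u ∈ B | (restrict G (X t')ᶜ).Reachable (v t') u} := by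
      rw [Set.disjoint_left]
      exact fun u hu hu' => hdis u hu.2 hu'.2
    have h4 := Set.ncard_union_eq hd (Set.toFinite _) (Set.toFinite _)
    have h5 : ({u ∈ B | (restrict G (X t)ᶜ).Reachable (v t) u} ∪
        {u ∈ B | (restrict G (X t')ᶜ).Reachable (v t') u}).ncard ≤ B.ncard :=
      Set.ncard_le_ncard (by rintro x (hx | hx) <;> exact hx.1) (Set.toFinite _)
    omega
  obtain ⟨s, hs⟩ := hcov u
  have r1 := hfreach t u hu s hs
  have r2 := hfreach t' u hu' s hs
  rw [h1.1] at r1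
  rw [h1.2] at r2
  have hbr := (isAcyclic_iff_forall_adj_isBridge.1 hT.isAcyclic) (h1.1 ▸ hf t)
  rw [isBridge_iff] at hbr
  refine hbr ((r2.mono ?_).trans (r1.mono ?_).symm)
  · rintro x y ⟨hxy, hx, hy⟩
    simp_all
  · rintro x y ⟨hxy, hx, hy⟩
    simp_all

/-- `G` has balanced separators of size at most `k`. -/
def HasSeparators {V : Type*} (G : SimpleGraph V) (k : ℕ) : Prop :=
  ∀ B : Set V, ∃ P : Set V, P.ncard ≤ k ∧ Separates G P B

theorem HasSeparators.anti {V : Type*} [Finite V] {G H : SimpleGraph V} {k : ℕ}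
    (h : HasSeparators G k) (hHG : H ≤ G) : HasSeparators H k := by
  intro B
  obtain ⟨P, hP, hsep⟩ := h B
  exact ⟨P, hP, hsep.transfer fun u v huv hu hv => ⟨hu, Adj.reachable ⟨hHG huv, hu, hv⟩⟩⟩

/-- The vertices of `R` adjacent to the component of `v` in `G - R`. -/
def boundary {V : Type*} (G : SimpleGraph V) (R : Set V) (v : V) : Set V :=
  {r ∈ R | ∃ u, (restrict G Rᶜ).Reachable v u ∧ G.Adj u r}

theorem boundary_eq_of_reachable {V : Type*} {G : SimpleGraph V} {R : Set V} {u v : V}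
    (h : (restrict G Rᶜ).Reachable u v) : boundary G R u = boundary G R v := by
  ext r
  constructor
  · rintro ⟨hr, x, hx, hxr⟩
    exact ⟨hr, x, h.symm.trans hx, hxr⟩
  · rintro ⟨hr, x, hx, hxr⟩
    exact ⟨hr, x, h.trans hx, hxr⟩

theorem exists_superset_boundary_le_pred {V : Type*} [Finite V] {G : SimpleGraph V} {k n : ℕ}
    (hG : HasSeparators G k) (hn : 2 * k + 2 ≤ n) {R : Set V}
    (hR : ∀ v ∉ R, (boundary G R v).ncard ≤ n + 1) :
    ∃ R', R ⊆ R' ∧ R'.ncard ≤ R.ncard + 2 ^ R.ncard * k ∧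
      ∀ v ∉ R', (boundary G R' v).ncard ≤ n := by
  choose Z hZk hZ using hG
  refine ⟨R ∪ {z | z ∉ R ∧ z ∈ Z (boundary G R z)}, Set.subset_union_left, ?_, ?_⟩
  · refine (Set.ncard_union_le _ _).trans (Nat.add_le_add_left ?_ _)
    have h := ncard_exists_le (𝒫 R) (fun B z => z ∈ Z B) k fun B _ => hZk B
    rw [Set.ncard_powerset] at h
    refine le_trans (Set.ncard_le_ncard ?_ (Set.toFinite _)) h
    exact fun z hz => ⟨boundary G R z, fun r hr => hr.1, hz.2⟩
  · intro v hv
    have hvR : v ∉ R := fun h => hv (Or.inl h)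
    have hvZ : v ∉ Z (boundary G R v) := fun h => hv (Or.inr ⟨hvR, h⟩)
    have hsep := hZ (boundary G R v) v hvZ
    have hcard := hR v hvR
    set R' := R ∪ {z | z ∉ R ∧ z ∈ Z (boundary G R z)} with hR'
    have hsub : boundary G R' v ⊆ Z (boundary G R v) ∪
        {u ∈ boundary G R v | (restrict G (Z (boundary G R v))ᶜ).Reachable v u} := by
      rintro r ⟨hr, u, hu, hur⟩
      have huR' : u ∉ R' := mem_of_restrict_reachable hu hv
      have key : (restrict G Rᶜ).Reachable v u ∧
          (restrict G (Z (boundary G R v))ᶜ).Reachable v u := by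
        refine mem_of_reachable (Q := {u | (restrict G Rᶜ).Reachable v u ∧
          (restrict G (Z (boundary G R v))ᶜ).Reachable v u}) hu ⟨.rfl, .rfl⟩ ?_
        rintro x y ⟨hxy, hx, hy⟩ ⟨h1, h2⟩
        have hxR : x ∉ R := fun h => hx (Or.inl h)
        have hyR : y ∉ R := fun h => hy (Or.inl h)
        have h1' : (restrict G Rᶜ).Reachable v y := h1.trans (Adj.reachable ⟨hxy, hxR, hyR⟩)
        refine ⟨h1', h2.trans (Adj.reachable ⟨hxy, ?_, ?_⟩)⟩
        · rw [boundary_eq_of_reachable h1]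
          exact fun h => hx (Or.inr ⟨hxR, h⟩)
        · rw [boundary_eq_of_reachable h1']
          exact fun h => hy (Or.inr ⟨hyR, h⟩)
      have huR : u ∉ R := fun h => huR' (Or.inl h)
      by_cases hrZ : r ∈ Z (boundary G R v)
      · exact Or.inl hrZ
      · rcases hr with hr | ⟨hr, hr'⟩
        · refine Or.inr ⟨⟨hr, u, key.1, hur⟩, key.2.trans (Adj.reachable ⟨hur, ?_, hrZ⟩)⟩
          rw [boundary_eq_of_reachable key.1]
          exact fun h => huR' (Or.inr ⟨huR, h⟩)
        · have : (restrict G Rᶜ).Reachable v r := key.1.trans (Adj.reachable ⟨hur, huR, hr⟩)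
          rw [← boundary_eq_of_reachable this] at hr'
          exact absurd hr' hrZ
    have h1 := Set.ncard_le_ncard hsub (Set.toFinite _)
    have h2 := h1.trans (Set.ncard_union_le _ _)
    have h3 := hZk (boundary G R v)
    omega

theorem exists_superset_boundary_le (k n m : ℕ) :
    ∃ g : ℕ, ∀ (V : Type u) [Finite V] (G : SimpleGraph V), HasSeparators G k →
      ∀ R : Set V, R.ncard ≤ m → (∀ v ∉ R, (boundary G R v).ncard ≤ n) →
        ∃ R', R ⊆ R' ∧ R'.ncard ≤ g ∧ ∀ v ∉ R', (boundary G R' v).ncard ≤ 2 * k + 2 := by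
  induction n generalizing m with
  | zero => exact ⟨m, fun V _ G _ R hm hR => ⟨R, subset_rfl, hm, fun v hv =>
      (hR v hv).trans (Nat.zero_le _)⟩⟩
  | succ n ih =>
    by_cases hn : 2 * k + 2 ≤ n
    · obtain ⟨g, hg⟩ := ih (m + 2 ^ m * k)
      refine ⟨g, fun V _ G hG R hm hR => ?_⟩
      obtain ⟨R₁, hRR₁, hcard, hR₁⟩ := exists_superset_boundary_le_pred hG hn hR
      have hpow : 2 ^ R.ncard * k ≤ 2 ^ m * k :=
        Nat.mul_le_mul_right _ (Nat.pow_le_pow_right two_pos hm)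
      obtain ⟨R', h, h'⟩ := hg V G hG R₁ (by omega) hR₁
      exact ⟨R', hRR₁.trans h, h'⟩
    · exact ⟨m, fun V _ G _ R hm hR => ⟨R, subset_rfl, hm, fun v hv =>
        (hR v hv).trans (by omega)⟩⟩

/-! ### Two-coloring graphs with balanced separators and bounded degree -/

theorem exists_two_coloring_extending (k Δ : ℕ) :
    ∃ d : ℕ, ∀ (V : Type u) [Finite V] (G : SimpleGraph V), HasSeparators G k →
      MaxDegreeLE G Δ → ∀ (C S : Set V) (b : Bool), S.ncard ≤ (2 * k + 2) * Δ →
        ∃ f : V → Bool, (∀ v ∈ S, f v = b) ∧ ComponentsLE (mono G C f) d := by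
  classical
  obtain ⟨g, hg⟩ := exists_superset_boundary_le.{u} k ((2 * k + 2) * Δ + 1) ((2 * k + 2) * Δ + 1)
  refine ⟨g + 1, fun V _ G hG hΔ C => ?_⟩
  induction hc : C.ncard using Nat.strong_induction_on generalizing C with
  | _ c ih =>
  intro S b hS
  subst hc
  rcases C.eq_empty_or_nonempty with rfl | ⟨x, hx⟩
  · refine ⟨fun _ => b, fun _ _ => rfl, fun a => ?_⟩
    have hsub : {y | (mono G ∅ fun _ => b).Reachable a y} ⊆ {a} := fun y hy =>
      mem_of_reachable (Q := {a}) hy rfl fun _ _ h _ => absurd h.2.1 (Set.notMem_empty _)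
    have := Set.ncard_le_ncard hsub (Set.toFinite _)
    rw [Set.ncard_singleton] at this
    omega
  · have hR₀ : (insert x S).ncard ≤ (2 * k + 2) * Δ + 1 :=
      (Set.ncard_insert_le _ _).trans (Nat.add_le_add_right hS 1)
    obtain ⟨R, hSR, hRg, hR⟩ := hg V (restrict G C) (hG.anti fun _ _ h => h.1) (insert x S) hR₀
      fun v _ => (Set.ncard_le_ncard (fun r hr => hr.1) (Set.toFinite _)).trans hR₀
    let H := restrict (restrict G C) Rᶜ
    have hKex : ∀ K : H.ConnectedComponent, ∃ f : V → Bool,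
        (∀ v, H.connectedComponentMk v = K → v ∈ C → v ∉ R →
          (∃ r ∈ R, r ∈ C ∧ G.Adj v r) → f v = !b) ∧
        ComponentsLE (mono G {v | H.connectedComponentMk v = K ∧ v ∈ C ∧ v ∉ R} f) (g + 1) := by
      intro K
      have hlt : {v | H.connectedComponentMk v = K ∧ v ∈ C ∧ v ∉ R}.ncard < C.ncard :=
        Set.ncard_lt_ncard ⟨fun v hv => hv.2.1,
          fun h => (h hx).2.2 (hSR (Set.mem_insert _ _))⟩ (Set.toFinite _)
      obtain ⟨f, hf, hf'⟩ := ih _ hlt _ rfl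
        {v | H.connectedComponentMk v = K ∧ v ∈ C ∧ v ∉ R ∧ ∃ r ∈ R, r ∈ C ∧ G.Adj v r} (!b) (by
          rcases Set.eq_empty_or_nonempty {v | H.connectedComponentMk v = K ∧ v ∈ C ∧ v ∉ R ∧
            ∃ r ∈ R, r ∈ C ∧ G.Adj v r} with h | ⟨v, hvK, hvC, hvR, -⟩
          · rw [h, Set.ncard_empty]
            exact Nat.zero_le _
          · have h := ncard_exists_le (boundary (restrict G C) R v) G.Adj Δ fun r _ => hΔ r
            refine le_trans (Set.ncard_le_ncard ?_ (Set.toFinite _))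
              (h.trans (Nat.mul_le_mul_right _ (hR v hvR)))
            rintro u ⟨huK, huC, huR, r, hr, hrC, hur⟩
            exact ⟨r, ⟨hr, u, ConnectedComponent.exact (hvK.trans huK.symm), hur, huC, hrC⟩,
              hur.symm⟩)
      exact ⟨f, fun v h1 h2 h3 h4 => hf v ⟨h1, h2, h3, h4⟩, hf'⟩
    choose F hF hFd using hKex
    let f : V → Bool := fun v => if v ∈ R then b else F (H.connectedComponentMk v) v
    have hfR : ∀ v ∈ R, f v = b := fun v hv => if_pos hv
    have hfn : ∀ v ∉ R, f v = F (H.connectedComponentMk v) v := fun v hv => if_neg hv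
    have hcross : ∀ u v, (mono G C f).Adj u v → u ∈ R → v ∈ R := by
      rintro u v ⟨huv, huC, hvC, hc⟩ hu
      by_contra hv
      rw [hfR u hu, hfn v hv, hF _ v rfl hvC hv ⟨u, hu, huC, huv.symm⟩] at hc
      cases b <;> simp at hc
    refine ⟨f, fun v hv => hfR v (hSR (Set.mem_insert_of_mem _ hv)), fun a => ?_⟩
    by_cases ha : a ∈ R
    · exact (Set.ncard_le_ncard (fun y hy => mem_of_reachable hy ha hcross)
        (Set.toFinite _)).trans (hRg.trans (Nat.le_succ _))
    · refine (Set.ncard_le_ncard (fun y hy => ?_) (Set.toFinite _)).trans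
        (hFd (H.connectedComponentMk a) a)
      refine (mem_of_reachable (Q := {y | y ∉ R ∧
        H.connectedComponentMk y = H.connectedComponentMk a ∧
        (mono G {v | H.connectedComponentMk v = H.connectedComponentMk a ∧ v ∈ C ∧ v ∉ R}
          (F (H.connectedComponentMk a))).Reachable a y}) hy ⟨ha, rfl, .rfl⟩ ?_).2.2
      rintro u v huv ⟨hu, huK, hau⟩
      have hv : v ∉ R := fun h => hu (hcross v u huv.symm h)
      obtain ⟨huv, huC, hvC, hc⟩ := huv
      have hvu : H.connectedComponentMk v = H.connectedComponentMk u :=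
        ConnectedComponent.sound (Adj.reachable ⟨⟨huv.symm, hvC, huC⟩, hv, hu⟩)
      have hvK := hvu.trans huK
      rw [hfn u hu, hfn v hv, huK, hvK] at hc
      exact ⟨hv, hvK, hau.trans (Adj.reachable ⟨huv, ⟨huK, huC, hu⟩, ⟨hvK, hvC, hv⟩, hc⟩)⟩

/-! ### Layered graphs and contractions -/

/-- Adjacent vertices lie in the same or in consecutive layers. -/
def IsLayering {V : Type*} (G : SimpleGraph V) (ℓ : V → ℕ) : Prop :=
  ∀ ⦃a b : V⦄, G.Adj a b → ℓ a ≤ ℓ b + 1 ∧ ℓ b ≤ ℓ a + 1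

/-- `G` has balanced separators meeting every layer in at most `w` vertices. -/
def HasLayeredSeparators {V : Type*} (G : SimpleGraph V) (ℓ : V → ℕ) (w : ℕ) : Prop :=
  ∀ B : Set V, ∃ P : Set V, (∀ i, (P ∩ {v | ℓ v = i}).ncard ≤ w) ∧ Separates G P B

/-- The edges of `G` inside the layers of `ℓ`. -/
def layerGraph {V : Type*} (G : SimpleGraph V) (ℓ : V → ℕ) : SimpleGraph V where
  Adj a b := G.Adj a b ∧ ℓ a = ℓ b
  symm := ⟨fun _ _ h => ⟨h.1.symm, h.2.symm⟩⟩
  loopless := ⟨fun _ h => h.1.ne rfl⟩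

theorem exists_layerwise_two_coloring (k Δ : ℕ) :
    ∃ d : ℕ, ∀ (V : Type u) [Finite V] (G : SimpleGraph V) (ℓ : V → ℕ),
      HasLayeredSeparators G ℓ k → MaxDegreeLE G Δ →
        ∃ f : V → Bool, ComponentsLE (mono (layerGraph G ℓ) Set.univ f) d := by
  obtain ⟨d, hd⟩ := exists_two_coloring_extending.{u} k Δ
  refine ⟨d, fun V _ G ℓ hG hΔ => ?_⟩
  have hlayer : ∀ j, ∃ f : V → Bool,
      ComponentsLE (mono (restrict G {v | ℓ v = j}) Set.univ f) d := by
    intro j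
    have hsep : HasSeparators (restrict G {v | ℓ v = j}) k := by
      intro B
      obtain ⟨P, hP, hsep⟩ := hG B
      refine ⟨_, hP j, hsep.transfer ?_⟩
      rintro u v ⟨huv, hu, hv⟩ huP hvP
      have hu' : u ∉ P := fun h => huP ⟨h, hu⟩
      exact ⟨hu', SimpleGraph.Adj.reachable ⟨huv, hu', fun h => hvP ⟨h, hv⟩⟩⟩
    obtain ⟨f, -, hf⟩ := hd V _ hsep
      (fun v => (Set.ncard_le_ncard (fun u hu => hu.1) (Set.toFinite _)).trans (hΔ v))
      Set.univ ∅ true (by simp)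
    exact ⟨f, hf⟩
  choose f hf using hlayer
  refine ⟨fun v => f (ℓ v) v, fun a => ?_⟩
  refine (Set.ncard_le_ncard (fun y hy => ?_) (Set.toFinite _)).trans (hf (ℓ a) a)
  refine (mem_of_reachable (Q := {y | ℓ y = ℓ a ∧
    (mono (restrict G {v | ℓ v = ℓ a}) Set.univ (f (ℓ a))).Reachable a y}) hy ⟨rfl, .rfl⟩ ?_).2
  rintro x y ⟨⟨hxy, hl⟩, -, -, hc⟩ ⟨hx, hax⟩
  have hy : ℓ y = ℓ a := hl.symm.trans hx
  simp only [hx, hy] at hc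
  exact ⟨hy, hax.trans (SimpleGraph.Adj.reachable ⟨⟨hxy, hx, hy⟩, trivial, trivial, hc⟩)⟩

/-- Vertices are adjacent if their closed `G`-neighborhoods meet a common component of `K`. -/
def contract {V : Type*} (G K : SimpleGraph V) : SimpleGraph V where
  Adj u v := u ≠ v ∧ ∃ p q, (p = u ∨ G.Adj u p) ∧ (q = v ∨ G.Adj v q) ∧ K.Reachable p q
  symm := ⟨fun _ _ ⟨h, p, q, hp, hq, hpq⟩ => ⟨h.symm, q, p, hq, hp, hpq.symm⟩⟩
  loopless := ⟨fun _ h => h.1 rfl⟩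

theorem contract_adj_of_adj {V : Type*} {G K : SimpleGraph V} {u v : V} (h : G.Adj u v) :
    (contract G K).Adj u v :=
  ⟨h.ne, v, v, Or.inr h, Or.inl rfl, .rfl⟩

theorem ncard_closedNeighbors_le {V : Type*} [Finite V] {G : SimpleGraph V} {Δ : ℕ}
    (hΔ : MaxDegreeLE G Δ) (u : V) : {p | p = u ∨ G.Adj u p}.ncard ≤ Δ + 1 := by
  refine le_trans (Set.ncard_insert_le u (G.neighborSet u)) ?_
  exact Nat.add_le_add_right (hΔ u) 1

theorem closedNeighbor_comm {V : Type*} {G : SimpleGraph V} {u p : V} :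
    (p = u ∨ G.Adj u p) ↔ (u = p ∨ G.Adj p u) := by
  rw [eq_comm, G.adj_comm]

theorem maxDegreeLE_contract {V : Type*} [Finite V] {G K : SimpleGraph V} {Δ d : ℕ}
    (hΔ : MaxDegreeLE G Δ) (hK : ComponentsLE K d) :
    MaxDegreeLE (contract G K) ((Δ + 1) * d * (Δ + 1)) := by
  intro u
  have h1 := ncard_exists_le {p | p = u ∨ G.Adj u p} K.Reachable d fun p _ => hK p
  have h2 := ncard_exists_le {q | ∃ p ∈ {p | p = u ∨ G.Adj u p}, K.Reachable p q}
    (fun q v => v = q ∨ G.Adj q v) (Δ + 1) fun q _ => ncard_closedNeighbors_le hΔ q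
  refine le_trans (Set.ncard_le_ncard ?_ (Set.toFinite _)) (h2.trans (Nat.mul_le_mul_right _
    (h1.trans (Nat.mul_le_mul_right _ (ncard_closedNeighbors_le hΔ u)))))
  rintro v ⟨-, p, q, hp, hq, hpq⟩
  exact ⟨q, ⟨p, hp, hpq⟩, closedNeighbor_comm.1 hq⟩

theorem IsLayering.le_add_of_reachable {V : Type*} [Finite V] {G K : SimpleGraph V} {ℓ : V → ℕ}
    {d : ℕ} (hℓ : IsLayering G ℓ) (hKG : K ≤ G) (hK : ComponentsLE K d) {p q : V}
    (h : K.Reachable p q) : ℓ p ≤ ℓ q + d := by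
  classical
  obtain ⟨W, hW⟩ := h.exists_isPath
  have hlen : ∀ {a b : V} (W : K.Walk a b), ℓ a ≤ ℓ b + W.length := by
    intro a b W
    induction W with
    | nil => simp
    | cons hadj _ ih =>
      have := (hℓ (hKG hadj)).1
      rw [Walk.length_cons]
      omega
  have h1 : W.support.toFinset.card = W.length + 1 := by
    rw [List.toFinset_card_of_nodup hW.support_nodup, Walk.length_support]
  have h2 : (W.support.toFinset : Set V).ncard ≤ {b | K.Reachable p b}.ncard := by
    refine Set.ncard_le_ncard (fun x hx => ?_) (Set.toFinite _)
    exact (W.takeUntil x (by simpa using hx)).reachable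
  rw [Set.ncard_coe_finset] at h2
  have h3 := hlen W
  have h4 := hK p
  omega

theorem IsLayering.le_add_of_closedNeighbor {V : Type*} {G : SimpleGraph V} {ℓ : V → ℕ}
    (hℓ : IsLayering G ℓ) {u p : V} (h : p = u ∨ G.Adj u p) : ℓ u ≤ ℓ p + 1 ∧ ℓ p ≤ ℓ u + 1 := by
  rcases h with rfl | h
  · omega
  · exact hℓ h

theorem HasLayeredSeparators.contract {V : Type*} [Finite V] {G K : SimpleGraph V} {ℓ : V → ℕ}
    {w Δ d : ℕ} (hG : HasLayeredSeparators G ℓ w) (hℓ : IsLayering G ℓ) (hΔ : MaxDegreeLE G Δ)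
    (hKG : K ≤ G) (hK : ComponentsLE K d) :
    HasLayeredSeparators (contract G K) ℓ ((2 * d + 3) * w * d * (Δ + 1)) := by
  intro B
  obtain ⟨P, hP, hsep⟩ := hG B
  refine ⟨{u | ∃ p, (p = u ∨ G.Adj u p) ∧ ∃ q ∈ P, K.Reachable q p}, fun i => ?_,
    hsep.transfer ?_⟩
  · have h0 := ncard_exists_le (↑(Finset.Icc (i - (d + 1)) (i + d + 1)) : Set ℕ)
      (fun j v => v ∈ P ∧ ℓ v = j) w (fun j _ => hP j) (Finset.finite_toSet _)
    rw [Set.ncard_coe_finset, Nat.card_Icc] at h0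
    have h1 := ncard_exists_le _ K.Reachable d fun q (_ : q ∈ {v | ∃ j ∈
      (↑(Finset.Icc (i - (d + 1)) (i + d + 1)) : Set ℕ), v ∈ P ∧ ℓ v = j}) => hK q
    have h2 := ncard_exists_le _ (fun q v => v = q ∨ G.Adj q v) (Δ + 1)
      fun p (_ : p ∈ {p | ∃ q ∈ {v | ∃ j ∈ (↑(Finset.Icc (i - (d + 1)) (i + d + 1)) : Set ℕ),
        v ∈ P ∧ ℓ v = j}, K.Reachable q p}) => ncard_closedNeighbors_le hΔ p
    have h3 : (i + d + 1 + 1 - (i - (d + 1))) * w ≤ (2 * d + 3) * w :=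
      Nat.mul_le_mul_right _ (by omega)
    refine le_trans (Set.ncard_le_ncard ?_ (Set.toFinite _)) (h2.trans (Nat.mul_le_mul_right _
      (h1.trans (Nat.mul_le_mul_right _ (h0.trans h3)))))
    rintro u ⟨⟨p, hup, q, hq, hqp⟩, hu⟩
    refine ⟨p, ⟨q, ⟨ℓ q, ?_, hq, rfl⟩, hqp⟩, closedNeighbor_comm.1 hup⟩
    have h4 := hℓ.le_add_of_reachable hKG hK hqp
    have h5 := hℓ.le_add_of_reachable hKG hK hqp.symm
    have h6 := hℓ.le_add_of_closedNeighbor hup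
    have hu : ℓ u = i := hu
    rw [Finset.mem_coe, Finset.mem_Icc]
    omega
  · rintro u v ⟨-, p, q, hp, hq, hpq⟩ hu hv
    have hself : ∀ x, (¬∃ p, (p = x ∨ G.Adj x p) ∧ ∃ q ∈ P, K.Reachable q p) → x ∉ P :=
      fun x hx h => hx ⟨x, Or.inl rfl, x, h, .rfl⟩
    have hcomp : ∀ x, K.Reachable p x → x ∉ P := fun x hx h => hu ⟨p, hp, x, h, hx.symm⟩
    have hstep : ∀ x y, x ∉ P → y ∉ P → (y = x ∨ G.Adj x y) →
        (restrict G Pᶜ).Reachable x y := by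
      rintro x y hx hy (rfl | h)
      · exact .rfl
      · exact SimpleGraph.Adj.reachable ⟨h, hx, hy⟩
    have hmid : (restrict G Pᶜ).Reachable p q := by
      refine (mem_of_reachable (Q := {x | K.Reachable p x ∧ (restrict G Pᶜ).Reachable p x}) hpq
        ⟨.rfl, .rfl⟩ ?_).2
      rintro x y hxy ⟨h1, h2⟩
      have h3 := h1.trans hxy.reachable
      exact ⟨h3, h2.trans (SimpleGraph.Adj.reachable ⟨hKG hxy, hcomp x h1, hcomp y h3⟩)⟩
    refine ⟨hself u hu, (hstep u p (hself u hu) (hcomp p .rfl) hp).trans (hmid.trans ?_)⟩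
    exact (hstep v q (hself v hv) (hcomp q hpq) hq).symm

/-- Bounded components of the coloring outside `Y`, and of the coloring of `Y` in a graph `H`
recording connections through the outside, give bounded monochromatic components. -/
theorem componentsLE_mono_of_contract {V α : Type*} [Finite V] {G H : SimpleGraph V} {Y : Set V}
    {c : V → α} {Δ d₁ d₂ : ℕ} (hΔ : MaxDegreeLE G Δ) (hK : ComponentsLE (mono G Yᶜ c) d₁)
    (hH : ComponentsLE (mono H Y c) d₂)
    (hadj : ∀ u ∈ Y, ∀ v ∈ Y, u ≠ v → c u = c v → (G.Adj u v ∨ ∃ p q, p ∉ Y ∧ c p = c u ∧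
      G.Adj u p ∧ G.Adj v q ∧ (mono G Yᶜ c).Reachable p q) → H.Adj u v) :
    ComponentsLE (mono G Set.univ c) (d₁ + d₂ + d₂ * Δ * d₁) := by
  intro a
  by_cases hx : ∃ x ∈ Y, (mono G Set.univ c).Reachable a x
  · obtain ⟨x, hxY, hax⟩ := hx
    let A : Set V := {y | (mono H Y c).Reachable x y}
    have h1 := ncard_exists_le A G.Adj Δ fun y _ => hΔ y
    have h2 := ncard_exists_le {p | ∃ y ∈ A, G.Adj y p} (mono G Yᶜ c).Reachable d₁ fun y _ => hK y
    have h3 : A.ncard * Δ * d₁ ≤ d₂ * Δ * d₁ :=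
      Nat.mul_le_mul_right _ (Nat.mul_le_mul_right _ (hH x))
    have h4 : A.ncard ≤ d₂ := hH x
    have hsub : {b | (mono G Set.univ c).Reachable a b} ⊆
        A ∪ {b | ∃ p ∈ {p | ∃ y ∈ A, G.Adj y p}, (mono G Yᶜ c).Reachable p b} := by
      intro b hb
      have hb' : b ∈ {b | c b = c x ∧ ((b ∈ Y ∧ b ∈ A) ∨ (b ∉ Y ∧ ∃ y ∈ Y, c y = c x ∧ y ∈ A ∧
          ∃ p ∉ Y, c p = c x ∧ G.Adj y p ∧ (mono G Yᶜ c).Reachable p b))} := by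
        refine mem_of_reachable (hax.symm.trans hb) ⟨rfl, Or.inl ⟨hxY, .rfl⟩⟩ ?_
        rintro y z ⟨hyz, -, -, hc⟩ ⟨hcy, hy⟩
        have hcz : c z = c x := hc.symm.trans hcy
        refine ⟨hcz, ?_⟩
        by_cases hzY : z ∈ Y
        · refine Or.inl ⟨hzY, ?_⟩
          rcases hy with ⟨hyY, hyA⟩ | ⟨hyY, t, htY, hct, htA, p, hpY, hcp, htp, hpy⟩
          · exact Reachable.trans hyA (SimpleGraph.Adj.reachable
              ⟨hadj y hyY z hzY hyz.ne hc (Or.inl hyz), hyY, hzY, hc⟩)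
          · by_cases htz : t = z
            · exact htz ▸ htA
            · exact Reachable.trans htA (SimpleGraph.Adj.reachable
                ⟨hadj t htY z hzY htz (hct.trans hcz.symm)
                  (Or.inr ⟨p, y, hpY, hcp.trans hct.symm, htp, hyz.symm, hpy⟩),
                  htY, hzY, hct.trans hcz.symm⟩)
        · refine Or.inr ⟨hzY, ?_⟩
          rcases hy with ⟨hyY, hyA⟩ | ⟨hyY, t, htY, hct, htA, p, hpY, hcp, htp, hpy⟩
          · exact ⟨y, hyY, hcy, hyA, z, hzY, hcz, hyz, .rfl⟩
          · exact ⟨t, htY, hct, htA, p, hpY, hcp, htp,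
              hpy.trans (SimpleGraph.Adj.reachable ⟨hyz, hyY, hzY, hc⟩)⟩
      rcases hb'.2 with ⟨-, hb⟩ | ⟨-, y, -, -, hyA, p, -, -, hyp, hpb⟩
      · exact Or.inl hb
      · exact Or.inr ⟨p, ⟨y, hyA, hyp⟩, hpb⟩
    have h5 := (Set.ncard_le_ncard hsub (Set.toFinite _)).trans (Set.ncard_union_le _ _)
    have h6 := h2.trans ((Nat.mul_le_mul_right _ h1).trans h3)
    omega
  · push Not at hx
    refine le_trans (Set.ncard_le_ncard (fun b hb => ?_) (Set.toFinite _))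
      ((hK a).trans (by omega))
    refine (mem_of_reachable (Q := {b | (mono G Set.univ c).Reachable a b ∧
      (mono G Yᶜ c).Reachable a b}) hb ⟨.rfl, .rfl⟩ ?_).2
    rintro y z hyz ⟨h1, h2⟩
    have h3 := h1.trans hyz.reachable
    exact ⟨h3, h2.trans (SimpleGraph.Adj.reachable
      ⟨hyz.1, fun h => hx y h h1, fun h => hx z h h3, hyz.2.2.2⟩)⟩

/-! ### Three-colorings -/

theorem exists_three_coloring (w Δ : ℕ) :
    ∃ N : ℕ, ∀ (V : Type u) [Finite V] (G : SimpleGraph V) (ℓ : V → ℕ),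
      HasLayeredSeparators G ℓ w → IsLayering G ℓ → MaxDegreeLE G Δ →
        ∃ c : V → Fin 3, ComponentsLE (mono G Set.univ c) N := by
  obtain ⟨d₁, h₁⟩ := exists_layerwise_two_coloring.{u} w Δ
  obtain ⟨d₂, h₂⟩ := exists_layerwise_two_coloring.{u} ((2 * d₁ + 3) * w * d₁ * (Δ + 1))
    ((Δ + 1) * d₁ * (Δ + 1))
  refine ⟨d₁ + d₂ + d₂ * Δ * d₁, fun V _ G ℓ hG hℓ hΔ => ?_⟩
  -- odd layers use the colors 0 and 1
  obtain ⟨f, hf⟩ := h₁ V G ℓ hG hΔ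
  have hodd : ∀ u v, G.Adj u v → ℓ u % 2 = ℓ v % 2 → ℓ u = ℓ v := by
    intro u v huv h
    have := hℓ huv
    omega
  let K := mono G {v | ℓ v % 2 = 1} f
  have hKlayer : ∀ u v, K.Adj u v → ℓ u = ℓ v := fun u v h =>
    hodd u v h.1 (Eq.trans (b := 1) h.2.1 h.2.2.1.symm)
  have hK : ComponentsLE K d₁ := hf.of_forall_reachable fun u v h =>
    SimpleGraph.Adj.reachable ⟨⟨h.1, hKlayer u v h⟩, trivial, trivial, h.2.2.2⟩
  have hKG : K ≤ G := fun _ _ h => h.1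
  -- an even layer uses the color 2 and one of the colors 0 and 1, depending on its index modulo 4
  obtain ⟨g, hg⟩ := h₂ V (contract G K) ℓ (hG.contract hℓ hΔ hKG hK) (maxDegreeLE_contract hΔ hK)
  let c : V → Fin 3 := fun v =>
    if ℓ v % 2 = 1 then (if f v then 1 else 0)
    else if g v then 2 else if ℓ v % 4 = 0 then 0 else 1
  have hcodd : ∀ v, ℓ v % 2 = 1 → c v = if f v then 1 else 0 := fun v hv => if_pos hv
  have hceven : ∀ v, ℓ v % 2 = 0 → c v = if g v then 2 else if ℓ v % 4 = 0 then 0 else 1 :=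
    fun v hv => if_neg (by omega)
  have hnot : ∀ v, v ∈ {v | ℓ v % 2 = 0}ᶜ → ℓ v % 2 = 1 := by
    intro v hv
    have : ¬ ℓ v % 2 = 0 := hv
    omega
  have hcK : ∀ u v, (mono G {v | ℓ v % 2 = 0}ᶜ c).Adj u v → K.Adj u v := by
    rintro u v ⟨huv, hu, hv, hc⟩
    refine ⟨huv, hnot u hu, hnot v hv, ?_⟩
    rw [hcodd u (hnot u hu), hcodd v (hnot v hv)] at hc
    revert hc
    cases f u <;> cases f v <;> simp
  refine ⟨c, componentsLE_mono_of_contract (Y := {v | ℓ v % 2 = 0})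
    (H := layerGraph (contract G K) ℓ) hΔ
    (hK.of_forall_reachable fun u v h => (hcK u v h).reachable)
    (hg.of_forall_reachable fun u v h => SimpleGraph.Adj.reachable ⟨h.1, trivial, trivial, ?_⟩) ?_⟩
  · obtain ⟨⟨-, hl⟩, hu, hv, hc⟩ := h
    rw [hceven u hu, hceven v hv, hl] at hc
    revert hc
    by_cases h4 : ℓ v % 4 = 0 <;> cases g u <;> cases g v <;> simp [h4]
  · rintro u hu v hv huv hc (h | ⟨p, q, hp, hcp, hup, hvq, hpq⟩)
    · exact ⟨contract_adj_of_adj h, hodd u v h (Eq.trans (b := 0) hu hv.symm)⟩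
    · have hpqK := reachable_of_forall_adj hpq fun x y h => (hcK x y h).reachable
      refine ⟨⟨huv, p, q, Or.inr hup, Or.inr hvq, hpqK⟩, ?_⟩
      have hlpq : ℓ q = ℓ p := mem_of_reachable (Q := {x | ℓ x = ℓ p}) hpqK rfl
        fun x y h hx => (hKlayer x y h).symm.trans hx
      have h1 := hℓ hup
      have h2 := hℓ hvq
      have hmod : ℓ u % 4 = 0 ↔ ℓ v % 4 = 0 := by
        rw [hcodd p (hnot p hp), hceven u hu] at hcp
        rw [hceven u hu, hceven v hv] at hc
        revert hc hcp
        by_cases hu4 : ℓ u % 4 = 0 <;> by_cases hv4 : ℓ v % 4 = 0 <;>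
          cases f p <;> cases g u <;> cases g v <;> simp [hu4, hv4]
      have hu' : ℓ u % 2 = 0 := hu
      have hv' : ℓ v % 2 = 0 := hv
      omega

theorem HasLayeredSeparators.div {V : Type*} [Finite V] {G : SimpleGraph V} {ℓ : V → ℕ}
    {w D : ℕ} (hG : HasLayeredSeparators G ℓ w) (hD : 0 < D) :
    HasLayeredSeparators G (fun v => ℓ v / D) (D * w) := by
  intro B
  obtain ⟨P, hP, hsep⟩ := hG B
  refine ⟨P, fun i => ?_, hsep⟩
  have h := ncard_exists_le (↑(Finset.Ico (i * D) (i * D + D)) : Set ℕ)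
    (fun j v => v ∈ P ∧ ℓ v = j) w (fun j _ => hP j) (Finset.finite_toSet _)
  rw [Set.ncard_coe_finset, Nat.card_Ico, Nat.add_sub_cancel_left] at h
  refine le_trans (Set.ncard_le_ncard ?_ (Set.toFinite _)) h
  rintro v ⟨hvP, rfl⟩
  refine ⟨ℓ v, ?_, hvP, rfl⟩
  rw [Finset.mem_coe, Finset.mem_Ico]
  have h1 := Nat.div_mul_le_self (ℓ v) D
  have h2 := Nat.lt_div_mul_add hD (a := ℓ v)
  exact ⟨h1, h2⟩

theorem IsLayering.contract_div {V : Type*} [Finite V] {G K : SimpleGraph V} {ℓ : V → ℕ}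
    {d : ℕ} (hℓ : IsLayering G ℓ) (hKG : K ≤ G) (hK : ComponentsLE K d) :
    IsLayering (contract G K) (fun v => ℓ v / (d + 2)) := by
  rintro u v ⟨-, p, q, hp, hq, hpq⟩
  have h1 := hℓ.le_add_of_closedNeighbor hp
  have h2 := hℓ.le_add_of_closedNeighbor hq
  have h3 := hℓ.le_add_of_reachable hKG hK hpq
  have h4 := hℓ.le_add_of_reachable hKG hK hpq.symm
  have hpos : 0 < d + 2 := by omega
  constructor
  · rw [← Nat.add_div_right _ hpos]
    exact Nat.div_le_div_right (by omega)
  · rw [← Nat.add_div_right _ hpos]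
    exact Nat.div_le_div_right (by omega)

theorem exists_three_coloring_extending (w Δ d : ℕ) :
    ∃ N : ℕ, ∀ (V : Type u) [Finite V] (G : SimpleGraph V) (ℓ : V → ℕ),
      HasLayeredSeparators G ℓ w → IsLayering G ℓ → MaxDegreeLE G Δ →
        ∀ (S : Set V) (e : V → Fin 3), ComponentsLE (mono G S e) d →
          ∃ c : V → Fin 3, (∀ v ∈ S, c v = e v) ∧ ComponentsLE (mono G Set.univ c) N := by
  classical
  obtain ⟨N, hN⟩ := exists_three_coloring.{u} ((d + 2) * ((2 * d + 3) * w * d * (Δ + 1)))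
    ((Δ + 1) * d * (Δ + 1))
  refine ⟨d + N + N * Δ * d, fun V _ G ℓ hG hℓ hΔ S e he => ?_⟩
  have hKG : mono G S e ≤ G := fun _ _ h => h.1
  obtain ⟨c₁, hc₁⟩ := hN V (contract G (mono G S e)) _ ((hG.contract hℓ hΔ hKG he).div
    (Nat.succ_pos _)) (hℓ.contract_div hKG he) (maxDegreeLE_contract hΔ he)
  let c : V → Fin 3 := fun v => if v ∈ S then e v else c₁ v
  have hcS : ∀ v ∈ S, c v = e v := fun v hv => if_pos hv
  have hcn : ∀ v ∉ S, c v = c₁ v := fun v hv => if_neg hv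
  have hK : ∀ u v, (mono G Sᶜᶜ c).Adj u v → (mono G S e).Reachable u v := by
    rintro u v ⟨huv, hu, hv, hc⟩
    rw [compl_compl] at hu hv
    rw [hcS u hu, hcS v hv] at hc
    exact SimpleGraph.Adj.reachable ⟨huv, hu, hv, hc⟩
  refine ⟨c, hcS, componentsLE_mono_of_contract (Y := Sᶜ) (H := contract G (mono G S e)) hΔ
    (he.of_forall_reachable hK) (hc₁.of_forall_reachable ?_) ?_⟩
  · rintro u v ⟨huv, hu, hv, hc⟩
    rw [hcn u hu, hcn v hv] at hc
    exact SimpleGraph.Adj.reachable ⟨huv, trivial, trivial, hc⟩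
  · rintro u - v - huv - (h | ⟨p, q, -, -, hup, hvq, hpq⟩)
    · exact contract_adj_of_adj h
    · exact ⟨huv, p, q, Or.inr hup, Or.inr hvq, reachable_of_forall_adj hpq hK⟩

theorem ComponentsLE.hasClusteringLE {V α : Type*} [Finite V] {G : SimpleGraph V} {c : V → α}
    {N : ℕ} (h : ComponentsLE (mono G Set.univ c) N) : HasClusteringLE G Set.univ c N := by
  refine fun a => le_trans (Set.ncard_le_ncard ?_ (Set.toFinite _)) (h a)
  rintro b ⟨p, hp⟩
  have key : ∀ {x y : V} (p : G.Walk x y), (∀ v ∈ p.support, c v = c a) →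
      (mono G Set.univ c).Reachable x y := by
    intro x y p hp
    induction p with
    | nil => exact .rfl
    | @cons x y _ hadj q ih =>
      rw [Walk.support_cons] at hp
      have hx := hp x (by simp)
      have hy := hp y (by simp)
      exact (SimpleGraph.Adj.reachable (show (mono G Set.univ c).Adj x y from
        ⟨hadj, trivial, trivial, hx.trans hy.symm⟩)).trans
        (ih fun v hv => hp v (List.mem_cons_of_mem _ hv))
  exact key p fun v hv => (hp v hv).2

theorem exists_color_class_card_le {V : Type*} [Fintype V] (c : V → Fin 3) :
    ∃ i, Fintype.card V ≤ 3 * {v | c v = i}.ncard := by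
  classical
  by_contra! h
  have hsum := Finset.card_eq_sum_card_fiberwise (f := c) (s := Finset.univ) (t := Finset.univ)
    (fun _ _ => Finset.mem_coe.2 (Finset.mem_univ _))
  have heq : ∀ i, {v | c v = i}.ncard = (Finset.univ.filter fun v => c v = i).card := by
    intro i
    rw [Set.ncard_eq_toFinset_card']
    congr 1
    ext v
    simp
  simp only [heq] at h
  rw [Fin.sum_univ_three, Finset.card_univ] at hsum
  have h0 := h 0
  have h1 := h 1
  have h2 := h 2
  omega

theorem two_pow_ncard_le_of_forall_extends {V : Type*} [Finite V] (S : Set V)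
    (Q : Set (V → Fin 3))
    (h : ∀ p : V → Bool, ∃ c ∈ Q, ∀ v ∈ S, c v = if p v then 1 else 0) :
    2 ^ S.ncard ≤ Q.ncard := by
  classical
  choose c hcQ hc using fun p : S → Bool => h fun v => if hv : v ∈ S then p ⟨v, hv⟩ else false
  have hinj : Function.Injective c := by
    intro p q hpq
    funext v
    have h1 := hc p v v.2
    have h2 := hc q v v.2
    rw [hpq, h2] at h1
    simp only [Subtype.coe_eta, dif_pos v.2] at h1
    revert h1
    cases p v <;> cases q v <;> simp
  have hle := Set.ncard_le_ncard (Set.range_subset_iff.2 hcQ) (Set.toFinite _)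
  rwa [Set.ncard_range_of_injective hinj, Nat.card_fun, Nat.card_eq_fintype_card (α := Bool),
    Fintype.card_bool, Nat.card_coe_set_eq] at hle

end LayeredColoring

open LayeredColoring

/-- **Corollary.** For all positive integers `w` and `Δ`, there exists a positive integer
`N` such that every graph `G` with layered tree-width at most `w` and maximum degree at
most `Δ` has at least `2 ^ (|V(G)|/(3w))` different 3-colorings with clustering at
most `N`. -/
theorem layered_treewidth_exponentially_many_three_colorings (w Δ : ℕ)
    (hw : 0 < w) (hΔ : 0 < Δ) :
    ∃ N : ℕ, 0 < N ∧
      ∀ (V : Type u) [Fintype V] (G : SimpleGraph V),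
        LayeredTreewidthLE G w →
        MaxDegreeLE G Δ →
        (2 : ℝ) ^ ((Fintype.card V : ℝ) / (3 * (w : ℝ))) ≤
          ({c : V → Fin 3 | HasClusteringLE G Set.univ c N}.ncard : ℝ) := by
  obtain ⟨N₀, h₀⟩ := exists_three_coloring.{u} w Δ
  obtain ⟨N, hN⟩ := exists_three_coloring_extending.{u} w Δ N₀
  refine ⟨N + 1, Nat.succ_pos N, ?_⟩
  rintro V _ G ⟨ι, _, T, X, ℓ, hTX, hℓ, hw'⟩ hdeg
  have hG : HasLayeredSeparators G ℓ w := by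
    intro B
    obtain ⟨t, ht⟩ := exists_bag_separates hTX B
    exact ⟨X t, hw' t, ht⟩
  obtain ⟨c₀, hc₀⟩ := h₀ V G ℓ hG hℓ hdeg
  obtain ⟨i, hi⟩ := exists_color_class_card_le c₀
  have hcount : 2 ^ {v | c₀ v = i}.ncard ≤
      {c : V → Fin 3 | HasClusteringLE G Set.univ c (N + 1)}.ncard := by
    refine two_pow_ncard_le_of_forall_extends _ _ fun p => ?_
    obtain ⟨c, hc, hcN⟩ := hN V G ℓ hG hℓ hdeg {v | c₀ v = i} (fun v => if p v then 1 else 0)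
      (hc₀.of_forall_reachable fun u v h => SimpleGraph.Adj.reachable
        ⟨h.1, trivial, trivial, Eq.trans (b := i) h.2.1 h.2.2.1.symm⟩)
    exact ⟨c, fun a => (hcN.hasClusteringLE a).trans (Nat.le_succ N), hc⟩
  have hexp : (Fintype.card V : ℝ) / (3 * (w : ℝ)) ≤ ({v | c₀ v = i}.ncard : ℝ) := by
    have hw1 : (1 : ℝ) ≤ w := by exact_mod_cast hw
    have hi' : (Fintype.card V : ℝ) ≤ 3 * ({v | c₀ v = i}.ncard : ℝ) := by exact_mod_cast hi
    rw [div_le_iff₀ (by positivity)]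
    nlinarith [Nat.cast_nonneg (α := ℝ) {v | c₀ v = i}.ncard]
  calc (2 : ℝ) ^ ((Fintype.card V : ℝ) / (3 * (w : ℝ)))
      ≤ (2 : ℝ) ^ ({v | c₀ v = i}.ncard : ℝ) := Real.rpow_le_rpow_of_exponent_le one_le_two hexp
    _ = ((2 ^ {v | c₀ v = i}.ncard : ℕ) : ℝ) := by rw [Real.rpow_natCast]; push_cast; rfl
    _ ≤ _ := by exact_mod_cast hcount
end

section
/- There are infinitely many positive integers Δ with the following property: for every positive integer N, there exist a bipartite graph G with maximum degree at most Δ and a ⌊log₂Δ / (12 log₂log₂Δ)⌋-list-assignment L of G such that every L-coloring of G has weak diameter in G greater than N (that is, some monochromatic component of the coloring has weak diameter in G greater than N). -/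
open SimpleGraph

/-! ### Cubic edge-coloured graphs in which reduced words are geodesic -/

/-- The action of the letter `j` on words of length at most `r`: delete a leading `j`, or
prepend `j` if there is room. -/
def letterAct (r : ℕ) (j : Fin 3) (l : List (Fin 3)) : List (Fin 3) :=
  if l.head? = some j then l.tail else if l.length < r then j :: l else l

/-- Reduced words of length at most `r` in three involutive letters. -/
abbrev ReducedWord (r : ℕ) : Type :=
  {l : List (Fin 3) // l.IsChain (· ≠ ·) ∧ l.length ≤ r}

instance (r : ℕ) : Finite (ReducedWord r) :=
  Set.Finite.subset (List.finite_length_le (Fin 3) r) fun _ h => h.2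

lemma letterAct_mem {r : ℕ} (j : Fin 3) {l : List (Fin 3)}
    (h : l.IsChain (· ≠ ·) ∧ l.length ≤ r) :
    (letterAct r j l).IsChain (· ≠ ·) ∧ (letterAct r j l).length ≤ r := by
  unfold letterAct
  cases l with
  | nil => by_cases hr : 0 < r <;> simp [hr]; omega
  | cons a t =>
    obtain ⟨h1, h2⟩ := h
    simp only [List.length_cons] at h2
    by_cases ha : a = j
    · simp only [ha, List.head?_cons, if_true, List.tail_cons]
      exact ⟨h1.tail, by omega⟩
    · by_cases hr : t.length + 1 < r
      · simp only [List.head?_cons, Option.some.injEq, ha, if_false, List.length_cons, hr, if_true]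
        exact ⟨List.isChain_cons_cons.2 ⟨Ne.symm ha, h1⟩, by omega⟩
      · simp only [List.head?_cons, Option.some.injEq, ha, if_false, List.length_cons, hr]
        exact ⟨h1, h2⟩

lemma letterAct_letterAct {r : ℕ} (j : Fin 3) {l : List (Fin 3)}
    (h : l.IsChain (· ≠ ·) ∧ l.length ≤ r) : letterAct r j (letterAct r j l) = l := by
  unfold letterAct
  cases l with
  | nil => by_cases hr : 0 < r <;> simp [hr]
  | cons a t =>
    obtain ⟨h1, h2⟩ := h
    simp only [List.length_cons] at h2
    by_cases ha : a = j
    · subst ha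
      cases t with
      | nil => simp at h2 ⊢; omega
      | cons b s =>
        have hb := (List.isChain_cons_cons.1 h1).1
        simp only [List.length_cons] at h2
        simp [hb.symm]
        omega
    · by_cases hr : t.length + 1 < r <;> simp [ha, hr]

/-- `letterAct` as a permutation of the reduced words. -/
def letterPerm (r : ℕ) (j : Fin 3) : Equiv.Perm (ReducedWord r) :=
  Function.Involutive.toPerm (fun x => ⟨letterAct r j x.1, letterAct_mem j x.2⟩)
    fun x => Subtype.ext (letterAct_letterAct j x.2)

lemma letterPerm_mul_self (r : ℕ) (j : Fin 3) : letterPerm r j * letterPerm r j = 1 := by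
  ext1 x
  exact Subtype.ext (letterAct_letterAct j x.2)

lemma length_letterAct_le (r : ℕ) (j : Fin 3) (l : List (Fin 3)) :
    (letterAct r j l).length ≤ l.length + 1 := by
  unfold letterAct
  split_ifs <;> simp
  omega

lemma length_foldl_letterAct_le (r : ℕ) (w l : List (Fin 3)) :
    (w.foldl (fun x j => letterAct r j x) l).length ≤ l.length + w.length := by
  induction w generalizing l with
  | nil => simp
  | cons j w ih =>
    have := ih (letterAct r j l)
    have := length_letterAct_le r j l
    simp only [List.foldl_cons, List.length_cons]
    omega

lemma length_foldl_letterAct {r : ℕ} (w l : List (Fin 3)) (hw : w.IsChain (· ≠ ·))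
    (hl : ∀ a ∈ w.head?, l.head? ≠ some a) (hr : l.length + w.length ≤ r) :
    (w.foldl (fun x j => letterAct r j x) l).length = l.length + w.length := by
  induction w generalizing l with
  | nil => simp
  | cons j w ih =>
    simp only [List.length_cons] at hr
    have hj : letterAct r j l = j :: l := by
      unfold letterAct
      rw [if_neg (hl j (by simp)), if_pos (by omega)]
    rw [List.foldl_cons, hj, ih (j :: l) hw.tail]
    · simp only [List.length_cons]; omega
    · intro a ha
      cases w with
      | nil => simp at ha
      | cons b s =>
        have hb := (List.isChain_cons_cons.1 hw).1
        simp at ha ⊢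
        exact fun h => hb (h.trans ha.symm)
    · simp only [List.length_cons]; omega

lemma foldl_letterPerm_apply (r : ℕ) (w : List (Fin 3)) (u : Equiv.Perm (ReducedWord r))
    (x : ReducedWord r) :
    ((w.foldl (fun v j => letterPerm r j * v) u) x).1 =
      w.foldl (fun l j => letterAct r j l) (u x).1 := by
  induction w generalizing u with
  | nil => rfl
  | cons j w ih => rw [List.foldl_cons, List.foldl_cons, ih]; rfl

/-- There is a finite graph, given by three involutions, in which every reduced word of
length `r` is a geodesic. -/
lemma exists_involutions_reduced_geodesic (r : ℕ) :
    ∃ (Γ : Type) (_ : Fintype Γ) (_ : Nonempty Γ) (τ : Fin 3 → Γ → Γ),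
      (∀ j v, τ j (τ j v) = v) ∧
      ∀ (u : Γ) (w w' : List (Fin 3)), w.IsChain (· ≠ ·) → w.length = r →
        w'.foldl (fun v j => τ j v) u = w.foldl (fun v j => τ j v) u → r ≤ w'.length := by
  classical
  refine ⟨Equiv.Perm (ReducedWord r), Fintype.ofFinite _, ⟨1⟩, fun j v => letterPerm r j * v,
    fun j v => by
    simp only [← mul_assoc, letterPerm_mul_self, one_mul], ?_⟩
  intro u w w' hw hr h
  let root : ReducedWord r := ⟨[], by simp⟩
  have h1 := congrArg (fun p : Equiv.Perm (ReducedWord r) => (p (u.symm root)).1.length) h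
  simp only [foldl_letterPerm_apply, Equiv.apply_symm_apply, root] at h1
  rw [length_foldl_letterAct w [] hw (by simp) (by simp [hr])] at h1
  have := length_foldl_letterAct_le r w' []
  simp only [List.length_nil] at h1 this
  omega

/-! ### Long reduced walks in dense subgraphs -/

/-- If more than `2 |Γ|` darts are good, some nonempty set of vertices induces a good subgraph
of minimum degree at least two. -/
lemma exists_good_core {Γ : Type} [Fintype Γ] (τ : Fin 3 → Γ → Γ)
    (hτ : ∀ j v, τ j (τ j v) = v) (D : Finset (Γ × Fin 3))
    (hD : ∀ v j, (v, j) ∈ D → (τ j v, j) ∈ D) (hcard : 2 * Fintype.card Γ < D.card) :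
    ∃ S : Finset Γ, S.Nonempty ∧ ∀ v ∈ S, ∃ j₁ j₂ : Fin 3, j₁ ≠ j₂ ∧
      ((v, j₁) ∈ D ∧ τ j₁ v ∈ S) ∧ ((v, j₂) ∈ D ∧ τ j₂ v ∈ S) := by
  classical
  let e : Finset Γ → Finset (Γ × Fin 3) := fun S => D.filter fun p => p.1 ∈ S ∧ τ p.2 p.1 ∈ S
  obtain ⟨S, hS, hmin⟩ := Finset.exists_min_image
    (Finset.univ.filter fun S : Finset Γ => 2 * S.card < (e S).card) Finset.card
    ⟨Finset.univ, by simpa [e] using hcard⟩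
  simp only [Finset.mem_filter, Finset.mem_univ, true_and] at hS hmin
  refine ⟨S, ?_, fun v hv => ?_⟩
  · rw [Finset.nonempty_iff_ne_empty]
    rintro rfl
    simp [e] at hS
  let J := Finset.univ.filter fun j : Fin 3 => (v, j) ∈ D ∧ τ j v ∈ S
  have hsub : e S ⊆ e (S.erase v) ∪ (J.image (fun j => (v, j)) ∪ J.image fun j => (τ j v, j)) := by
    rintro ⟨x, j⟩ hx
    simp only [e, Finset.mem_filter] at hx
    obtain ⟨h1, h2, h3⟩ := hx
    simp only [e, J, Finset.mem_union, Finset.mem_filter, Finset.mem_image, Finset.mem_erase,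
      Finset.mem_univ, true_and, Prod.mk.injEq]
    by_cases hxv : x = v
    · subst hxv
      exact Or.inr (Or.inl ⟨j, ⟨h1, h3⟩, rfl, rfl⟩)
    by_cases hyv : τ j x = v
    · refine Or.inr (Or.inr ⟨j, ⟨hyv ▸ hD _ _ h1, ?_⟩, ?_, rfl⟩)
      · rw [← hyv, hτ]; exact h2
      · rw [← hyv, hτ]
    · exact Or.inl ⟨h1, ⟨hxv, h2⟩, hyv, h3⟩
  have hle := (Finset.card_le_card hsub).trans (Finset.card_union_le _ _)
  have hle2 := Finset.card_union_le (J.image fun j => (v, j)) (J.image fun j => (τ j v, j))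
  have h1 : (J.image fun j => (v, j)).card ≤ J.card := Finset.card_image_le
  have h2 : (J.image fun j => (τ j v, j)).card ≤ J.card := Finset.card_image_le
  have hpos : 0 < S.card := Finset.card_pos.2 ⟨v, hv⟩
  have herase := Finset.card_erase_of_mem hv
  have hlt : (e (S.erase v)).card ≤ 2 * (S.erase v).card := by
    by_contra! h
    have := hmin _ h
    omega
  obtain ⟨a, ha, b, hb, hab⟩ := Finset.one_lt_card.1 (show 1 < J.card by omega)
  exact ⟨a, b, hab, by simpa [J] using ha, by simpa [J] using hb⟩

lemma exists_reduced_walk_of_core {Γ : Type} (τ : Fin 3 → Γ → Γ) (D : Finset (Γ × Fin 3))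
    (S : Finset Γ)
    (hS : ∀ v ∈ S, ∃ j₁ j₂ : Fin 3, j₁ ≠ j₂ ∧
      ((v, j₁) ∈ D ∧ τ j₁ v ∈ S) ∧ ((v, j₂) ∈ D ∧ τ j₂ v ∈ S)) (n : ℕ) :
    ∀ v ∈ S, ∀ j₀ : Fin 3, ∃ w : List (Fin 3), w.length = n ∧ (j₀ :: w).IsChain (· ≠ ·) ∧
      Relation.ReflTransGen (fun x y => ∃ j, (x, j) ∈ D ∧ y = τ j x) v
        (w.foldl (fun x j => τ j x) v) := by
  induction n with
  | zero => exact fun v _ j₀ => ⟨[], rfl, by simp, Relation.ReflTransGen.refl⟩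
  | succ n ih =>
    intro v hv j₀
    obtain ⟨j, hj, hD, hjS⟩ : ∃ j, j₀ ≠ j ∧ (v, j) ∈ D ∧ τ j v ∈ S := by
      obtain ⟨j₁, j₂, hne, h1, h2⟩ := hS v hv
      by_cases h : j₀ = j₁
      · exact ⟨j₂, h ▸ hne, h2⟩
      · exact ⟨j₁, h, h1⟩
    obtain ⟨w, hw, hc, hr⟩ := ih _ hjS j
    exact ⟨j :: w, by simp [hw], List.isChain_cons_cons.2 ⟨hj, hc⟩,
      Relation.ReflTransGen.head ⟨j, hD, rfl⟩ hr⟩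

/-! ### The bipartite blow-up -/

/-- The vertices and the darts of the graph given by `τ`, each blown up to a copy of `P`; a dart
is joined to both of its ends. -/
def blowUp {Γ : Type} (τ : Fin 3 → Γ → Γ) (P : Type) :
    SimpleGraph (Γ × P ⊕ (Γ × Fin 3) × P) :=
  SimpleGraph.fromRel fun x y =>
    ∃ u S v j T, x = Sum.inl (u, S) ∧ y = Sum.inr ((v, j), T) ∧ (u = v ∨ u = τ j v)

lemma blowUp_adj_inl_inr {Γ : Type} (τ : Fin 3 → Γ → Γ) {P : Type} {u v : Γ} {j : Fin 3}
    {S T : P} (h : u = v ∨ u = τ j v) :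
    (blowUp τ P).Adj (Sum.inl (u, S)) (Sum.inr ((v, j), T)) := by
  rw [blowUp, SimpleGraph.fromRel_adj]
  exact ⟨by simp, Or.inl ⟨u, S, v, j, T, rfl, rfl, h⟩⟩

lemma blowUp_colorable {Γ : Type} (τ : Fin 3 → Γ → Γ) (P : Type) :
    (blowUp τ P).Colorable 2 := by
  refine ⟨SimpleGraph.Coloring.mk (Sum.elim (fun _ => 0) fun _ => 1) ?_⟩
  intro x y h
  rw [blowUp, SimpleGraph.fromRel_adj] at h
  obtain ⟨-, ⟨u, S, v, j, T, rfl, rfl, -⟩ | ⟨u, S, v, j, T, rfl, rfl, -⟩⟩ := h <;> simp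

lemma blowUp_maxDegreeLE {Γ : Type} (τ : Fin 3 → Γ → Γ) (hτ : ∀ j v, τ j (τ j v) = v)
    (P : Type) [Fintype P] : MaxDegreeLE (blowUp τ P) (6 * Fintype.card P) := by
  rintro (⟨u, S⟩ | ⟨⟨v, j⟩, T⟩)
  · have hsub : (blowUp τ P).neighborSet (Sum.inl (u, S)) ⊆ Set.range
        (fun q : (Fin 3 × Bool) × P =>
          Sum.inr ((if q.1.2 then u else τ q.1.1 u, q.1.1), q.2)) := by
      intro y hy
      rw [SimpleGraph.mem_neighborSet, blowUp, SimpleGraph.fromRel_adj] at hy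
      obtain ⟨-, ⟨u', S', v, j, T, h, rfl, h'⟩ | ⟨u', S', v, j, T, -, h, -⟩⟩ := hy
      · simp only [Sum.inl.injEq, Prod.mk.injEq] at h
        obtain ⟨rfl, rfl⟩ := h
        rcases h' with rfl | rfl
        · exact ⟨((j, true), T), by simp⟩
        · exact ⟨((j, false), T), by simp [hτ]⟩
      · simp at h
    refine (Set.ncard_le_ncard hsub (Set.finite_range _)).trans ?_
    rw [← Set.image_univ]
    refine (Set.ncard_image_le Set.finite_univ).trans ?_
    simp [Set.ncard_univ]
  · have hsub : (blowUp τ P).neighborSet (Sum.inr ((v, j), T)) ⊆ Set.range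
        (fun q : Bool × P => Sum.inl (if q.1 then v else τ j v, q.2)) := by
      intro y hy
      rw [SimpleGraph.mem_neighborSet, blowUp, SimpleGraph.fromRel_adj] at hy
      obtain ⟨-, ⟨u', S', v', j', T', h, -, -⟩ | ⟨u', S', v', j', T', rfl, h, h'⟩⟩ := hy
      · simp at h
      · simp only [Sum.inr.injEq, Prod.mk.injEq] at h
        obtain ⟨⟨rfl, rfl⟩, rfl⟩ := h
        rcases h' with rfl | rfl
        · exact ⟨(true, S'), by simp⟩
        · exact ⟨(false, S'), by simp⟩
    refine (Set.ncard_le_ncard hsub (Set.finite_range _)).trans ?_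
    rw [← Set.image_univ]
    refine (Set.ncard_image_le Set.finite_univ).trans ?_
    simp [Set.ncard_univ]
    omega

/-- The vertex of the base graph below a vertex of the blow-up. -/
def blowUpBase {Γ P : Type} : Γ × P ⊕ (Γ × Fin 3) × P → Γ :=
  Sum.elim Prod.fst fun x => x.1.1

lemma exists_word_of_walk {Γ : Type} (τ : Fin 3 → Γ → Γ) (hτ : ∀ j v, τ j (τ j v) = v)
    {P : Type} {x y : Γ × P ⊕ (Γ × Fin 3) × P} (p : (blowUp τ P).Walk x y) :
    ∃ w : List (Fin 3), w.length ≤ p.length ∧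
      w.foldl (fun v j => τ j v) (blowUpBase x) = blowUpBase y := by
  induction p with
  | nil => exact ⟨[], by simp⟩
  | cons h p ih =>
    rename_i a b c
    obtain ⟨w, hw, hf⟩ := ih
    have key : blowUpBase a = blowUpBase b ∨ ∃ j, τ j (blowUpBase a) = blowUpBase b := by
      rw [blowUp, SimpleGraph.fromRel_adj] at h
      obtain ⟨-, ⟨u, S, v, j, T, rfl, rfl, rfl | rfl⟩ | ⟨u, S, v, j, T, rfl, rfl, rfl | rfl⟩⟩ := h
      · exact Or.inl rfl
      · exact Or.inr ⟨j, hτ j v⟩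
      · exact Or.inl rfl
      · exact Or.inr ⟨j, rfl⟩
    rcases key with h | ⟨j, hj⟩
    · exact ⟨w, by simp; omega, h ▸ hf⟩
    · exact ⟨j :: w, by simpa using hw, by simpa [hj] using hf⟩

/-! ### Monochromatic components -/

lemma MonoReach.refl {β α : Type*} (G : SimpleGraph β) (c : β → α) (a : β) :
    MonoReach G Set.univ c a a :=
  ⟨SimpleGraph.Walk.nil, by simp⟩

lemma MonoReach.cons {β α : Type*} {G : SimpleGraph β} {c : β → α} {a b d : β}
    (h : MonoReach G Set.univ c a b) (hbd : G.Adj b d) (hd : c d = c a) :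
    MonoReach G Set.univ c a d := by
  obtain ⟨w, hw⟩ := h
  refine ⟨w.concat hbd, fun v hv => ⟨trivial, ?_⟩⟩
  rw [SimpleGraph.Walk.support_concat, List.mem_append, List.mem_singleton] at hv
  rcases hv with hv | rfl
  · exact (hw v hv).2
  · exact hd

/-- If each `k`-subset of `range K` contributes one of its elements, fewer than `k` elements of
`range K` are missed. -/
lemma card_missed_lt {k K : ℕ} (f : Finset.powersetCard k (Finset.range K) → ℕ)
    (hf : ∀ S, f S ∈ S.1) :
    ((Finset.range K).filter (· ∉ Finset.univ.image f)).card < k := by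
  by_contra! h
  obtain ⟨S, hS, hk⟩ := Finset.exists_subset_card_eq h
  have hmem : S ∈ Finset.powersetCard k (Finset.range K) :=
    Finset.mem_powersetCard.2 ⟨hS.trans (Finset.filter_subset _ _), hk⟩
  exact (Finset.mem_filter.1 (hS (hf ⟨S, hmem⟩))).2 (Finset.mem_image_of_mem f (Finset.mem_univ _))

/-- For some colour `i < 12 k`, all but less than a third of the darts of the cubic graph are such
that the colour `i` occurs at both ends and at both of the orientations of the dart. -/
lemma exists_color_many_good {Γ : Type} [Fintype Γ] [Nonempty Γ] (τ : Fin 3 → Γ → Γ) {k : ℕ}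
    (A : Γ → Finset ℕ) (B : Γ × Fin 3 → Finset ℕ)
    (hA : ∀ v, ((Finset.range (12 * k)).filter (· ∉ A v)).card < k)
    (hB : ∀ p, ((Finset.range (12 * k)).filter (· ∉ B p)).card < k) :
    ∃ i, 2 * Fintype.card Γ < (Finset.univ.filter fun p : Γ × Fin 3 =>
      (i ∈ A p.1 ∧ i ∈ A (τ p.2 p.1)) ∧ i ∈ B p ∧ i ∈ B (τ p.2 p.1, p.2)).card := by
  classical
  by_contra! h
  let good : ℕ → Γ × Fin 3 → Prop := fun i p =>
    (i ∈ A p.1 ∧ i ∈ A (τ p.2 p.1)) ∧ i ∈ B p ∧ i ∈ B (τ p.2 p.1, p.2)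
  have hgood : ∀ p : Γ × Fin 3,
      8 * k + 4 ≤ ((Finset.range (12 * k)).filter fun i => good i p).card := by
    intro p
    have hsub : Finset.range (12 * k) ⊆ ((Finset.range (12 * k)).filter fun i => good i p) ∪
        ((((Finset.range (12 * k)).filter (· ∉ A p.1)) ∪
          ((Finset.range (12 * k)).filter (· ∉ A (τ p.2 p.1)))) ∪
        (((Finset.range (12 * k)).filter (· ∉ B p)) ∪
          ((Finset.range (12 * k)).filter (· ∉ B (τ p.2 p.1, p.2))))) := by
      intro i hi
      simp only [Finset.mem_union, Finset.mem_filter, hi, true_and, good]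
      tauto
    have h0 := Finset.card_le_card hsub
    have h1 := h0.trans (Finset.card_union_le _ _)
    have h2 := Finset.card_union_le
      (((Finset.range (12 * k)).filter (· ∉ A p.1)) ∪
        ((Finset.range (12 * k)).filter (· ∉ A (τ p.2 p.1))))
      (((Finset.range (12 * k)).filter (· ∉ B p)) ∪
        ((Finset.range (12 * k)).filter (· ∉ B (τ p.2 p.1, p.2))))
    have h3 := Finset.card_union_le ((Finset.range (12 * k)).filter (· ∉ A p.1))
      ((Finset.range (12 * k)).filter (· ∉ A (τ p.2 p.1)))
    have h4 := Finset.card_union_le ((Finset.range (12 * k)).filter (· ∉ B p))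
      ((Finset.range (12 * k)).filter (· ∉ B (τ p.2 p.1, p.2)))
    have := hA p.1
    have := hA (τ p.2 p.1)
    have := hB p
    have := hB (τ p.2 p.1, p.2)
    rw [Finset.card_range] at h1
    omega
  have hswap := Finset.sum_card_bipartiteAbove_eq_sum_card_bipartiteBelow
    (s := Finset.range (12 * k)) (t := (Finset.univ : Finset (Γ × Fin 3))) good
  have hle : ∑ i ∈ Finset.range (12 * k), (Finset.univ.bipartiteAbove good i).card ≤
      12 * k * (2 * Fintype.card Γ) := by
    refine (Finset.sum_le_card_nsmul _ _ _ fun i _ => h i).trans ?_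
    simp
  have hge : Fintype.card Γ * 3 * (8 * k + 4) ≤
      ∑ p : Γ × Fin 3, ((Finset.range (12 * k)).bipartiteBelow good p).card := by
    refine le_trans ?_ (Finset.card_nsmul_le_sum _ _ _ fun p _ => hgood p)
    simp
  have hpos : 0 < Fintype.card Γ := Fintype.card_pos
  nlinarith

/-- Every colouring of the blow-up from the `k`-subsets of `range (12 * k)` has a monochromatic
component of large weak diameter. -/
lemma exists_bipartite_list_large_weak_diameter (k N : ℕ) :
    ∃ (V : Type) (_ : Fintype V) (G : SimpleGraph V) (L : V → Finset ℕ),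
      G.Colorable 2 ∧ MaxDegreeLE G (6 * (12 * k).choose k) ∧ (∀ x, (L x).card = k) ∧
      ∀ c : V → ℕ, (∀ x, c x ∈ L x) →
        ∃ a b : V, MonoReach G Set.univ c a b ∧ N < G.dist a b := by
  classical
  obtain ⟨Γ, _, _, τ, hτ, hfar⟩ := exists_involutions_reduced_geodesic (N + 1)
  let P : Type := Finset.powersetCard k (Finset.range (12 * k))
  refine ⟨Γ × P ⊕ (Γ × Fin 3) × P, inferInstance, blowUp τ P,
    Sum.elim (fun x => x.2.1) (fun x => x.2.1), blowUp_colorable τ P, ?_, ?_, ?_⟩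
  · have := blowUp_maxDegreeLE τ hτ P
    rwa [show Fintype.card P = (12 * k).choose k by simp [P]] at this
  · rintro (⟨u, S⟩ | ⟨p, S⟩) <;> exact (Finset.mem_powersetCard.1 S.2).2
  intro c hc
  let A : Γ → Finset ℕ := fun v => Finset.univ.image fun S : P => c (Sum.inl (v, S))
  let B : Γ × Fin 3 → Finset ℕ := fun p => Finset.univ.image fun S : P => c (Sum.inr (p, S))
  obtain ⟨i, hi⟩ := exists_color_many_good τ A B
    (fun v => card_missed_lt (fun S => c (Sum.inl (v, S))) fun S => hc (Sum.inl (v, S)))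
    (fun p => card_missed_lt (fun S => c (Sum.inr (p, S))) fun S => hc (Sum.inr (p, S)))
  set D := Finset.univ.filter fun p : Γ × Fin 3 =>
      (i ∈ A p.1 ∧ i ∈ A (τ p.2 p.1)) ∧ i ∈ B p ∧ i ∈ B (τ p.2 p.1, p.2) with hDdef
  have hDsymm : ∀ v j, (v, j) ∈ D → (τ j v, j) ∈ D := by
    intro v j h
    simp only [hDdef, Finset.mem_filter, Finset.mem_univ, true_and, hτ] at h ⊢
    tauto
  obtain ⟨S, ⟨u, hu⟩, hS⟩ := exists_good_core τ hτ D hDsymm hi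
  obtain ⟨w, hw, hchain, hreach⟩ := exists_reduced_walk_of_core τ D S hS (N + 1) u hu 0
  obtain ⟨X, hX⟩ : ∃ X : P, c (Sum.inl (u, X)) = i := by
    obtain ⟨j, _, _, ⟨h, _⟩, _⟩ := hS u hu
    simpa [A] using (Finset.mem_filter.1 h).2.1.1
  obtain ⟨Y, hY⟩ : ∃ Y : P, MonoReach (blowUp τ P) Set.univ c (Sum.inl (u, X))
      (Sum.inl (w.foldl (fun x j => τ j x) u, Y)) := by
    generalize w.foldl (fun x j => τ j x) u = v at hreach ⊢
    induction hreach with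
    | refl => exact ⟨X, MonoReach.refl _ _ _⟩
    | tail _ hstep ih =>
      obtain ⟨Y, hY⟩ := ih
      obtain ⟨j, hj, rfl⟩ := hstep
      obtain ⟨⟨-, h2⟩, h3, -⟩ := (Finset.mem_filter.1 hj).2
      simp only [A, B, Finset.mem_image, Finset.mem_univ, true_and] at h2 h3
      obtain ⟨Z, hZ⟩ := h2
      obtain ⟨T, hT⟩ := h3
      exact ⟨Z, (hY.cons (blowUp_adj_inl_inr τ (Or.inl rfl)) (hT.trans hX.symm)).cons
        (blowUp_adj_inl_inr τ (Or.inr rfl)).symm (hZ.trans hX.symm)⟩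
  refine ⟨_, _, hY, ?_⟩
  obtain ⟨q, -⟩ := hY
  obtain ⟨p, hp⟩ := q.reachable.exists_walk_length_eq_dist
  obtain ⟨w', hw', hf⟩ := exists_word_of_walk τ hτ p
  have := hfar u w w' hchain.tail hw hf
  omega

lemma twelve_mul_lt_two_pow {t : ℕ} (ht : 7 ≤ t) : 12 * t < 2 ^ t := by
  induction t, ht using Nat.le_induction with
  | base => norm_num
  | succ t ht ih => rw [pow_succ]; omega

lemma six_mul_choose_le {k t : ℕ} (ht : 7 ≤ t) (h : k * (12 * t) ≤ 2 ^ t) :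
    6 * (12 * k).choose k ≤ 2 ^ 2 ^ t := by
  have h1 : (12 * k).choose k ≤ 2 ^ (12 * k) := Nat.choose_le_two_pow _ _
  have h2 := twelve_mul_lt_two_pow ht
  have h3 : 12 * k + 3 ≤ 2 ^ t := by nlinarith
  calc 6 * (12 * k).choose k ≤ 2 ^ 3 * 2 ^ (12 * k) := Nat.mul_le_mul (by norm_num) h1
    _ = 2 ^ (12 * k + 3) := by rw [← pow_add, add_comm]
    _ ≤ 2 ^ 2 ^ t := Nat.pow_le_pow_right (by norm_num) h3

/-- **Theorem.** There are infinitely many positive integers `Δ` such that for every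
positive integer `N`, there exist a bipartite graph `G` with maximum degree at most `Δ`
and a `⌊log₂ Δ / (12 log₂ log₂ Δ)⌋`-list-assignment `L` of `G` such that every
`L`-coloring of `G` has weak diameter in `G` greater than `N`, i.e. some monochromatic
component contains two vertices at distance greater than `N` in `G`. -/
theorem bipartite_weak_diameter_list_lower_bound :
    {Δ : ℕ | 0 < Δ ∧
      ∀ N : ℕ, 0 < N →
        ∃ (V : Type) (_ : Fintype V) (G : SimpleGraph V) (L : V → Finset ℕ),
          G.Colorable 2 ∧
          MaxDegreeLE G Δ ∧
          (∀ x, (L x).Nonempty) ∧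
          (∀ x, (L x).card =
            ⌊Real.logb 2 (Δ : ℝ) / (12 * Real.logb 2 (Real.logb 2 (Δ : ℝ)))⌋₊) ∧
          ∀ c : V → ℕ, (∀ x, c x ∈ L x) →
            ∃ a b : V, MonoReach G Set.univ c a b ∧ N < G.dist a b}.Infinite := by
  refine Set.infinite_of_injective_forall_mem (f := fun s : ℕ => 2 ^ 2 ^ (s + 7)) ?_ ?_
  · intro a b h
    have := Nat.pow_right_injective le_rfl (Nat.pow_right_injective le_rfl h)
    omega
  intro s
  refine ⟨by positivity, fun N _ => ?_⟩
  have h1 : Real.logb 2 ((2 ^ 2 ^ (s + 7) : ℕ) : ℝ) = ((2 ^ (s + 7) : ℕ) : ℝ) := by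
    push_cast
    rw [Real.logb_pow, Real.logb_self_eq_one one_lt_two, mul_one]
    push_cast
    rfl
  have h2 : Real.logb 2 ((2 ^ (s + 7) : ℕ) : ℝ) = ((s + 7 : ℕ) : ℝ) := by
    push_cast
    rw [Real.logb_pow, Real.logb_self_eq_one one_lt_two, mul_one]
    push_cast
    rfl
  have hfloor : ⌊Real.logb 2 ((2 ^ 2 ^ (s + 7) : ℕ) : ℝ) /
      (12 * Real.logb 2 (Real.logb 2 ((2 ^ 2 ^ (s + 7) : ℕ) : ℝ)))⌋₊ =
      2 ^ (s + 7) / (12 * (s + 7)) := by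
    rw [h1, h2, ← Nat.floor_div_eq_div (K := ℝ)]
    push_cast
    rfl
  have hk : 0 < 2 ^ (s + 7) / (12 * (s + 7)) :=
    Nat.div_pos (twelve_mul_lt_two_pow (by omega)).le (by omega)
  obtain ⟨V, hV, G, L, hcol, hdeg, hL, hmain⟩ :=
    exists_bipartite_list_large_weak_diameter (2 ^ (s + 7) / (12 * (s + 7))) N
  refine ⟨V, hV, G, L, hcol, fun v => (hdeg v).trans ?_, fun x => ?_, fun x => ?_, hmain⟩
  · exact six_mul_choose_le (by omega) (Nat.div_mul_le_self _ _)
  · rw [← Finset.card_pos, hL]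
    exact hk
  · rw [hfloor, hL]
end
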